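/- (Main Theorem, sufficiency.) Let k ≥ 1, d ≥ 2 be integers with k < 2d and ε ∈ (0,1]. Let S : Σ_d^dual → Simp_{2d−2} be continuous (product topology) and suppose there exists C > 0 such that for all j ≠ j' in Σ_d^dual and every j₀ ∈ {1,…,d}, the intersection D^k_var(C·ρ_S(j₀·j, j₀·j')^{k+ε−1})(A(j₀·j), A(j₀·j')) ∩ R_{j₀}( D^k_var(C·ρ_S(j,j')^{k+ε−1})(A(j), A(j')) ) is nonempty. Then there exists a C^{k+ε} Cantor system on [0,1] with d branches whose scaling function equals S. -/

import Mathlib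

open Set Filter

noncomputable section

/-- The unit interval `[0,1] ⊆ ℝ`. -/
abbrev I01 : Set ℝ := Set.Icc (0:ℝ) 1

/-- `ψ` satisfies an `ε`-Hölder bound with constant `H` on `[0,1]`. -/
def HolderBoundOn01 (ε H : ℝ) (ψ : ℝ → ℝ) : Prop :=
  ∀ x ∈ I01, ∀ y ∈ I01, |ψ x - ψ y| ≤ H * |x - y| ^ ε

/-- A `C^{k+ε}` Cantor system on `[0,1]` with `d` branches: each branch `g i` is a
`C^k` increasing contraction of `[0,1]` with `ε`-Hölder `k`-th derivative, the images
`g i ([0,1])` are disjoint closed intervals in increasing order, `g 0 0 = 0` and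
`g (d-1) 1 = 1`. -/
structure IsCantorSystem {d : ℕ} (k : ℕ) (ε : ℝ) (g : Fin d → ℝ → ℝ) : Prop where
  maps : ∀ i, Set.MapsTo (g i) I01 I01
  smooth : ∀ i, ContDiffOn ℝ k (g i) I01
  holder : ∀ i, ∃ H > 0, HolderBoundOn01 ε H (iteratedDerivWithin k (g i) I01)
  deriv_pos : ∀ i, ∀ x ∈ I01, 0 < derivWithin (g i) I01 x
  deriv_lt_one : ∀ i, ∀ x ∈ I01, derivWithin (g i) I01 x < 1
  ordered : ∀ i j : Fin d, i < j → g i 1 < g j 0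
  first : ∀ i : Fin d, (i : ℕ) = 0 → g i 0 = 0
  last : ∀ i : Fin d, (i : ℕ) = d - 1 → g i 1 = 1

/-- For a finite word `w = [w₁,…,wₙ]`, `wordMap g w = g_{wₙ} ∘ ⋯ ∘ g_{w₁}` (i.e. `G_w`). -/
def wordMap {d : ℕ} (g : Fin d → ℝ → ℝ) : List (Fin d) → ℝ → ℝ
  | [] => id
  | i :: w => fun x => wordMap g w (g i x)

/-- `|I_w|`, the length of the interval `I_w = G_w([0,1]) = [G_w 0, G_w 1]`. -/
def wordLen {d : ℕ} (g : Fin d → ℝ → ℝ) (w : List (Fin d)) : ℝ :=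
  wordMap g w 1 - wordMap g w 0

/-- The scaling data of the word `w`: the first `d` coordinates are the ratios
`|I_{i·w}|/|I_w|`, the last `d-1` coordinates are the `d-1` gap lengths between the
consecutive children `I_{1·w},…,I_{d·w}` divided by `|I_w|`. -/
def scalingData {d : ℕ} (g : Fin d → ℝ → ℝ) (w : List (Fin d)) : Fin (2*d-1) → ℝ :=
  fun m =>
    if h : (m : ℕ) < d then
      wordLen g ((⟨(m : ℕ), h⟩ : Fin d) :: w) / wordLen g w
    else
      (wordMap g w (g ⟨(m : ℕ) - d + 1, by have := m.isLt; omega⟩ 0)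
        - wordMap g w (g ⟨(m : ℕ) - d, by have := m.isLt; omega⟩ 1)) / wordLen g w

/-- The open simplex `Simp_{2d-2} ⊆ (0,1)^{2d-1}` of vectors with coordinate sum `1`. -/
def Simp (d : ℕ) : Set (Fin (2*d-1) → ℝ) :=
  {s | (∀ m, s m ∈ Set.Ioo (0:ℝ) 1) ∧ ∑ m, s m = 1}

/-- The initial word `j|_n = (j_1,…,j_n)` of a sequence `j ∈ Σ_d^dual = {1,…,d}^ℕ`. -/
def dword {d : ℕ} (j : ℕ → Fin d) (n : ℕ) : List (Fin d) :=
  List.ofFn (fun i : Fin n => j i)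

/-- `S` is the scaling function of the system `g`:
`S(j) = lim_{n→∞} S_n(j|_n)` for every `j ∈ Σ_d^dual`. -/
def HasScalingFunction {d : ℕ} (g : Fin d → ℝ → ℝ) (S : (ℕ → Fin d) → Fin (2*d-1) → ℝ) : Prop :=
  ∀ j : ℕ → Fin d,
    Filter.Tendsto (fun n => scalingData g (dword j n)) Filter.atTop (nhds (S j))

/-- `ρ_S(j,j')` where `n = #(j∩j')`:
`ρ_S(j,j') = sup_w ∏_{t=1}^{n} S((j_{t+1},…,j_n)·w)_{j_t}` (depends only on `j` and `n`). -/
def rhoS {d : ℕ} (S : (ℕ → Fin d) → Fin (2*d-1) → ℝ) (j : ℕ → Fin d) (n : ℕ) : ℝ :=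
  ⨆ w : ℕ → Fin d, ∏ t ∈ Finset.range n,
    S (fun m => if t + 1 + m < n then j (t + 1 + m) else w (t + 1 + m - n))
      ⟨((j t) : ℕ), by have := (j t).isLt; omega⟩

/-- Given a scaling vector `s ∈ Simp_{2d-2}`, the partition of `[0,1]` it determines has
`i`-th child interval starting at `childLeft s i = ∑_{m<i} (s_m + s_{d+m})`. -/
def childLeft {d : ℕ} (s : Fin (2*d-1) → ℝ) (i : Fin d) : ℝ :=
  ∑ m ∈ (Finset.range (i : ℕ)).attach,
    (s ⟨(m : ℕ), by have h := Finset.mem_range.mp m.2; have := i.isLt; omega⟩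
      + s ⟨d + (m : ℕ), by have h := Finset.mem_range.mp m.2; have := i.isLt; omega⟩)

/-- The right endpoint of the `i`-th child interval of the partition determined by `s`. -/
def childRight {d : ℕ} (s : Fin (2*d-1) → ℝ) (i : Fin d) : ℝ :=
  childLeft s i + s ⟨(i : ℕ), by have := i.isLt; omega⟩

/-- `A(j)`: the set of `2d` endpoints of the `d` child intervals of the partition of `[0,1]`
determined by the scaling vector `s = S(j)`. -/
def Apts {d : ℕ} (s : Fin (2*d-1) → ℝ) : Set ℝ :=
  ⋃ i : Fin d, {childLeft s i, childRight s i}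

/-- An increasing `C^k` diffeomorphism of `[0,1]`. -/
structure IsDiffeo01 (k : ℕ) (φ : ℝ → ℝ) : Prop where
  smooth : ContDiffOn ℝ k φ I01
  mono : StrictMonoOn φ I01
  deriv_pos : ∀ x ∈ I01, 0 < derivWithin φ I01 x
  bij : Set.BijOn φ I01 I01

/-- `D^k(A₁,A₂)`: increasing `C^k` diffeomorphisms of `[0,1]` mapping `A₁` onto `A₂`. -/
def Dk (k : ℕ) (A₁ A₂ : Set ℝ) : Set (ℝ → ℝ) :=
  {φ | IsDiffeo01 k φ ∧ φ '' A₁ = A₂}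

/-- `D^k_var(M)(A₁,A₂)`: members of `D^k(A₁,A₂)` whose `k`-th derivative has variation `< M`. -/
def DkVar (k : ℕ) (M : ℝ) (A₁ A₂ : Set ℝ) : Set (ℝ → ℝ) :=
  {φ | φ ∈ Dk k A₁ A₂ ∧ ∀ x ∈ I01, ∀ y ∈ I01,
    |iteratedDerivWithin k φ I01 x - iteratedDerivWithin k φ I01 y| < M}

/-- The renormalization `(L')⁻¹ ∘ φ ∘ L` of `φ`, where `L, L'` are the increasing affine
bijections from `[0,1]` onto `[a,b]` and `[a',b']` respectively. -/
def renorm (a b a' b' : ℝ) (φ : ℝ → ℝ) : ℝ → ℝ :=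
  fun x => (φ (a + (b - a) * x) - a') / (b' - a')

/-- `R_{j₀} φ`: restrict `φ` to the `j₀`-th child interval of the partition determined by `s`
(mapped to the `j₀`-th child interval of the partition determined by `s'`) and renormalize. -/
def Rmap {d : ℕ} (s s' : Fin (2*d-1) → ℝ) (j₀ : Fin d) (φ : ℝ → ℝ) : ℝ → ℝ :=
  renorm (childLeft s j₀) (childRight s j₀) (childLeft s' j₀) (childRight s' j₀) φ

/-- `j₀·j = (j₀, j_1, j_2, …)`. -/
def consSeq {d : ℕ} (j₀ : Fin d) (j : ℕ → Fin d) : ℕ → Fin d :=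
  fun m => if m = 0 then j₀ else j (m - 1)

/-- The Cantor set of the system: `C = ⋂_{n ≥ 1} ⋃_{w of length n} I_w`. -/
def systemCantorSet {d : ℕ} (g : Fin d → ℝ → ℝ) : Set ℝ :=
  ⋂ n : ℕ, ⋃ w ∈ {w : List (Fin d) | w.length = n + 1}, wordMap g w '' I01

end

/-- `F m` has derivative `F (m + 1)` along `s` for every `m < k`. -/
def IsJet (k : ℕ) (s : Set ℝ) (F : ℕ → ℝ → ℝ) : Prop :=
  ∀ m < k, ∀ x ∈ s, HasDerivWithinAt (F m) (F (m + 1) x) s x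

lemma IsJet.shift {k : ℕ} {s : Set ℝ} {F : ℕ → ℝ → ℝ} (h : IsJet (k + 1) s F) :
    IsJet k s (fun m => F (m + 1)) :=
  fun m hm x hx => h (m + 1) (by omega) x hx

lemma IsJet.mono_set {k : ℕ} {s t : Set ℝ} {F : ℕ → ℝ → ℝ} (h : IsJet k s F) (hts : t ⊆ s) :
    IsJet k t F :=
  fun m hm x hx => (h m hm x (hts hx)).mono hts

lemma IsJet.mono_order {k l : ℕ} {s : Set ℝ} {F : ℕ → ℝ → ℝ} (h : IsJet k s F) (hl : l ≤ k) :
    IsJet l s F :=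
  fun m hm x hx => h m (by omega) x hx

lemma IsJet.sub {k : ℕ} {s : Set ℝ} {F G : ℕ → ℝ → ℝ} (hF : IsJet k s F) (hG : IsJet k s G) :
    IsJet k s (fun m x => F m x - G m x) :=
  fun m hm x hx => (hF m hm x hx).sub (hG m hm x hx)

lemma IsJet.add {k : ℕ} {s : Set ℝ} {F G : ℕ → ℝ → ℝ} (hF : IsJet k s F) (hG : IsJet k s G) :
    IsJet k s (fun m x => F m x + G m x) :=
  fun m hm x hx => (hF m hm x hx).add (hG m hm x hx)

lemma exists_slope_eq_of_hasDerivWithinAt {s : Set ℝ} (hs : s.OrdConnected) {f f' : ℝ → ℝ}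
    (hf : ∀ x ∈ s, HasDerivWithinAt f (f' x) s x) {x y : ℝ} (hx : x ∈ s) (hy : y ∈ s)
    (hxy : x < y) : ∃ ξ ∈ Ioo x y, f y - f x = f' ξ * (y - x) := by
  have hsub : Icc x y ⊆ s := hs.out hx hy
  obtain ⟨ξ, hξ, h⟩ := exists_hasDerivAt_eq_slope f f' hxy
    (fun z hz => ((hf z (hsub hz)).continuousWithinAt).mono hsub)
    (fun z hz => (hf z (hsub (Ioo_subset_Icc_self hz))).hasDerivAt
      (mem_of_superset (Icc_mem_nhds hz.1 hz.2) hsub))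
  refine ⟨ξ, hξ, ?_⟩
  rw [h, div_mul_cancel₀]
  linarith

lemma abs_sub_le_of_hasDerivWithinAt {s : Set ℝ} (hs : s.OrdConnected) {f f' : ℝ → ℝ} {η : ℝ}
    (hf : ∀ x ∈ s, HasDerivWithinAt f (f' x) s x) (hb : ∀ x ∈ s, |f' x| ≤ η)
    {x y : ℝ} (hx : x ∈ s) (hy : y ∈ s) : |f y - f x| ≤ η * |y - x| := by
  simpa using Convex.norm_image_sub_le_of_norm_hasDerivWithin_le (f := f) (f' := f') hf hb
    hs.convex hx hy

/-- Iterated Rolle theorem: `n + m + 1` ordered zeros of `F 0` yield `n + 1` ordered zeros of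
`F m`. -/
lemma IsJet.exists_ordered_zeros {k : ℕ} {s : Set ℝ} (hs : s.OrdConnected) {F : ℕ → ℝ → ℝ}
    (h : IsJet k s F) (m : ℕ) (hm : m ≤ k) (n : ℕ) (x : ℕ → ℝ) (hxs : ∀ i ≤ n + m, x i ∈ s)
    (hx : ∀ i < n + m, x i < x (i + 1)) (h0 : ∀ i ≤ n + m, F 0 (x i) = 0) :
    ∃ y : ℕ → ℝ, (∀ i ≤ n, y i ∈ s) ∧ (∀ i < n, y i < y (i + 1)) ∧ ∀ i ≤ n, F m (y i) = 0 := by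
  induction m generalizing n with
  | zero => exact ⟨x, hxs, hx, h0⟩
  | succ m ih =>
    obtain ⟨y, hys, hy, hy0⟩ := ih (by omega) (n + 1) (fun i hi => hxs i (by omega))
      (fun i hi => hx i (by omega)) (fun i hi => h0 i (by omega))
    have key : ∀ i : ℕ, ∃ ξ, i ≤ n → ξ ∈ Ioo (y i) (y (i + 1)) ∧ F (m + 1) ξ = 0 := by
      intro i
      by_cases hi : i ≤ n
      · obtain ⟨ξ, hξ, e⟩ := exists_slope_eq_of_hasDerivWithinAt hs (h m (by omega))
          (hys i (by omega)) (hys (i + 1) (by omega)) (hy i (by omega))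
        rw [hy0 i (by omega), hy0 (i + 1) (by omega), sub_zero] at e
        refine ⟨ξ, fun _ => ⟨hξ, ?_⟩⟩
        have := hy i (by omega)
        rcases mul_eq_zero.mp e.symm with h | h
        · exact h
        · linarith
      · exact ⟨0, fun h => absurd h hi⟩
    choose ξ hξ using key
    refine ⟨ξ, fun i hi => ?_, fun i hi => ?_, fun i hi => (hξ i hi).2⟩
    · exact hs.out (hys i (by omega)) (hys (i + 1) (by omega))
        (Ioo_subset_Icc_self (hξ i hi).1)
    · exact (hξ i (by omega)).1.2.trans (hξ (i + 1) (by omega)).1.1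

lemma IsJet.abs_le_of_zeros {k : ℕ} {F : ℕ → ℝ → ℝ} {η : ℝ} (h : IsJet k I01 F) (x : ℕ → ℝ)
    (hxs : ∀ i ≤ k, x i ∈ I01) (hx : ∀ i < k, x i < x (i + 1)) (h0 : ∀ i ≤ k, F 0 (x i) = 0)
    (hη : ∀ x ∈ I01, ∀ y ∈ I01, |F k x - F k y| ≤ η) :
    ∀ m ≤ k, ∀ y ∈ I01, |F m y| ≤ η := by
  have hz : ∀ m ≤ k, ∃ z ∈ I01, F m z = 0 := fun m hm => by
    obtain ⟨y, hys, -, hy⟩ := h.exists_ordered_zeros ordConnected_Icc m hm 0 x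
      (fun i hi => hxs i (by omega)) (fun i hi => hx i (by omega)) (fun i hi => h0 i (by omega))
    exact ⟨y 0, hys 0 le_rfl, hy 0 le_rfl⟩
  have hη0 : 0 ≤ η := (abs_nonneg _).trans (hη 0 (by simp) 0 (by simp))
  have main : ∀ n ≤ k, ∀ y ∈ I01, |F (k - n) y| ≤ η := by
    intro n
    induction n with
    | zero =>
      intro _ y hy
      obtain ⟨z, hz, e⟩ := hz k le_rfl
      simpa [e] using hη y hy z hz
    | succ n ih =>
      intro hn y hy
      obtain ⟨z, hz, e⟩ := hz (k - (n + 1)) (by omega)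
      have hb : ∀ x ∈ I01, |F (k - (n + 1) + 1) x| ≤ η := by
        have : k - (n + 1) + 1 = k - n := by omega
        rw [this]; exact ih (by omega)
      have := abs_sub_le_of_hasDerivWithinAt ordConnected_Icc (h (k - (n + 1)) (by omega)) hb hz hy
      rw [e, sub_zero] at this
      refine this.trans (mul_le_of_le_one_right hη0 ?_)
      rw [abs_le]; constructor <;> linarith [hy.1, hy.2, hz.1, hz.2]
  intro m hm
  have := main (k - m) (by omega)
  rwa [Nat.sub_sub_self hm] at this

lemma IsJet.exists_abs_le (k : ℕ) : ∀ ℓ : ℝ, 0 < ℓ → ∃ A : ℝ, ∀ (F : ℕ → ℝ → ℝ) (a b : ℝ),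
    ℓ ≤ b - a → IsJet k (Icc a b) F → (∀ x ∈ Icc a b, |F 0 x| ≤ 1) →
    ∃ ξ ∈ Icc a b, |F k ξ| ≤ A := by
  induction k with
  | zero =>
    intro ℓ hℓ
    exact ⟨1, fun F a b hab _ h => ⟨a, ⟨le_rfl, by linarith⟩, h a ⟨le_rfl, by linarith⟩⟩⟩
  | succ k ih =>
    intro ℓ hℓ
    obtain ⟨A, hA⟩ := ih (ℓ / 3) (by positivity)
    refine ⟨2 * A / (ℓ / 3), fun F a b hab hF hb => ?_⟩
    have s1 : Icc a (a + ℓ / 3) ⊆ Icc a b := Icc_subset_Icc le_rfl (by linarith)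
    have s2 : Icc (b - ℓ / 3) b ⊆ Icc a b := Icc_subset_Icc (by linarith) le_rfl
    obtain ⟨u, hu, hu'⟩ := hA F a (a + ℓ / 3) (by linarith)
      ((hF.mono_order (Nat.le_succ k)).mono_set s1) (fun x hx => hb x (s1 hx))
    obtain ⟨v, hv, hv'⟩ := hA F (b - ℓ / 3) b (by linarith)
      ((hF.mono_order (Nat.le_succ k)).mono_set s2) (fun x hx => hb x (s2 hx))
    have huv : ℓ / 3 ≤ v - u := by linarith [hu.2, hv.1]
    obtain ⟨ξ, hξ, e⟩ := exists_slope_eq_of_hasDerivWithinAt ordConnected_Icc (hF k (by omega))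
      (s1 hu) (s2 hv) (by linarith)
    refine ⟨ξ, ⟨(s1 hu).1.trans hξ.1.le, hξ.2.le.trans (s2 hv).2⟩, ?_⟩
    rw [le_div_iff₀ (by positivity)]
    calc |F (k + 1) ξ| * (ℓ / 3) ≤ |F (k + 1) ξ| * (v - u) := by gcongr
      _ = |F k v - F k u| := by rw [e, abs_mul, abs_of_pos (by linarith : 0 < v - u)]
      _ ≤ |F k v| + |F k u| := abs_sub _ _
      _ ≤ 2 * A := by linarith

lemma IsJet.uniform_bound (k : ℕ) (C : ℝ) : ∃ B : ℝ, 0 ≤ B ∧ ∀ F : ℕ → ℝ → ℝ, IsJet k I01 F →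
    (∀ x ∈ I01, |F 0 x| ≤ 1) → (∀ x ∈ I01, ∀ y ∈ I01, |F k x - F k y| ≤ C) →
    ∀ m ≤ k, ∀ x ∈ I01, |F m x| ≤ B := by
  have main : ∀ n : ℕ, ∃ B : ℝ, n ≤ k → ∀ F : ℕ → ℝ → ℝ, IsJet k I01 F →
      (∀ x ∈ I01, |F 0 x| ≤ 1) → (∀ x ∈ I01, ∀ y ∈ I01, |F k x - F k y| ≤ C) →
      ∀ x ∈ I01, |F (k - n) x| ≤ B := by
    intro n
    induction n with
    | zero =>
      obtain ⟨A, hA⟩ := IsJet.exists_abs_le k 1 one_pos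
      refine ⟨A + C, fun _ F hF hb hC x hx => ?_⟩
      obtain ⟨ξ, hξ, h⟩ := hA F 0 1 (by norm_num) hF hb
      have := hC x hx ξ hξ
      rw [Nat.sub_zero]
      calc |F k x| = |F k ξ + (F k x - F k ξ)| := by ring_nf
        _ ≤ _ := (abs_add_le _ _).trans (add_le_add h this)
    | succ n ih =>
      obtain ⟨B, hB⟩ := ih
      obtain ⟨A, hA⟩ := IsJet.exists_abs_le (k - (n + 1)) 1 one_pos
      refine ⟨A + B, fun hn F hF hb hC x hx => ?_⟩
      obtain ⟨ξ, hξ, h⟩ := hA F 0 1 (by norm_num) (hF.mono_order (by omega)) hb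
      have hb' : ∀ x ∈ I01, |F (k - (n + 1) + 1) x| ≤ B := by
        have : k - (n + 1) + 1 = k - n := by omega
        rw [this]; exact hB (by omega) F hF hb hC
      have h1 := abs_sub_le_of_hasDerivWithinAt ordConnected_Icc (hF (k - (n + 1)) (by omega)) hb'
        hξ hx
      have h2 : |x - ξ| ≤ 1 := by
        rw [abs_le]; constructor <;> linarith [hx.1, hx.2, hξ.1, hξ.2]
      have hB0 : 0 ≤ B := (abs_nonneg _).trans (hb' x hx)
      calc |F (k - (n + 1)) x| = |F (k - (n + 1)) ξ + (F (k - (n + 1)) x - F (k - (n + 1)) ξ)| := by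
            ring_nf
        _ ≤ _ := (abs_add_le _ _).trans (add_le_add h (h1.trans (mul_le_of_le_one_right hB0 h2)))
  choose B hB using main
  refine ⟨∑ n ∈ Finset.range (k + 1), |B n|, by positivity, fun F hF hb hC m hm x hx => ?_⟩
  have h1 := hB (k - m) (by omega) F hF hb hC x hx
  rw [Nat.sub_sub_self hm] at h1
  exact (h1.trans (le_abs_self _)).trans (Finset.single_le_sum (f := fun n => |B n|)
    (fun i _ => abs_nonneg _) (Finset.mem_range.mpr (by omega)))

/-- The Taylor polynomial of degree `n` of the jet `F` at `x`, evaluated at `y`. -/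
noncomputable def taylorSum (n : ℕ) (F : ℕ → ℝ → ℝ) (x y : ℝ) : ℝ :=
  ∑ l ∈ Finset.range (n + 1), F l x * (y - x) ^ l / (l.factorial : ℝ)

lemma taylorSum_succ (n : ℕ) (F : ℕ → ℝ → ℝ) (x y : ℝ) :
    taylorSum (n + 1) F x y =
      F 0 x + ∑ l ∈ Finset.range (n + 1), F (l + 1) x * (y - x) ^ (l + 1) /
        ((l + 1).factorial : ℝ) := by
  rw [taylorSum, Finset.sum_range_succ']
  simp [add_comm]

lemma hasDerivAt_taylorSum (n : ℕ) (F : ℕ → ℝ → ℝ) (x y : ℝ) :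
    HasDerivAt (taylorSum (n + 1) F x) (taylorSum n (fun m => F (m + 1)) x y) y := by
  have : taylorSum (n + 1) F x = fun y => F 0 x + ∑ l ∈ Finset.range (n + 1),
      F (l + 1) x * (y - x) ^ (l + 1) / ((l + 1).factorial : ℝ) :=
    funext fun y => taylorSum_succ n F x y
  rw [this]
  refine HasDerivAt.const_add _ (HasDerivAt.fun_sum fun l _ => ?_)
  have h := ((((hasDerivAt_id y).sub_const x).pow (l + 1)).const_mul (F (l + 1) x)).div_const
    ((l + 1).factorial : ℝ)
  refine h.congr_deriv ?_
  have : (l.factorial : ℝ) ≠ 0 := by positivity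
  rw [Nat.factorial_succ]
  push_cast
  simp
  field_simp

lemma IsJet.taylor_bound {s : Set ℝ} (hs : s.OrdConnected) {η : ℝ} (k : ℕ) :
    ∀ {F : ℕ → ℝ → ℝ}, IsJet k s F → ∀ {x y : ℝ}, x ∈ s → y ∈ s →
    (∀ z ∈ uIcc x y, |F k z - F k x| ≤ η) →
    |F 0 y - taylorSum k F x y| ≤ η * |y - x| ^ k := by
  induction k with
  | zero =>
    intro F _ x y hx hy h
    simpa [taylorSum] using h y right_mem_uIcc
  | succ k ih =>
    intro F hF x y hx hy h
    have hη : 0 ≤ η := (abs_nonneg _).trans (h x left_mem_uIcc)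
    have hsub : uIcc x y ⊆ s := hs.uIcc_subset hx hy
    have hd : ∀ z ∈ uIcc x y, HasDerivWithinAt (fun z => F 0 z - taylorSum (k + 1) F x z)
        (F 1 z - taylorSum k (fun m => F (m + 1)) x z) (uIcc x y) z := fun z hz =>
      ((hF 0 (by omega) z (hsub hz)).mono hsub).sub
        (hasDerivAt_taylorSum k F x z).hasDerivWithinAt
    have hb : ∀ z ∈ uIcc x y, |F 1 z - taylorSum k (fun m => F (m + 1)) x z| ≤
        η * |y - x| ^ k := fun z hz => by
      have h1 := ih hF.shift hx (hsub hz)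
        (fun u hu => h u ((uIcc_subset_uIcc left_mem_uIcc hz) hu))
      refine h1.trans ?_
      have : |z - x| ≤ |y - x| := abs_sub_left_of_mem_uIcc hz
      gcongr
    have h2 := abs_sub_le_of_hasDerivWithinAt ordConnected_uIcc hd hb left_mem_uIcc right_mem_uIcc
    have h3 : F 0 x - taylorSum (k + 1) F x x = 0 := by
      rw [taylorSum_succ]; simp
    rw [h3, sub_zero] at h2
    rw [pow_succ, ← mul_assoc]
    exact h2

/-- `f` is of class `C^{k+ε}` on `[0,1]`. -/
def IsHolderSmooth (ε : ℝ) : ℕ → (ℝ → ℝ) → Prop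
  | 0, f => ∃ K, 0 ≤ K ∧ HolderBoundOn01 ε K f
  | k + 1, f => ∃ f' : ℝ → ℝ, (∀ x ∈ I01, HasDerivWithinAt f (f' x) I01 x) ∧
      IsHolderSmooth ε k f'

lemma abs_sub_le_one_of_mem_I01 {x y : ℝ} (hx : x ∈ I01) (hy : y ∈ I01) : |x - y| ≤ 1 := by
  rw [abs_le]; constructor <;> linarith [hx.1, hx.2, hy.1, hy.2]

lemma holderBoundOn01_of_lipschitz {ε K : ℝ} (hε1 : ε ≤ 1) (hK : 0 ≤ K) {f : ℝ → ℝ}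
    (h : ∀ x ∈ I01, ∀ y ∈ I01, |f x - f y| ≤ K * |x - y|) : HolderBoundOn01 ε K f :=
  fun x hx y hy => (h x hx y hy).trans (mul_le_mul_of_nonneg_left
    (Real.self_le_rpow_of_le_one (abs_nonneg _) (abs_sub_le_one_of_mem_I01 hx hy) hε1) hK)

lemma HolderBoundOn01.continuousOn {ε K : ℝ} (hε : 0 < ε) {f : ℝ → ℝ}
    (h : HolderBoundOn01 ε K f) : ContinuousOn f I01 := by
  intro x hx
  rw [ContinuousWithinAt, tendsto_iff_dist_tendsto_zero]
  have ht : Tendsto (fun y : ℝ => K * |y - x| ^ ε) (nhdsWithin x I01) (nhds 0) := by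
    have : ContinuousAt (fun y : ℝ => K * |y - x| ^ ε) x :=
      continuousAt_const.mul
        ((continuousAt_id.sub continuousAt_const).abs.rpow_const (Or.inr hε.le))
    have h2 := this.tendsto
    simp only [sub_self, abs_zero, Real.zero_rpow hε.ne', mul_zero] at h2
    exact h2.mono_left nhdsWithin_le_nhds
  refine squeeze_zero' (Eventually.of_forall fun _ => dist_nonneg) ?_ ht
  filter_upwards [self_mem_nhdsWithin] with y hy
  exact h y hy x hx

lemma IsHolderSmooth.continuousOn {ε : ℝ} (hε : 0 < ε) {k : ℕ} {f : ℝ → ℝ}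
    (h : IsHolderSmooth ε k f) : ContinuousOn f I01 := by
  cases k with
  | zero => obtain ⟨K, -, hK⟩ := h; exact hK.continuousOn hε
  | succ k => obtain ⟨f', hf, -⟩ := h; exact fun x hx => (hf x hx).continuousWithinAt

lemma exists_abs_le_of_continuousOn_I01 {f : ℝ → ℝ} (hf : ContinuousOn f I01) :
    ∃ B, 0 ≤ B ∧ ∀ x ∈ I01, |f x| ≤ B := by
  obtain ⟨B, hB⟩ := isCompact_Icc.exists_bound_of_continuousOn hf
  exact ⟨B, (norm_nonneg _).trans (hB 0 (by simp)), hB⟩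

lemma exists_lipschitz_of_hasDerivWithinAt {f f' : ℝ → ℝ}
    (hf : ∀ x ∈ I01, HasDerivWithinAt f (f' x) I01 x) (hc : ContinuousOn f' I01) :
    ∃ K, 0 ≤ K ∧ ∀ x ∈ I01, ∀ y ∈ I01, |f x - f y| ≤ K * |x - y| := by
  obtain ⟨B, hB0, hB⟩ := exists_abs_le_of_continuousOn_I01 hc
  exact ⟨B, hB0, fun x hx y hy => abs_sub_le_of_hasDerivWithinAt ordConnected_Icc hf hB hy hx⟩

lemma IsHolderSmooth.of_succ {ε : ℝ} (hε : 0 < ε) (hε1 : ε ≤ 1) {k : ℕ} :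
    ∀ {f : ℝ → ℝ}, IsHolderSmooth ε (k + 1) f → IsHolderSmooth ε k f := by
  induction k with
  | zero =>
    rintro f ⟨f', hf, hf'⟩
    obtain ⟨K, hK, h⟩ := exists_lipschitz_of_hasDerivWithinAt hf (hf'.continuousOn hε)
    exact ⟨K, hK, holderBoundOn01_of_lipschitz hε1 hK h⟩
  | succ k ih =>
    rintro f ⟨f', hf, hf'⟩
    exact ⟨f', hf, ih hf'⟩

lemma IsHolderSmooth.add {ε : ℝ} {k : ℕ} : ∀ {f g : ℝ → ℝ}, IsHolderSmooth ε k f →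
    IsHolderSmooth ε k g → IsHolderSmooth ε k (fun x => f x + g x) := by
  induction k with
  | zero =>
    rintro f g ⟨K, hK, hf⟩ ⟨L, hL, hg⟩
    refine ⟨K + L, by positivity, fun x hx y hy => ?_⟩
    calc |f x + g x - (f y + g y)| = |(f x - f y) + (g x - g y)| := by ring_nf
      _ ≤ |f x - f y| + |g x - g y| := abs_add_le _ _
      _ ≤ _ := add_le_add (hf x hx y hy) (hg x hx y hy)
      _ = _ := by ring
  | succ k ih =>
    rintro f g ⟨f', hf, hf'⟩ ⟨g', hg, hg'⟩
    exact ⟨fun x => f' x + g' x, fun x hx => (hf x hx).add (hg x hx), ih hf' hg'⟩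

lemma IsHolderSmooth.mul {ε : ℝ} (hε : 0 < ε) (hε1 : ε ≤ 1) {k : ℕ} : ∀ {f g : ℝ → ℝ},
    IsHolderSmooth ε k f → IsHolderSmooth ε k g → IsHolderSmooth ε k (fun x => f x * g x) := by
  induction k with
  | zero =>
    intro f g hf hg
    obtain ⟨A, hA0, hA⟩ := exists_abs_le_of_continuousOn_I01 (hf.continuousOn hε)
    obtain ⟨B, hB0, hB⟩ := exists_abs_le_of_continuousOn_I01 (hg.continuousOn hε)
    obtain ⟨K, hK, hf⟩ := hf
    obtain ⟨L, hL, hg⟩ := hg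
    refine ⟨K * B + A * L, by positivity, fun x hx y hy => ?_⟩
    calc |f x * g x - f y * g y| = |(f x - f y) * g x + f y * (g x - g y)| := by ring_nf
      _ ≤ |f x - f y| * |g x| + |f y| * |g x - g y| := by
        rw [← abs_mul, ← abs_mul]; exact abs_add_le _ _
      _ ≤ (K * |x - y| ^ ε) * B + A * (L * |x - y| ^ ε) := by
        gcongr
        · exact hf x hx y hy
        · exact hB x hx
        · exact hA y hy
        · exact hg x hx y hy
      _ = _ := by ring
  | succ k ih =>
    intro f g hf hg
    have hf1 := hf.of_succ hε hε1
    have hg1 := hg.of_succ hε hε1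
    obtain ⟨f', hf, hf'⟩ := hf
    obtain ⟨g', hg, hg'⟩ := hg
    exact ⟨fun x => f' x * g x + f x * g' x, fun x hx => (hf x hx).mul (hg x hx),
      (ih hf' hg1).add (ih hf1 hg')⟩

lemma uniqueDiffOn_I01 : UniqueDiffOn ℝ I01 := uniqueDiffOn_Icc one_pos

lemma isHolderSmooth_of_contDiffOn {ε : ℝ} (hε1 : ε ≤ 1) {k : ℕ} : ∀ {f : ℝ → ℝ},
    ContDiffOn ℝ (k + 1 : ℕ) f I01 → IsHolderSmooth ε k f := by
  have aux : ∀ {n : ℕ} {f : ℝ → ℝ}, ContDiffOn ℝ (n + 1 : ℕ) f I01 →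
      (∀ x ∈ I01, HasDerivWithinAt f (derivWithin f I01 x) I01 x) ∧
      ContDiffOn ℝ n (derivWithin f I01) I01 := fun {n f} hf =>
    ⟨fun x hx => (hf.differentiableOn (by simp) x hx).hasDerivWithinAt,
      hf.derivWithin uniqueDiffOn_I01 (by norm_cast)⟩
  induction k with
  | zero =>
    intro f hf
    obtain ⟨h1, h2⟩ := aux hf
    obtain ⟨K, hK, h⟩ := exists_lipschitz_of_hasDerivWithinAt h1 h2.continuousOn
    exact ⟨K, hK, holderBoundOn01_of_lipschitz hε1 hK h⟩
  | succ k ih =>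
    intro f hf
    obtain ⟨h1, h2⟩ := aux hf
    exact ⟨_, h1, ih h2⟩

lemma IsJet.isHolderSmooth {ε : ℝ} {k : ℕ} : ∀ {F : ℕ → ℝ → ℝ}, IsJet k I01 F →
    (∃ K, 0 ≤ K ∧ HolderBoundOn01 ε K (F k)) → IsHolderSmooth ε k (F 0) := by
  induction k with
  | zero => exact fun _ h => h
  | succ k ih => exact fun {F} hF h => ⟨F 1, hF 0 (by omega), ih hF.shift h⟩

lemma IsJet.iteratedDerivWithin_eq {s : Set ℝ} (hs : UniqueDiffOn ℝ s) {k : ℕ} {F : ℕ → ℝ → ℝ}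
    (hF : IsJet k s F) : ∀ m ≤ k, ∀ x ∈ s, iteratedDerivWithin m (F 0) s x = F m x := by
  intro m
  induction m with
  | zero => intro _ x _; simp
  | succ m ih =>
    intro hm x hx
    rw [iteratedDerivWithin_succ, derivWithin_congr (fun y hy => ih (by omega) y hy)
      (ih (by omega) x hx)]
    exact (hF m (by omega) x hx).derivWithin (hs x hx)

lemma isJet_iteratedDerivWithin {s : Set ℝ} (hs : UniqueDiffOn ℝ s) {k : ℕ} {f : ℝ → ℝ}
    (hf : ContDiffOn ℝ k f s) : IsJet k s (fun m => iteratedDerivWithin m f s) := by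
  intro m hm x hx
  change HasDerivWithinAt _ (iteratedDerivWithin (m + 1) f s x) s x
  rw [iteratedDerivWithin_succ]
  exact (hf.differentiableOn_iteratedDerivWithin (by exact_mod_cast hm) hs x hx).hasDerivWithinAt

lemma IsHolderSmooth.exists_jet {ε : ℝ} {k : ℕ} : ∀ {f : ℝ → ℝ}, IsHolderSmooth ε k f →
    ∃ F : ℕ → ℝ → ℝ, F 0 = f ∧ IsJet k I01 F ∧ ∃ K, 0 ≤ K ∧ HolderBoundOn01 ε K (F k) := by
  induction k with
  | zero => exact fun {f} h => ⟨fun _ => f, rfl, fun m hm => absurd hm (by omega), h⟩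
  | succ k ih =>
    rintro f ⟨f', hf, hf'⟩
    obtain ⟨F, hF0, hF, hK⟩ := ih hf'
    refine ⟨fun m => Nat.casesOn m f F, rfl, ?_, hK⟩
    intro m hm x hx
    cases m with
    | zero => simpa [hF0] using hf x hx
    | succ m => exact hF m (by omega) x hx

lemma IsHolderSmooth.contDiffOn {ε : ℝ} (hε : 0 < ε) {k : ℕ} {f : ℝ → ℝ}
    (h : IsHolderSmooth ε k f) : ContDiffOn ℝ k f I01 ∧
      ∃ K > 0, HolderBoundOn01 ε K (iteratedDerivWithin k f I01) := by
  obtain ⟨F, rfl, hF, K, hK, hb⟩ := h.exists_jet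
  have e := hF.iteratedDerivWithin_eq uniqueDiffOn_I01
  refine ⟨contDiffOn_of_continuousOn_differentiableOn_deriv (fun m hm => ?_) (fun m hm => ?_),
    K + 1, by positivity, fun x hx y hy => ?_⟩
  · have hm' : m ≤ k := by exact_mod_cast hm
    refine ContinuousOn.congr (f := F m) ?_ (fun x hx => e m hm' x hx)
    rcases hm'.lt_or_eq with h | rfl
    · exact fun x hx => (hF m h x hx).continuousWithinAt
    · exact hb.continuousOn hε
  · have hm' : m < k := by exact_mod_cast hm
    exact DifferentiableOn.congr (f := F m) (fun x hx => (hF m hm' x hx).differentiableWithinAt)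
      (fun x hx => e m hm'.le x hx)
  · rw [e k le_rfl x hx, e k le_rfl y hy]
    refine (hb x hx y hy).trans ?_
    gcongr
    linarith

/-- `C` is a closed subset of `[0,1]` containing `0` and `1`. -/
structure IsFrame (C : Set ℝ) : Prop where
  closed : IsClosed C
  subset : C ⊆ I01
  zero_mem : (0 : ℝ) ∈ C
  one_mem : (1 : ℝ) ∈ C

/-- `(a, b)` is a bounded complementary component of `C`. -/
structure IsGap (C : Set ℝ) (a b : ℝ) : Prop where
  left_mem : a ∈ C
  right_mem : b ∈ C
  lt : a < b
  notMem : ∀ z ∈ Ioo a b, z ∉ C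

/-- The largest point of `C` that is at most `x`. -/
noncomputable def gapLeft (C : Set ℝ) (x : ℝ) : ℝ := sSup (C ∩ Iic x)

/-- The smallest point of `C` that is at least `x`. -/
noncomputable def gapRight (C : Set ℝ) (x : ℝ) : ℝ := sInf (C ∩ Ici x)

namespace IsFrame

variable {C : Set ℝ}

lemma gapLeft_mem_inter (hC : IsFrame C) {x : ℝ} (hx : x ∈ I01) :
    gapLeft C x ∈ C ∩ Iic x :=
  (hC.closed.inter isClosed_Iic).csSup_mem ⟨0, hC.zero_mem, hx.1⟩ ⟨x, fun _ h => h.2⟩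

lemma gapRight_mem_inter (hC : IsFrame C) {x : ℝ} (hx : x ∈ I01) :
    gapRight C x ∈ C ∩ Ici x :=
  (hC.closed.inter isClosed_Ici).csInf_mem ⟨1, hC.one_mem, hx.2⟩ ⟨x, fun _ h => h.2⟩

lemma gapLeft_mem (hC : IsFrame C) {x : ℝ} (hx : x ∈ I01) : gapLeft C x ∈ C :=
  (hC.gapLeft_mem_inter hx).1

lemma gapLeft_le (hC : IsFrame C) {x : ℝ} (hx : x ∈ I01) : gapLeft C x ≤ x :=
  (hC.gapLeft_mem_inter hx).2

lemma gapRight_mem (hC : IsFrame C) {x : ℝ} (hx : x ∈ I01) : gapRight C x ∈ C :=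
  (hC.gapRight_mem_inter hx).1

lemma le_gapRight (hC : IsFrame C) {x : ℝ} (hx : x ∈ I01) : x ≤ gapRight C x :=
  (hC.gapRight_mem_inter hx).2

end IsFrame

lemma le_gapLeft {C : Set ℝ} {x c : ℝ} (hc : c ∈ C) (hcx : c ≤ x) : c ≤ gapLeft C x :=
  le_csSup ⟨x, fun _ h => h.2⟩ ⟨hc, hcx⟩

lemma gapRight_le {C : Set ℝ} {x c : ℝ} (hc : c ∈ C) (hcx : x ≤ c) : gapRight C x ≤ c :=
  csInf_le ⟨x, fun _ h => h.2⟩ ⟨hc, hcx⟩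

namespace IsFrame

variable {C : Set ℝ}

lemma gapLeft_of_mem (hC : IsFrame C) {x : ℝ} (hx : x ∈ C) : gapLeft C x = x :=
  le_antisymm (hC.gapLeft_le (hC.subset hx)) (le_gapLeft hx le_rfl)

lemma gapRight_of_mem (hC : IsFrame C) {x : ℝ} (hx : x ∈ C) : gapRight C x = x :=
  le_antisymm (gapRight_le hx le_rfl) (hC.le_gapRight (hC.subset hx))

lemma mem_gap (hC : IsFrame C) {x : ℝ} (hx : x ∈ I01) (hxC : x ∉ C) :
    x ∈ Ioo (gapLeft C x) (gapRight C x) := by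
  refine ⟨lt_of_le_of_ne (hC.gapLeft_le hx) ?_, lt_of_le_of_ne (hC.le_gapRight hx) ?_⟩
  · intro h; exact hxC (h ▸ hC.gapLeft_mem hx)
  · intro h; exact hxC (h ▸ hC.gapRight_mem hx)

lemma isGap (hC : IsFrame C) {x : ℝ} (hx : x ∈ I01) (hxC : x ∉ C) :
    IsGap C (gapLeft C x) (gapRight C x) := by
  refine ⟨hC.gapLeft_mem hx, hC.gapRight_mem hx,
    (hC.mem_gap hx hxC).1.trans (hC.mem_gap hx hxC).2, fun z hz hzC => ?_⟩
  rcases le_total z x with h | h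
  · exact absurd (le_gapLeft hzC h) (not_le.mpr hz.1)
  · exact absurd (gapRight_le hzC h) (not_le.mpr hz.2)

end IsFrame

namespace IsGap

variable {C : Set ℝ} {a b : ℝ}

lemma mem_I01 (h : IsGap C a b) (hC : IsFrame C) {z : ℝ} (hz : z ∈ Icc a b) : z ∈ I01 :=
  ⟨(hC.subset h.left_mem).1.trans hz.1, hz.2.trans (hC.subset h.right_mem).2⟩

lemma gapLeft_eq (h : IsGap C a b) (hC : IsFrame C) {z : ℝ} (hz : z ∈ Ioo a b) :
    gapLeft C z = a := by
  have hz' := h.mem_I01 hC (Ioo_subset_Icc_self hz)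
  refine le_antisymm (not_lt.mp fun hlt => ?_) (le_gapLeft h.left_mem hz.1.le)
  exact h.notMem _ ⟨hlt, (hC.gapLeft_le hz').trans_lt hz.2⟩ (hC.gapLeft_mem hz')

lemma gapRight_eq (h : IsGap C a b) (hC : IsFrame C) {z : ℝ} (hz : z ∈ Ioo a b) :
    gapRight C z = b := by
  have hz' := h.mem_I01 hC (Ioo_subset_Icc_self hz)
  refine le_antisymm (gapRight_le h.right_mem hz.2.le) (not_lt.mp fun hlt => ?_)
  exact h.notMem _ ⟨hz.1.trans_le (hC.le_gapRight hz'), hlt⟩ (hC.gapRight_mem hz')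

end IsGap

/-- A function that is Hölder along `C` and along every gap of `C` is Hölder. -/
lemma holderBoundOn01_of_gaps {C : Set ℝ} (hC : IsFrame C) {ε K : ℝ} (hε : 0 ≤ ε) (hK : 0 ≤ K)
    {f : ℝ → ℝ} (h1 : ∀ x ∈ C, ∀ y ∈ C, |f x - f y| ≤ K * |x - y| ^ ε)
    (h2 : ∀ a b, IsGap C a b → ∀ x ∈ Icc a b, ∀ y ∈ Icc a b, |f x - f y| ≤ K * |x - y| ^ ε) :
    HolderBoundOn01 ε (3 * K) f := by
  have key : ∀ x ∈ I01, ∀ y ∈ I01, x ≤ y → |f x - f y| ≤ 3 * K * |x - y| ^ ε := by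
    intro x hx y hy hxy
    have hr := hC.le_gapRight hx
    have hl := hC.gapLeft_le hy
    by_cases h : gapRight C x ≤ y
    · have hcc : gapRight C x ≤ gapLeft C y := le_gapLeft (hC.gapRight_mem hx) h
      have e1 : |f x - f (gapRight C x)| ≤ K * |x - gapRight C x| ^ ε := by
        by_cases hxC : x ∈ C
        · exact h1 _ hxC _ (hC.gapRight_mem hx)
        · have hm := hC.mem_gap hx hxC
          exact h2 _ _ (hC.isGap hx hxC) _ ⟨hm.1.le, hm.2.le⟩ _ ⟨(hm.1.trans hm.2).le, le_rfl⟩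
      have e2 := h1 _ (hC.gapRight_mem hx) _ (hC.gapLeft_mem hy)
      have e3 : |f (gapLeft C y) - f y| ≤ K * |gapLeft C y - y| ^ ε := by
        by_cases hyC : y ∈ C
        · exact h1 _ (hC.gapLeft_mem hy) _ hyC
        · have hm := hC.mem_gap hy hyC
          exact h2 _ _ (hC.isGap hy hyC) _ ⟨le_rfl, (hm.1.trans hm.2).le⟩ _ ⟨hm.1.le, hm.2.le⟩
      have a1 : |x - gapRight C x| ^ ε ≤ |x - y| ^ ε := by
        refine Real.rpow_le_rpow (abs_nonneg _) ?_ hε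
        rw [abs_sub_comm, abs_sub_comm x y, abs_of_nonneg, abs_of_nonneg] <;> linarith
      have a2 : |gapRight C x - gapLeft C y| ^ ε ≤ |x - y| ^ ε := by
        refine Real.rpow_le_rpow (abs_nonneg _) ?_ hε
        rw [abs_sub_comm, abs_sub_comm x y, abs_of_nonneg, abs_of_nonneg] <;> linarith
      have a3 : |gapLeft C y - y| ^ ε ≤ |x - y| ^ ε := by
        refine Real.rpow_le_rpow (abs_nonneg _) ?_ hε
        rw [abs_sub_comm, abs_sub_comm x y, abs_of_nonneg, abs_of_nonneg] <;> linarith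
      have t1 := abs_sub_le (f x) (f (gapRight C x)) (f y)
      have t2 := abs_sub_le (f (gapRight C x)) (f (gapLeft C y)) (f y)
      have b1 := mul_le_mul_of_nonneg_left a1 hK
      have b2 := mul_le_mul_of_nonneg_left a2 hK
      have b3 := mul_le_mul_of_nonneg_left a3 hK
      linarith
    · have hxC : x ∉ C := fun hxC => h ((hC.gapRight_of_mem hxC).trans_le hxy)
      have hm := hC.mem_gap hx hxC
      have := h2 _ _ (hC.isGap hx hxC) x ⟨hm.1.le, hm.2.le⟩ y
        ⟨hm.1.le.trans hxy, (not_le.mp h).le⟩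
      have h0 : 0 ≤ K * |x - y| ^ ε := by positivity
      linarith
  intro x hx y hy
  rcases le_total x y with h | h
  · exact key x hx y hy h
  · rw [abs_sub_comm, abs_sub_comm x y]; exact key y hy x hx h

lemma hasDerivWithinAt_zero_of_abs_sub_le {s : Set ℝ} {f : ℝ → ℝ} {x K ε : ℝ} (hε : 0 < ε)
    (h : ∀ y ∈ s, |f y - f x| ≤ K * |y - x| ^ (1 + ε)) : HasDerivWithinAt f 0 s x := by
  rw [hasDerivWithinAt_iff_isLittleO, Asymptotics.isLittleO_iff]
  intro c hc
  have ht : Tendsto (fun y : ℝ => |K| * |y - x| ^ ε) (nhdsWithin x s) (nhds 0) := by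
    have : ContinuousAt (fun y : ℝ => |K| * |y - x| ^ ε) x :=
      continuousAt_const.mul
        ((continuousAt_id.sub continuousAt_const).abs.rpow_const (Or.inr hε.le))
    have h2 := this.tendsto
    simp only [sub_self, abs_zero, Real.zero_rpow hε.ne', mul_zero] at h2
    exact h2.mono_left nhdsWithin_le_nhds
  filter_upwards [self_mem_nhdsWithin, ht.eventually (gt_mem_nhds hc)] with y hy hyc
  simp only [smul_zero, sub_zero, Real.norm_eq_abs]
  calc |f y - f x| ≤ K * |y - x| ^ (1 + ε) := h y hy
    _ ≤ |K| * |y - x| ^ (1 + ε) := by gcongr; exact le_abs_self K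
    _ = (|K| * |y - x| ^ ε) * |y - x| := by
      rw [Real.rpow_add_of_nonneg (abs_nonneg _) zero_le_one hε.le, Real.rpow_one]; ring
    _ ≤ c * |y - x| := by gcongr

/-- A smooth step from `0` to `1` that is flat at both endpoints of `[0,1]`. -/
lemma exists_flat_step (n : ℕ) : ∃ (θ : ℕ → ℝ → ℝ) (B : ℝ), 0 ≤ B ∧
    (∀ m x, HasDerivAt (θ m) (θ (m + 1) x) x) ∧ θ 0 0 = 0 ∧ θ 0 1 = 1 ∧
    (∀ m, θ (m + 1) 0 = 0 ∧ θ (m + 1) 1 = 0) ∧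
    (∀ m ≤ n, ∀ t₀, t₀ = 0 ∨ t₀ = 1 → ∀ t ∈ I01, |θ m t - θ m t₀| ≤ B * |t - t₀| ^ 2) ∧
    ∀ m ≤ n, ∀ t ∈ I01, ∀ t' ∈ I01, |θ m t - θ m t'| ≤ B * |t - t'| := by
  set θ : ℕ → ℝ → ℝ := fun m => iteratedDeriv m Real.smoothTransition with hθ
  have hs : ContDiff ℝ (⊤ : ℕ∞) Real.smoothTransition := Real.smoothTransition.contDiff
  have hcont : ∀ m, Continuous (θ m) := fun m =>
    hs.continuous_iteratedDeriv m (by exact_mod_cast le_top)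
  have hderiv : ∀ m x, HasDerivAt (θ m) (θ (m + 1) x) x := fun m x => by
    have : DifferentiableAt ℝ (θ m) x :=
      (hs.differentiable_iteratedDeriv m (by exact_mod_cast WithTop.coe_lt_top m)) x
    have e : θ (m + 1) = deriv (θ m) := iteratedDeriv_succ
    rw [e]
    exact this.hasDerivAt
  have hz0 : ∀ m, θ m 0 = 0 := fun m => by
    have hcl : IsClosed {x | θ m x = 0} := isClosed_eq (hcont m) continuous_const
    have hsub : Iio (0 : ℝ) ⊆ {x | θ m x = 0} := fun x hx => by
      have he : Real.smoothTransition =ᶠ[nhds x] fun _ => 0 := by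
        filter_upwards [Iio_mem_nhds hx] with y hy
        exact Real.smoothTransition.zero_of_nonpos (le_of_lt hy)
      change iteratedDeriv m _ x = 0
      rw [he.iteratedDeriv_eq m]
      simp
    have := hcl.closure_subset_iff.mpr hsub
    rw [closure_Iio] at this
    exact this (mem_Iic.mpr le_rfl)
  have hz1 : ∀ m, θ (m + 1) 1 = 0 := fun m => by
    have hcl : IsClosed {x | θ (m + 1) x = 0} := isClosed_eq (hcont _) continuous_const
    have hsub : Ioi (1 : ℝ) ⊆ {x | θ (m + 1) x = 0} := fun x hx => by
      have he : Real.smoothTransition =ᶠ[nhds x] fun _ => 1 := by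
        filter_upwards [Ioi_mem_nhds hx] with y hy
        exact Real.smoothTransition.one_of_one_le (le_of_lt hy)
      change iteratedDeriv (m + 1) _ x = 0
      rw [he.iteratedDeriv_eq (m + 1)]
      simp [iteratedDeriv_const]
    have := hcl.closure_subset_iff.mpr hsub
    rw [closure_Ioi] at this
    exact this (mem_Ici.mpr le_rfl)
  have hbd : ∀ m, ∃ B, 0 ≤ B ∧ ∀ x ∈ I01, |θ m x| ≤ B := fun m =>
    exists_abs_le_of_continuousOn_I01 (hcont m).continuousOn
  choose b hb0 hb using hbd
  set B := ∑ m ∈ Finset.range (n + 3), b m with hB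
  have hbB : ∀ m ≤ n + 2, ∀ x ∈ I01, |θ m x| ≤ B := fun m hm x hx =>
    (hb m x hx).trans (Finset.single_le_sum (fun i _ => hb0 i) (Finset.mem_range.mpr (by omega)))
  have hB0 : 0 ≤ B := Finset.sum_nonneg fun i _ => hb0 i
  have hlip : ∀ m ≤ n + 1, ∀ t ∈ I01, ∀ t' ∈ I01, |θ m t - θ m t'| ≤ B * |t - t'| :=
    fun m hm t ht t' ht' => abs_sub_le_of_hasDerivWithinAt ordConnected_Icc
      (fun x _ => (hderiv m x).hasDerivWithinAt) (hbB (m + 1) (by omega)) ht' ht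
  refine ⟨θ, B, hB0, hderiv, hz0 0, ?_, fun m => ⟨hz0 _, hz1 m⟩, ?_, fun m hm => hlip m (by omega)⟩
  · simp [hθ]
  · intro m hm t₀ ht₀ t ht
    have ht₀' : t₀ ∈ I01 := by rcases ht₀ with rfl | rfl <;> simp
    have hz : θ (m + 1) t₀ = 0 := by
      rcases ht₀ with rfl | rfl
      · exact hz0 _
      · exact hz1 _
    have hsub : uIcc t₀ t ⊆ I01 := ordConnected_Icc.uIcc_subset ht₀' ht
    have h1 : ∀ z ∈ uIcc t₀ t, |θ (m + 1) z| ≤ B * |t - t₀| := fun z hz' => by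
      have := hlip (m + 1) (by omega) z (hsub hz') t₀ ht₀'
      rw [hz, sub_zero] at this
      exact this.trans (mul_le_mul_of_nonneg_left (abs_sub_left_of_mem_uIcc hz') hB0)
    have := abs_sub_le_of_hasDerivWithinAt ordConnected_uIcc
      (fun x _ => (hderiv m x).hasDerivWithinAt) h1 left_mem_uIcc right_mem_uIcc
    rw [pow_two, ← mul_assoc]
    exact this

/-- A function on `C` that is Hölder of exponent `n + ε` extends to a `C^{n+ε}` function on
`[0,1]` all of whose derivatives of positive order vanish on `C`. -/
lemma exists_flat_extension {C : Set ℝ} (hC : IsFrame C) {ε : ℝ} (hε : 0 < ε) (hε1 : ε ≤ 1)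
    (n : ℕ) (r : ℝ → ℝ) {K : ℝ} (hK : 0 ≤ K)
    (hr : ∀ x ∈ C, ∀ y ∈ C, |r y - r x| ≤ K * |y - x| ^ ((n : ℝ) + ε)) :
    ∃ D : ℕ → ℝ → ℝ, IsJet n I01 D ∧ (∃ K', 0 ≤ K' ∧ HolderBoundOn01 ε K' (D n)) ∧
      ∀ x ∈ C, ∀ m ≤ n, D m x = if m = 0 then r x else 0 := by
  obtain ⟨θ, B, hB0, hθ, hθ0, hθ1, hθz, hθq, hθl⟩ := exists_flat_step n
  set D : ℕ → ℝ → ℝ := fun m x => (if m = 0 then r (gapLeft C x) else 0) +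
    (r (gapRight C x) - r (gapLeft C x)) / (gapRight C x - gapLeft C x) ^ m *
      θ m ((x - gapLeft C x) / (gapRight C x - gapLeft C x)) with hD
  have hDC : ∀ x ∈ C, ∀ m, D m x = if m = 0 then r x else 0 := fun x hx m => by
    simp [hD, hC.gapLeft_of_mem hx, hC.gapRight_of_mem hx]
  have hDoo : ∀ a b, IsGap C a b → ∀ x ∈ Ioo a b, ∀ m, D m x =
      (if m = 0 then r a else 0) + (r b - r a) / (b - a) ^ m * θ m ((x - a) / (b - a)) :=
    fun a b hg x hx m => by simp [hD, hg.gapLeft_eq hC hx, hg.gapRight_eq hC hx]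
  have hDcc : ∀ a b, IsGap C a b → ∀ x ∈ Icc a b, ∀ m, D m x =
      (if m = 0 then r a else 0) + (r b - r a) / (b - a) ^ m * θ m ((x - a) / (b - a)) := by
    intro a b hg x hx m
    have hne : b - a ≠ 0 := by linarith [hg.lt]
    rcases eq_endpoints_or_mem_Ioo_of_mem_Icc hx with rfl | rfl | hx
    · rw [hDC _ hg.left_mem]
      cases m with
      | zero => simp [hθ0]
      | succ m => simp [(hθz m).1]
    · rw [hDC _ hg.right_mem]
      cases m with
      | zero => simp [hθ1, div_self hne]
      | succ m => simp [(hθz m).2, div_self hne]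
    · exact hDoo a b hg x hx m
  have he : ∀ a b, IsGap C a b → ∀ m ≤ n, |(r b - r a) / (b - a) ^ m| ≤
      K * (b - a) ^ (n - m) * (b - a) ^ ε := by
    intro a b hg m hm
    have hL : 0 < b - a := by linarith [hg.lt]
    rw [abs_div, abs_of_pos (pow_pos hL m), div_le_iff₀ (pow_pos hL m)]
    refine (hr a hg.left_mem b hg.right_mem).trans_eq ?_
    rw [abs_of_pos hL, Real.rpow_add hL, Real.rpow_natCast]
    nth_rewrite 1 [← Nat.sub_add_cancel hm]
    rw [pow_add]; ring
  have hunit : ∀ a b, IsGap C a b → ∀ x ∈ Icc a b, (x - a) / (b - a) ∈ I01 := by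
    intro a b hg x hx
    have hL : 0 < b - a := by linarith [hg.lt]
    exact ⟨div_nonneg (by linarith [hx.1]) hL.le, (div_le_one hL).mpr (by linarith [hx.2])⟩
  -- Hölder bound of the top derivative along a gap
  have htop : ∀ a b, IsGap C a b → ∀ x ∈ Icc a b, ∀ y ∈ Icc a b,
      |D n x - D n y| ≤ K * B * |x - y| ^ ε := by
    intro a b hg x hx y hy
    have hL : 0 < b - a := by linarith [hg.lt]
    rw [hDcc a b hg x hx, hDcc a b hg y hy, add_sub_add_left_eq_sub, ← mul_sub, abs_mul]
    have h1 := he a b hg n le_rfl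
    rw [Nat.sub_self, pow_zero, mul_one] at h1
    have h2 := hθl n le_rfl _ (hunit a b hg x hx) _ (hunit a b hg y hy)
    have h3 := Real.self_le_rpow_of_le_one (abs_nonneg _)
      (abs_sub_le_one_of_mem_I01 (hunit a b hg x hx) (hunit a b hg y hy)) hε1
    have h4 : |(x - a) / (b - a) - (y - a) / (b - a)| = |x - y| / (b - a) := by
      rw [← sub_div, abs_div, abs_of_pos hL]; ring_nf
    calc _ ≤ (K * (b - a) ^ ε) * (B * |(x - a) / (b - a) - (y - a) / (b - a)| ^ ε) := by
          gcongr; exact h2.trans (by gcongr)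
      _ = K * B * |x - y| ^ ε := by
        rw [h4, Real.div_rpow (abs_nonneg _) hL.le]
        have := (Real.rpow_pos_of_pos hL ε).ne'
        field_simp
  -- flatness at the endpoints of a gap
  have hend : ∀ m < n, ∀ a b, IsGap C a b → ∀ c, c = a ∨ c = b → ∀ x ∈ Icc a b,
      |D m x - D m c| ≤ K * B * |x - c| ^ (1 + ε) := by
    intro m hm a b hg c hc x hx
    have hL : 0 < b - a := by linarith [hg.lt]
    have hcI : c ∈ Icc a b := by rcases hc with rfl | rfl <;> simp [hg.lt.le]
    have hL1 : b - a ≤ 1 := by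
      linarith [(hC.subset hg.left_mem).1, (hC.subset hg.right_mem).2]
    have hc01 : (c - a) / (b - a) = 0 ∨ (c - a) / (b - a) = 1 := by
      rcases hc with rfl | rfl
      · left; simp
      · right; exact div_self hL.ne'
    rw [hDcc a b hg x hx, hDcc a b hg c hcI, add_sub_add_left_eq_sub, ← mul_sub, abs_mul]
    have h1 := he a b hg m hm.le
    have h2 := hθq m hm.le _ hc01 _ (hunit a b hg x hx)
    have h4 : |(x - a) / (b - a) - (c - a) / (b - a)| = |x - c| / (b - a) := by
      rw [← sub_div, abs_div, abs_of_pos hL]; ring_nf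
    have h5 : |(x - a) / (b - a) - (c - a) / (b - a)| ≤ 1 :=
      abs_sub_le_one_of_mem_I01 (hunit a b hg x hx) (hunit a b hg c hcI)
    have h6 : (|(x - a) / (b - a) - (c - a) / (b - a)|) ^ 2 ≤
        (|(x - a) / (b - a) - (c - a) / (b - a)|) ^ (1 + ε) := by
      rw [← Real.rpow_natCast]
      exact Real.rpow_le_rpow_of_exponent_ge' (abs_nonneg _) h5 (by linarith)
        (by push_cast; linarith)
    have h7 : (b - a) ^ (n - m) ≤ b - a :=
      pow_le_of_le_one hL.le hL1 (by omega)
    calc _ ≤ (K * (b - a) ^ (n - m) * (b - a) ^ ε) *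
          (B * |(x - a) / (b - a) - (c - a) / (b - a)| ^ (1 + ε)) := by
          gcongr; exact h2.trans (by gcongr)
      _ ≤ (K * (b - a) * (b - a) ^ ε) *
          (B * |(x - a) / (b - a) - (c - a) / (b - a)| ^ (1 + ε)) := by gcongr
      _ = K * B * |x - c| ^ (1 + ε) := by
        rw [h4, Real.div_rpow (abs_nonneg _) hL.le, Real.rpow_add hL 1 ε, Real.rpow_one]
        have := (Real.rpow_pos_of_pos hL ε).ne'
        field_simp
  have hCC : ∀ m < n, ∀ x ∈ C, ∀ y ∈ C, |D m y - D m x| ≤ K * |y - x| ^ (1 + ε) := by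
    intro m hm x hx y hy
    rw [hDC x hx, hDC y hy]
    split_ifs with h
    · refine (hr x hx y hy).trans (mul_le_mul_of_nonneg_left ?_ hK)
      have h1 : (1 : ℝ) ≤ n := by exact_mod_cast (by omega : 1 ≤ n)
      exact Real.rpow_le_rpow_of_exponent_ge' (abs_nonneg _)
        (abs_sub_le_one_of_mem_I01 (hC.subset hy) (hC.subset hx)) (by linarith) (by linarith)
    · simp; positivity
  refine ⟨D, ?_, ⟨3 * (K * B + K), by positivity, ?_⟩, fun x hx m _ => hDC x hx m⟩
  · intro m hm x hx
    by_cases hxC : x ∈ C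
    · have h0 : D (m + 1) x = 0 := by rw [hDC x hxC]; simp
      rw [h0]
      refine hasDerivWithinAt_zero_of_abs_sub_le (K := K * B + K) hε fun y hy => ?_
      by_cases hyC : y ∈ C
      · refine (hCC m hm x hxC y hyC).trans ?_
        gcongr
        nlinarith
      · have hg := hC.isGap hy hyC
        have hy' := hC.mem_gap hy hyC
        obtain ⟨c, hc, hc1, hc2⟩ : ∃ c, (c = gapLeft C y ∨ c = gapRight C y) ∧
            |y - c| ≤ |y - x| ∧ |c - x| ≤ |y - x| := by
          rcases le_total x y with h | h
          · have := le_gapLeft hxC h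
            refine ⟨_, Or.inl rfl, ?_, ?_⟩ <;>
              rw [abs_of_nonneg, abs_of_nonneg] <;> linarith [hy'.1]
          · have := gapRight_le hxC h
            refine ⟨_, Or.inr rfl, ?_, ?_⟩ <;>
              rw [abs_of_nonpos, abs_of_nonpos] <;> linarith [hy'.2]
        have hcC : c ∈ C := by
          rcases hc with rfl | rfl
          · exact hg.left_mem
          · exact hg.right_mem
        have e1 := hend m hm _ _ hg c hc y (Ioo_subset_Icc_self hy')
        have e2 := hCC m hm x hxC c hcC
        calc |D m y - D m x| ≤ |D m y - D m c| + |D m c - D m x| := abs_sub_le _ _ _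
          _ ≤ K * B * |y - c| ^ (1 + ε) + K * |c - x| ^ (1 + ε) := add_le_add e1 e2
          _ ≤ K * B * |y - x| ^ (1 + ε) + K * |y - x| ^ (1 + ε) := by gcongr
          _ = _ := by ring
    · have hg := hC.isGap hx hxC
      have hx' := hC.mem_gap hx hxC
      set a := gapLeft C x
      set b := gapRight C x
      have hL : b - a ≠ 0 := by linarith [hg.lt]
      refine HasDerivAt.hasDerivWithinAt ?_
      rw [hDoo a b hg x hx']
      have h1 : HasDerivAt (fun y => (if m = 0 then r a else 0) +
          (r b - r a) / (b - a) ^ m * θ m ((y - a) / (b - a)))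
          ((r b - r a) / (b - a) ^ m * (θ (m + 1) ((x - a) / (b - a)) * (1 / (b - a)))) x := by
        refine HasDerivAt.const_add _ (HasDerivAt.const_mul _ ?_)
        exact HasDerivAt.comp x (hθ m _) (((hasDerivAt_id x).sub_const a).div_const (b - a))
      have h2 : HasDerivAt (D m)
          ((r b - r a) / (b - a) ^ m * (θ (m + 1) ((x - a) / (b - a)) * (1 / (b - a)))) x :=
        h1.congr_of_eventuallyEq (by
          filter_upwards [Ioo_mem_nhds hx'.1 hx'.2] with y hy using hDoo a b hg y hy m)
      refine h2.congr_deriv ?_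
      simp only [Nat.succ_ne_zero, if_false, zero_add, pow_succ]
      field_simp
  · refine holderBoundOn01_of_gaps hC hε.le (by positivity) (fun x hx y hy => ?_)
      (fun a b hg x hx y hy => (htop a b hg x hx y hy).trans ?_)
    · rw [hDC x hx, hDC y hy]
      split_ifs with h
      · subst h
        have := hr y hy x hx
        rw [Nat.cast_zero, zero_add] at this
        refine this.trans ?_
        gcongr
        nlinarith
      · simp; positivity
    · gcongr
      linarith

/-- The Whitney compatibility condition of order `k + ε` for a jet on `C`. -/
def WhitneyJet (ε : ℝ) (k : ℕ) (K : ℝ) (C : Set ℝ) (h : ℕ → ℝ → ℝ) : Prop :=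
  ∀ m ≤ k, ∀ x ∈ C, ∀ y ∈ C, |h m y - taylorSum (k - m) (fun l => h (m + l)) x y| ≤
    K * |y - x| ^ (((k - m : ℕ) : ℝ) + ε)

lemma exists_antideriv {f : ℝ → ℝ} (hf : ContinuousOn f I01) :
    ∃ P : ℝ → ℝ, ∀ x ∈ I01, HasDerivWithinAt P (f x) I01 x := by
  set g : ℝ → ℝ := IccExtend (zero_le_one' ℝ) (I01.domRestrict f) with hg
  have hgc : Continuous g := (continuousOn_iff_continuous_domRestrict.mp hf).Icc_extend'
  refine ⟨fun x => ∫ t in (0 : ℝ)..x, g t, fun x hx => ?_⟩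
  have : g x = f x := by rw [hg, IccExtend_of_mem _ _ hx]; rfl
  rw [← this]
  exact (hgc.integral_hasStrictDerivAt 0 x).hasDerivAt.hasDerivWithinAt

lemma IsJet.continuousOn {ε : ℝ} (hε : 0 < ε) {k : ℕ} {F : ℕ → ℝ → ℝ} (hF : IsJet k I01 F)
    (hK : ∃ K, 0 ≤ K ∧ HolderBoundOn01 ε K (F k)) : ContinuousOn (F 0) I01 :=
  (hF.isHolderSmooth hK).continuousOn hε

/-- Whitney's extension theorem in class `C^{k+ε}` on the line. -/
theorem whitney_extension {C : Set ℝ} (hC : IsFrame C) {ε : ℝ} (hε : 0 < ε) (hε1 : ε ≤ 1)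
    (k : ℕ) : ∀ (h : ℕ → ℝ → ℝ) (K : ℝ), 0 ≤ K → WhitneyJet ε k K C h →
    ∃ F : ℕ → ℝ → ℝ, IsJet k I01 F ∧ (∃ K', 0 ≤ K' ∧ HolderBoundOn01 ε K' (F k)) ∧
      ∀ m ≤ k, ∀ x ∈ C, F m x = h m x := by
  induction k with
  | zero =>
    intro h K hK hW
    obtain ⟨D, hD, hD', hDC⟩ := exists_flat_extension hC hε hε1 0 (h 0) hK
      (fun x hx y hy => by simpa [taylorSum] using hW 0 le_rfl x hx y hy)
    refine ⟨D, hD, hD', fun m hm x hx => ?_⟩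
    obtain rfl : m = 0 := by omega
    simpa using hDC x hx 0 le_rfl
  | succ k ih =>
    intro h K hK hW
    have hW' : WhitneyJet ε k K C (fun m => h (m + 1)) := by
      intro m hm x hx y hy
      have := hW (m + 1) (by omega) x hx y hy
      rw [Nat.add_sub_add_right] at this
      have e : (fun l => h (m + l + 1)) = fun l => h (m + 1 + l) := by
        funext l; congr 1; omega
      change |h (m + 1) y - taylorSum (k - m) (fun l => h (m + l + 1)) x y| ≤ _
      rw [e]; exact this
    obtain ⟨F, hF, ⟨L, hL0, hL⟩, hFC⟩ := ih _ K hK hW'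
    obtain ⟨P, hP⟩ := exists_antideriv (hF.continuousOn hε ⟨L, hL0, hL⟩)
    set G : ℕ → ℝ → ℝ := fun m => Nat.casesOn m P F with hG
    have hGj : IsJet (k + 1) I01 G := by
      intro m hm x hx
      cases m with
      | zero => exact hP x hx
      | succ m => exact hF m (by omega) x hx
    have hGC : ∀ m ≤ k, ∀ x ∈ C, G (m + 1) x = h (m + 1) x := hFC
    have hr : ∀ x ∈ C, ∀ y ∈ C, |(h 0 y - P y) - (h 0 x - P x)| ≤
        (K + L) * |y - x| ^ (((k + 1 : ℕ) : ℝ) + ε) := by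
      intro x hx y hy
      have h1 := hW 0 (by omega) x hx y hy
      simp only [zero_add, Nat.sub_zero] at h1
      have h2 : |G 0 y - taylorSum (k + 1) G x y| ≤ L * |y - x| ^ ε * |y - x| ^ (k + 1) := by
        refine hGj.taylor_bound ordConnected_Icc (k + 1) (hC.subset hx) (hC.subset hy)
          fun z hz => ?_
        have hz' : z ∈ I01 := ordConnected_Icc.uIcc_subset (hC.subset hx) (hC.subset hy) hz
        refine (hL z hz' x (hC.subset hx)).trans ?_
        have := abs_sub_left_of_mem_uIcc hz
        gcongr
      have h3 : L * |y - x| ^ ε * |y - x| ^ (k + 1) =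
          L * |y - x| ^ (((k + 1 : ℕ) : ℝ) + ε) := by
        rw [Real.rpow_add_of_nonneg (abs_nonneg _) (by positivity) hε.le, Real.rpow_natCast]
        ring
      rw [h3] at h2
      have h4 : taylorSum (k + 1) G x y - P x = taylorSum (k + 1) h x y - h 0 x := by
        rw [taylorSum_succ, taylorSum_succ]
        change P x + _ - P x = _
        rw [add_sub_cancel_left, add_sub_cancel_left]
        refine Finset.sum_congr rfl fun l hl => ?_
        rw [hGC l (by have := Finset.mem_range.mp hl; omega) x hx]
      have h5 : (h 0 y - P y) - (h 0 x - P x) =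
          (h 0 y - taylorSum (k + 1) h x y) - (G 0 y - taylorSum (k + 1) G x y) := by
        have : G 0 y = P y := rfl
        rw [this]; linarith
      rw [h5, add_mul]
      exact (abs_sub _ _).trans (add_le_add h1 h2)
    obtain ⟨D, hD, hD', hDC⟩ := exists_flat_extension hC hε hε1 (k + 1) (fun x => h 0 x - P x)
      (by positivity) hr
    refine ⟨fun m x => G m x + D m x, hGj.add hD, ?_, fun m hm x hx => ?_⟩
    · exact IsHolderSmooth.add (ε := ε) (k := 0) (f := G (k + 1)) (g := D (k + 1)) ⟨L, hL0, hL⟩ hD'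
    · change G m x + D m x = h m x
      rw [hDC x hx m hm]
      cases m with
      | zero => simp [hG]
      | succ m => simpa using hGC m (by omega) x hx

lemma sub_le_sub_of_hasDerivWithinAt_le {p q p' q' : ℝ → ℝ} {a b : ℝ} (hab : a ≤ b)
    (ha : a ∈ I01) (hb : b ∈ I01) (hp : ∀ x ∈ I01, HasDerivWithinAt p (p' x) I01 x)
    (hq : ∀ x ∈ I01, HasDerivWithinAt q (q' x) I01 x) (h : ∀ x ∈ Ioo a b, p' x ≤ q' x) :
    p b - p a ≤ q b - q a := by
  rcases hab.eq_or_lt with rfl | hab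
  · simp
  obtain ⟨ξ, hξ, e⟩ := exists_slope_eq_of_hasDerivWithinAt (f := fun x => q x - p x)
    (f' := fun x => q' x - p' x) ordConnected_Icc (fun x hx => (hq x hx).sub (hp x hx)) ha hb hab
  have := mul_nonneg (sub_nonneg.mpr (h ξ hξ)) (sub_nonneg.mpr hab.le)
  linarith

lemma exists_smooth_cutoff (C : Set ℝ) {η : ℝ} (hη : 0 < η) :
    ∃ χ : ℝ → ℝ, ContDiff ℝ (⊤ : ℕ∞) χ ∧ (∀ x, χ x ∈ I01) ∧
      (∀ x ∈ Metric.cthickening (η / 2) C, χ x = 1) ∧ ∀ x ∉ Metric.thickening η C, χ x = 0 := by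
  obtain ⟨χ, h0, h1, hχ⟩ := exists_contMDiffMap_zero_one_of_isClosed (n := (⊤ : ℕ∞))
    (modelWithCornersSelf ℝ ℝ)
    (s := (Metric.thickening η C)ᶜ) (t := Metric.cthickening (η / 2) C)
    Metric.isOpen_thickening.isClosed_compl Metric.isClosed_cthickening
    (disjoint_compl_left_iff_subset.mpr
      (Metric.cthickening_subset_thickening' hη (by linarith) C))
  exact ⟨χ, χ.contMDiff.contDiff, hχ, fun x hx => h1 hx, fun x hx => h0 hx⟩

/-- A `C^{k+1+ε}` function whose derivative lies in `(0,1)` on `C` and whose slopes over the gaps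
of `C` are bounded away from `0` and `1` can be modified off `C` into a contraction with positive
derivative. -/
lemma exists_increasing_contraction {C : Set ℝ} (hC : IsFrame C) {ε : ℝ} (hε : 0 < ε)
    (hε1 : ε ≤ 1) {k : ℕ} {f G : ℝ → ℝ} (hG : IsHolderSmooth ε k G)
    (hf : ∀ x ∈ I01, HasDerivWithinAt f (G x) I01 x) (hGC : ∀ x ∈ C, G x ∈ Ioo (0 : ℝ) 1)
    {c₀ θ : ℝ} (hc₀ : 0 < c₀) (hθ : θ < 1)
    (hgap : ∀ a b, IsGap C a b → c₀ * (b - a) ≤ f b - f a ∧ f b - f a ≤ θ * (b - a)) :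
    ∃ F F' : ℝ → ℝ, IsHolderSmooth ε k F' ∧ (∀ x ∈ I01, HasDerivWithinAt F (F' x) I01 x) ∧
      (∀ x ∈ I01, F' x ∈ Ioo (0 : ℝ) 1) ∧ ∀ x ∈ C, F x = f x := by
  have hGc := hG.continuousOn hε
  have hCc : IsCompact C := isCompact_Icc.of_isClosed_subset hC.closed hC.subset
  obtain ⟨δ, hδ, hdisj⟩ : ∃ δ > 0, ∀ x ∈ I01 ∩ Metric.cthickening δ C, G x ∈ Ioo (0 : ℝ) 1 := by
    have hK : IsClosed (I01 ∩ G ⁻¹' (Ioo 0 1)ᶜ) :=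
      hGc.preimage_isClosed_of_isClosed isClosed_Icc isOpen_Ioo.isClosed_compl
    obtain ⟨δ, hδ, h⟩ := (disjoint_left.mpr fun x hx hx' => hx'.2 (hGC x hx) :
      Disjoint C (I01 ∩ G ⁻¹' (Ioo 0 1)ᶜ)).exists_cthickenings hCc hK
    refine ⟨δ, hδ, fun x hx => ?_⟩
    by_contra hn
    exact disjoint_left.mp h hx.2 (Metric.self_subset_cthickening _ ⟨hx.1, hn⟩)
  have hcpt : IsCompact (I01 ∩ Metric.cthickening δ C) :=
    isCompact_Icc.inter_right Metric.isClosed_cthickening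
  have hne : (I01 ∩ Metric.cthickening δ C).Nonempty :=
    ⟨0, hC.subset hC.zero_mem, Metric.self_subset_cthickening _ hC.zero_mem⟩
  obtain ⟨x₀, hx₀, hmin⟩ := hcpt.exists_isMinOn hne (hGc.mono inter_subset_left)
  obtain ⟨x₁, hx₁, hmax⟩ := hcpt.exists_isMaxOn hne (hGc.mono inter_subset_left)
  have hg0 := (hdisj x₀ hx₀).1
  have hg1 := (hdisj x₁ hx₁).2
  set η : ℝ := min δ (min (c₀ * δ) ((1 - θ) * δ)) / 3 with hη_def
  have hηm : 0 < min δ (min (c₀ * δ) ((1 - θ) * δ)) := by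
    have : 0 < 1 - θ := by linarith
    positivity
  have hη : 0 < η := by positivity
  have hη3 : 3 * η = min δ (min (c₀ * δ) ((1 - θ) * δ)) := by rw [hη_def]; ring
  have hη1 : 3 * η ≤ δ := hη3.trans_le (min_le_left _ _)
  have hη2 : 3 * η ≤ c₀ * δ := hη3.trans_le ((min_le_right _ _).trans (min_le_left _ _))
  have hη4 : 3 * η ≤ (1 - θ) * δ := hη3.trans_le ((min_le_right _ _).trans (min_le_right _ _))
  obtain ⟨χ, hχs, hχ01, hχ1, hχ0⟩ := exists_smooth_cutoff C hη
  have hthick : ∀ x ∈ I01, x ∈ Metric.thickening η C → G x ∈ Ioo (0 : ℝ) 1 := fun x hx hx' =>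
    hdisj x ⟨hx, Metric.thickening_subset_cthickening_of_le (by linarith) C hx'⟩
  have hχc : ContinuousOn χ I01 := hχs.continuous.continuousOn
  obtain ⟨X, hX⟩ := exists_antideriv hχc
  obtain ⟨Y, hY⟩ : ∃ Y : ℝ → ℝ, ∀ x ∈ I01, HasDerivWithinAt Y (G x * χ x) I01 x :=
    exists_antideriv (hGc.mul hχc)
  have hid : ∀ x ∈ I01, HasDerivWithinAt (fun x : ℝ => x) ((fun _ => 1) x) I01 x :=
    fun x _ => hasDerivWithinAt_id x _
  -- total increment over a long gap of a function that is flat away from `C`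
  have hlong : ∀ a b, IsGap C a b → δ < b - a → ∀ p p' : ℝ → ℝ,
      (∀ x ∈ I01, HasDerivWithinAt p (p' x) I01 x) → (∀ x ∈ I01, p' x ≤ 1) →
      (∀ x ∉ Metric.thickening η C, p' x = 0) → p b - p a ≤ 2 * η := by
    intro a b hg hL p p' hp hp1 hp0
    have ha := hC.subset hg.left_mem
    have hb := hC.subset hg.right_mem
    have ha' : a + η ∈ I01 := ⟨by linarith [ha.1], by linarith [hb.2]⟩
    have hb' : b - η ∈ I01 := ⟨by linarith [ha.1], by linarith [hb.2]⟩
    have e1 := sub_le_sub_of_hasDerivWithinAt_le (by linarith) ha ha' hp hid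
      fun x hx => hp1 x (ordConnected_Icc.out ha ha' (Ioo_subset_Icc_self hx))
    have e3 := sub_le_sub_of_hasDerivWithinAt_le (by linarith) hb' hb hp hid
      fun x hx => hp1 x (ordConnected_Icc.out hb' hb (Ioo_subset_Icc_self hx))
    have e2 := sub_le_sub_of_hasDerivWithinAt_le (a := a + η) (b := b - η) (by linarith) ha' hb' hp
      (fun x _ => hasDerivWithinAt_const x _ (0 : ℝ)) (q' := fun _ => 0) fun x hx => by
        refine (hp0 x fun h => ?_).le
        obtain ⟨y, hy, hxy⟩ := Metric.mem_thickening_iff.mp h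
        rw [Real.dist_eq, abs_lt] at hxy
        exact hg.notMem y ⟨by linarith [hx.1], by linarith [hx.2]⟩ hy
    linarith
  have hconst : ∀ a b, IsGap C a b → ∃ c ∈ Ioo (0 : ℝ) 1,
      f b - f a - (Y b - Y a) = c * ((b - a) - (X b - X a)) := by
    intro a b hg
    have ha := hC.subset hg.left_mem
    have hb := hC.subset hg.right_mem
    have hfY : ∀ x ∈ I01, HasDerivWithinAt (fun x => f x - Y x) (G x - G x * χ x) I01 x :=
      fun x hx => (hf x hx).sub (hY x hx)
    have hiX : ∀ x ∈ I01, HasDerivWithinAt (fun x => x - X x) (1 - χ x) I01 x :=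
      fun x hx => (hid x hx).sub (hX x hx)
    rcases le_or_gt (b - a) δ with hL | hL
    · have hin : ∀ x ∈ Ioo a b, x ∈ I01 ∩ Metric.cthickening δ C := fun x hx =>
        ⟨hg.mem_I01 hC (Ioo_subset_Icc_self hx),
          Metric.mem_cthickening_of_dist_le x a δ C hg.left_mem (by
          rw [Real.dist_eq, abs_of_pos (by linarith [hx.1])]; linarith [hx.2])⟩
      have e1 := sub_le_sub_of_hasDerivWithinAt_le hg.lt.le ha hb
        (fun x hx => (hiX x hx).const_mul (G x₀)) hfY fun x hx => by
          nlinarith [(hχ01 x).2, isMinOn_iff.mp hmin x (hin x hx)]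
      have e2 := sub_le_sub_of_hasDerivWithinAt_le hg.lt.le ha hb hfY
        (fun x hx => (hiX x hx).const_mul (G x₁)) fun x hx => by
          nlinarith [(hχ01 x).2, isMaxOn_iff.mp hmax x (hin x hx)]
      have e3 := sub_le_sub_of_hasDerivWithinAt_le hg.lt.le ha hb hX hid fun x _ => (hχ01 x).2
      rcases eq_or_ne ((b - a) - (X b - X a)) 0 with h0 | h0
      · refine ⟨1 / 2, by norm_num, ?_⟩
        have h0' : b - X b = a - X a := by linarith
        rw [h0, mul_zero]
        rw [h0'] at e1 e2
        linarith
      · have hD : 0 < (b - a) - (X b - X a) := lt_of_le_of_ne (by linarith) (Ne.symm h0)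
        refine ⟨(f b - f a - (Y b - Y a)) / ((b - a) - (X b - X a)), ⟨?_, ?_⟩,
          (div_mul_cancel₀ _ h0).symm⟩
        · exact div_pos (by nlinarith) hD
        · rw [div_lt_one hD]; nlinarith
    · have h1 := hlong a b hg hL Y _ hY (fun x hx => by
          by_cases h : x ∈ Metric.thickening η C
          · have := hthick x hx h
            exact mul_le_one₀ this.2.le (hχ01 x).1 (hχ01 x).2
          · simp [hχ0 x h]) fun x h => by simp [hχ0 x h]
      have h2 := hlong a b hg hL (fun x => X x - Y x) (fun x => χ x - G x * χ x)
        (fun x hx => (hX x hx).sub (hY x hx)) (fun x hx => by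
          by_cases h : x ∈ Metric.thickening η C
          · have := hthick x hx h
            nlinarith [(hχ01 x).1, (hχ01 x).2, mul_nonneg this.1.le (hχ01 x).1]
          · simp [hχ0 x h]) fun x h => by simp [hχ0 x h]
      obtain ⟨g1, g2⟩ := hgap a b hg
      have hN : 0 < f b - f a - (Y b - Y a) := by nlinarith
      have hDN : f b - f a - (Y b - Y a) < (b - a) - (X b - X a) := by nlinarith
      have hD := hN.trans hDN
      exact ⟨_, ⟨div_pos hN hD, (div_lt_one hD).mpr hDN⟩, (div_mul_cancel₀ _ hD.ne').symm⟩
  choose! c hc hcN using hconst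
  set F : ℝ → ℝ := fun x => f (gapLeft C x) + (Y x - Y (gapLeft C x)) +
    c (gapLeft C x) (gapRight C x) * ((x - gapLeft C x) - (X x - X (gapLeft C x))) with hF
  set e : ℝ → ℝ := fun x => c (gapLeft C x) (gapRight C x) * (1 - χ x) with he
  have hFC : ∀ x ∈ C, F x = f x := fun x hx => by simp [hF, hC.gapLeft_of_mem hx]
  have hFg : ∀ a b, IsGap C a b → ∀ x ∈ Ioo a b, F x = f a + (Y x - Y a) +
      c a b * ((x - a) - (X x - X a)) := fun a b hg x hx => by
    simp [hF, hg.gapLeft_eq hC hx, hg.gapRight_eq hC hx]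
  have heg : ∀ a b, IsGap C a b → ∀ x ∈ Ioo a b, e x = c a b * (1 - χ x) :=
    fun a b hg x hx => by simp [he, hg.gapLeft_eq hC hx, hg.gapRight_eq hC hx]
  have hnear : ∀ x ∈ C, ∀ᶠ y in nhdsWithin x I01, χ y = 1 ∧ F y = f y := by
    intro x hx
    have hball : Metric.ball x (η / 2) ∈ nhdsWithin x I01 :=
      mem_nhdsWithin_of_mem_nhds (Metric.ball_mem_nhds x (by positivity))
    filter_upwards [hball, self_mem_nhdsWithin] with y hyb hy
    have hcl : ∀ c ∈ C, ∀ z, |z - c| ≤ η / 2 → χ z = 1 := fun c hc z hz =>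
      hχ1 z (Metric.mem_cthickening_of_dist_le z c _ C hc (by rwa [Real.dist_eq]))
    rw [Metric.mem_ball, Real.dist_eq] at hyb
    refine ⟨hcl x hx y hyb.le, ?_⟩
    by_cases hyC : y ∈ C
    · exact hFC y hyC
    have hg := hC.isGap hy hyC
    have hy' := hC.mem_gap hy hyC
    rw [hFg _ _ hg y hy']
    have key : ∀ p q : ℝ, p ≤ q → p ∈ I01 → q ∈ I01 → (∀ z ∈ Ioo p q, χ z = 1) →
        Y q - Y p = f q - f p ∧ X q - X p = q - p := by
      intro p q hpq hp hq h1
      refine ⟨le_antisymm ?_ ?_, le_antisymm ?_ ?_⟩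
      · exact sub_le_sub_of_hasDerivWithinAt_le hpq hp hq hY hf fun z hz => by simp [h1 z hz]
      · exact sub_le_sub_of_hasDerivWithinAt_le hpq hp hq hf hY fun z hz => by simp [h1 z hz]
      · exact sub_le_sub_of_hasDerivWithinAt_le hpq hp hq hX hid fun z hz => by simp [h1 z hz]
      · exact sub_le_sub_of_hasDerivWithinAt_le hpq hp hq hid hX fun z hz => by simp [h1 z hz]
    rw [abs_lt] at hyb
    rcases le_total x y with h | h
    · have hl := le_gapLeft hx h
      obtain ⟨k1, k2⟩ := key _ y hy'.1.le (hC.subset hg.left_mem) hy fun z hz =>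
        hcl _ hg.left_mem z (by rw [abs_of_pos (by linarith [hz.1])]; linarith [hz.2])
      rw [k1, k2]; ring
    · have hl := gapRight_le hx h
      obtain ⟨k1, k2⟩ := key y _ hy'.2.le hy (hC.subset hg.right_mem) fun z hz =>
        hcl _ hg.right_mem z (by rw [abs_of_neg (by linarith [hz.2])]; linarith [hz.1])
      have hN := hcN _ _ hg
      have e1 : y - gapLeft C y - (X y - X (gapLeft C y)) =
        gapRight C y - gapLeft C y - (X (gapRight C y) - X (gapLeft C y)) := by linarith
      rw [e1, ← hN]; linarith
  have hes : ContDiffOn ℝ (k + 1 : ℕ) e I01 := by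
    have hχk : ContDiff ℝ (k + 1 : ℕ) χ := hχs.of_le (by exact_mod_cast le_top)
    intro x hx
    by_cases hxC : x ∈ C
    · refine (contDiffWithinAt_const (c := (0 : ℝ))).congr_of_eventuallyEq ?_ ?_
      · filter_upwards [hnear x hxC] with y hy
        simp [he, hy.1]
      · have := ((hnear x hxC).self_of_nhdsWithin hx).1
        simp [he, this]
    · have hg := hC.isGap hx hxC
      have hx' := hC.mem_gap hx hxC
      refine ContDiffAt.contDiffWithinAt ?_
      have h1 : ContDiffAt ℝ (k + 1 : ℕ) (fun y => c (gapLeft C x) (gapRight C x) * (1 - χ y)) x :=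
        (contDiff_const.mul (contDiff_const.sub hχk)).contDiffAt
      refine h1.congr_of_eventuallyEq ?_
      filter_upwards [Ioo_mem_nhds hx'.1 hx'.2] with y hy using heg _ _ hg y hy
  have hχH : IsHolderSmooth ε k χ :=
    isHolderSmooth_of_contDiffOn hε1 (hχs.of_le (by exact_mod_cast le_top)).contDiffOn
  refine ⟨F, fun x => G x * χ x + e x, ?_, ?_, ?_, hFC⟩
  · exact (hG.mul hε hε1 hχH).add (isHolderSmooth_of_contDiffOn hε1 hes)
  · intro x hx
    by_cases hxC : x ∈ C
    · have h1 := (hnear x hxC).self_of_nhdsWithin hx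
      have : G x * χ x + e x = G x := by simp [he, h1.1]
      change HasDerivWithinAt F (G x * χ x + e x) I01 x
      rw [this]
      exact (hf x hx).congr_of_eventuallyEq ((hnear x hxC).mono fun y hy => hy.2) h1.2
    · have hg := hC.isGap hx hxC
      have hx' := hC.mem_gap hx hxC
      change HasDerivWithinAt F (G x * χ x + e x) I01 x
      rw [heg _ _ hg x hx']
      have h1 := (((hY x hx).sub_const (Y (gapLeft C x))).const_add (f (gapLeft C x))).add
        ((((hid x hx).sub_const (gapLeft C x)).sub ((hX x hx).sub_const
          (X (gapLeft C x)))).const_mul (c (gapLeft C x) (gapRight C x)))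
      refine h1.congr_of_eventuallyEq ?_ (hFg _ _ hg x hx')
      filter_upwards [mem_nhdsWithin_of_mem_nhds (Ioo_mem_nhds hx'.1 hx'.2)] with y hy
      exact hFg _ _ hg y hy
  · intro x hx
    by_cases hxC : x ∈ C
    · have h1 := (hnear x hxC).self_of_nhdsWithin hx
      have : G x * χ x + e x = G x := by simp [he, h1.1]
      simpa only [this] using hGC x hxC
    · have hg := hC.isGap hx hxC
      have hcc := hc _ _ hg
      by_cases h : x ∈ Metric.thickening η C
      · have hGx := hthick x hx h
        have h0 := (hχ01 x).1
        have h1 := (hχ01 x).2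
        constructor
        · rcases h0.eq_or_lt with h0 | h0
          · simpa [he, ← h0] using hcc.1
          · exact add_pos_of_pos_of_nonneg (mul_pos hGx.1 h0)
              (mul_nonneg hcc.1.le (by linarith))
        · rcases h0.eq_or_lt with h0 | h0
          · simpa [he, ← h0] using hcc.2
          · simp only [he]
            nlinarith [mul_lt_mul_of_pos_right hGx.2 h0,
              mul_le_mul_of_nonneg_right hcc.2.le (sub_nonneg.mpr h1)]
      · simpa [he, hχ0 x h] using hcc

/-! ### The partition of `[0,1]` determined by a scaling vector -/

/-- The `n`-th length, from left to right, of the partition determined by `s`. -/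
noncomputable def partLen {d : ℕ} (s : Fin (2 * d - 1) → ℝ) (n : ℕ) : ℝ :=
  if h : (if n % 2 = 0 then n / 2 else d + n / 2) < 2 * d - 1 then s ⟨_, h⟩ else 0

/-- The `n`-th endpoint, from left to right, of the partition determined by `s`. -/
noncomputable def partPt {d : ℕ} (s : Fin (2 * d - 1) → ℝ) (n : ℕ) : ℝ :=
  ∑ m ∈ Finset.range n, partLen s m

section Partition

variable {d : ℕ} (s : Fin (2 * d - 1) → ℝ)

lemma partPt_zero : partPt s 0 = 0 := by simp [partPt]

lemma partPt_succ (n : ℕ) : partPt s (n + 1) = partPt s n + partLen s n :=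
  Finset.sum_range_succ _ _

lemma partLen_even (n : ℕ) (h : n < d) : partLen s (2 * n) = s ⟨n, by omega⟩ := by
  have e : (if 2 * n % 2 = 0 then 2 * n / 2 else d + 2 * n / 2) = n := by
    rw [if_pos (by omega)]; omega
  rw [partLen, dif_pos (by rw [e]; omega)]
  congr 1; exact Fin.ext e

lemma partLen_odd (n : ℕ) (h : n + 1 < d) : partLen s (2 * n + 1) = s ⟨d + n, by omega⟩ := by
  have e : (if (2 * n + 1) % 2 = 0 then (2 * n + 1) / 2 else d + (2 * n + 1) / 2) = d + n := by
    rw [if_neg (by omega)]; omega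
  rw [partLen, dif_pos (by rw [e]; omega)]
  congr 1; exact Fin.ext e

lemma exists_partLen (hd : 1 ≤ d) (m : Fin (2 * d - 1)) :
    ∃ n, n + 1 < 2 * d ∧ ∀ s : Fin (2 * d - 1) → ℝ, s m = partLen s n := by
  have := m.isLt
  by_cases h : (m : ℕ) < d
  · exact ⟨2 * m, by omega, fun s => by rw [partLen_even s _ h]⟩
  · refine ⟨2 * (m - d) + 1, by omega, fun s => ?_⟩
    rw [partLen_odd s _ (by omega)]
    congr 1; exact Fin.ext (by simp; omega)

lemma exists_eq_partLen (n : ℕ) (hn : n + 1 < 2 * d) :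
    ∃ m, ∀ s : Fin (2 * d - 1) → ℝ, partLen s n = s m := by
  rcases Nat.even_or_odd' n with ⟨m, rfl | rfl⟩
  · exact ⟨_, fun s => partLen_even s m (by omega)⟩
  · exact ⟨_, fun s => partLen_odd s m (by omega)⟩

lemma childLeft_eq_partPt (i : Fin d) : childLeft s i = partPt s (2 * i) := by
  have key : ∀ n ≤ (i : ℕ), ∑ m ∈ Finset.range n, (partLen s (2 * m) + partLen s (2 * m + 1)) =
      partPt s (2 * n) := by
    intro n
    induction n with
    | zero => simp [partPt]
    | succ n ih =>
      intro h
      rw [Finset.sum_range_succ, ih (by omega), show 2 * (n + 1) = 2 * n + 1 + 1 by ring,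
        partPt_succ, partPt_succ, add_assoc]
  rw [← key i le_rfl, childLeft,
    ← Finset.sum_attach (Finset.range i) fun m => partLen s (2 * m) + partLen s (2 * m + 1)]
  refine Finset.sum_congr rfl fun m _ => ?_
  have h := Finset.mem_range.mp m.2
  have := i.isLt
  rw [partLen_even s _ (by omega), partLen_odd s _ (by omega)]

lemma childRight_eq_partPt (i : Fin d) : childRight s i = partPt s (2 * i + 1) := by
  rw [childRight, childLeft_eq_partPt, partPt_succ, partLen_even s i i.isLt]

lemma Apts_eq_range : Apts s = range fun n : Fin (2 * d) => partPt s n := by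
  ext x
  simp only [Apts, mem_iUnion, mem_insert_iff, mem_singleton_iff, mem_range]
  constructor
  · rintro ⟨i, rfl | rfl⟩
    · exact ⟨⟨2 * i, by omega⟩, (childLeft_eq_partPt s i).symm⟩
    · exact ⟨⟨2 * i + 1, by omega⟩, (childRight_eq_partPt s i).symm⟩
  · rintro ⟨⟨n, hn⟩, rfl⟩
    rcases Nat.even_or_odd' n with ⟨m, rfl | rfl⟩
    · exact ⟨⟨m, by omega⟩, Or.inl (childLeft_eq_partPt s ⟨m, by omega⟩).symm⟩
    · exact ⟨⟨m, by omega⟩, Or.inr (childRight_eq_partPt s ⟨m, by omega⟩).symm⟩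

lemma partPt_last (hd : 1 ≤ d) : partPt s (2 * d - 1) = ∑ m, s m := by
  have key : ∀ n < d, partPt s (2 * n + 1) = ∑ m ∈ Finset.range (n + 1), partLen s (2 * m) +
      ∑ m ∈ Finset.range n, partLen s (2 * m + 1) := by
    intro n
    induction n with
    | zero => simp [partPt]
    | succ n ih =>
      intro h
      rw [show 2 * (n + 1) + 1 = 2 * n + 1 + 1 + 1 by ring, partPt_succ, partPt_succ,
        ih (by omega), Finset.sum_range_succ _ (n + 1),
        Finset.sum_range_succ (fun m => partLen s (2 * m + 1)) n,
        show 2 * n + 1 + 1 = 2 * (n + 1) by ring]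
      ring
  have e : 2 * d - 1 = 2 * (d - 1) + 1 := by omega
  have e2 : 2 * d - 1 = d + (d - 1) := by omega
  set q : ℕ → ℝ := fun n => if h : n < 2 * d - 1 then s ⟨n, h⟩ else 0 with hq
  have h1 : ∑ m, s m = ∑ m ∈ Finset.range (2 * d - 1), q m := by
    rw [Finset.sum_range]
    exact Finset.sum_congr rfl fun m _ => by simp [hq]
  rw [h1]
  conv_lhs => rw [e]
  rw [key _ (by omega), Nat.sub_add_cancel hd]
  conv_rhs => rw [e2, Finset.sum_range_add]
  congr 1
  · refine Finset.sum_congr rfl fun m hm => ?_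
    have := Finset.mem_range.mp hm
    rw [partLen_even s m this, hq]
    simp only
    rw [dif_pos (by omega)]
  · refine Finset.sum_congr rfl fun m hm => ?_
    have := Finset.mem_range.mp hm
    rw [partLen_odd s m (by omega), hq]
    simp only
    rw [dif_pos (by omega)]

variable {s}

lemma partLen_pos (hs : s ∈ Simp d) {n : ℕ} (hn : n + 1 < 2 * d) : 0 < partLen s n := by
  obtain ⟨m, hm⟩ := exists_eq_partLen n hn
  rw [hm]; exact (hs.1 m).1

lemma partPt_lt (hs : s ∈ Simp d) {n n' : ℕ} (h : n < n') (hn : n' < 2 * d) :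
    partPt s n < partPt s n' := by
  obtain ⟨l, rfl⟩ : ∃ l, n' = n + l + 1 := ⟨n' - n - 1, by omega⟩
  clear h
  induction l with
  | zero =>
    rw [Nat.add_zero, partPt_succ]
    linarith [partLen_pos hs hn]
  | succ l ih =>
    have := ih (by omega)
    rw [← add_assoc, partPt_succ s (n + l + 1)]
    linarith [partLen_pos hs (n := n + l + 1) (by omega)]

lemma partPt_le (hs : s ∈ Simp d) {n n' : ℕ} (h : n ≤ n') (hn : n' < 2 * d) :
    partPt s n ≤ partPt s n' := by
  rcases h.eq_or_lt with rfl | h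
  · rfl
  · exact (partPt_lt hs h hn).le

lemma partPt_mem_I01 (hs : s ∈ Simp d) {n : ℕ} (hn : n < 2 * d) : partPt s n ∈ I01 := by
  constructor
  · rw [← partPt_zero s]; exact partPt_le hs (Nat.zero_le _) hn
  · rw [← hs.2, ← partPt_last s (by omega)]; exact partPt_le hs (by omega) (by omega)

/-- An increasing map between the partition endpoints preserves their order. -/
lemma map_partPt {s' : Fin (2 * d - 1) → ℝ} (hs : s ∈ Simp d) (hs' : s' ∈ Simp d)
    {φ : ℝ → ℝ} (hφ : StrictMonoOn φ I01) (h : φ '' Apts s = Apts s') {n : ℕ} (hn : n < 2 * d) :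
    φ (partPt s n) = partPt s' n := by
  rw [Apts_eq_range, Apts_eq_range, ← range_comp] at h
  have h1 : StrictMono (φ ∘ fun n : Fin (2 * d) => partPt s n) := fun a b hab =>
    hφ (partPt_mem_I01 hs a.isLt) (partPt_mem_I01 hs b.isLt) (partPt_lt hs hab b.isLt)
  have h2 : StrictMono fun n : Fin (2 * d) => partPt s' n := fun a b hab =>
    partPt_lt hs' hab b.isLt
  exact congrFun ((StrictMono.range_inj h1 h2).mp h) ⟨n, hn⟩

lemma childLeft_mem_I01 (hs : s ∈ Simp d) (i : Fin d) : childLeft s i ∈ I01 := by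
  rw [childLeft_eq_partPt]; exact partPt_mem_I01 hs (by omega)

lemma childRight_mem_I01 (hs : s ∈ Simp d) (i : Fin d) : childRight s i ∈ I01 := by
  rw [childRight_eq_partPt]; exact partPt_mem_I01 hs (by omega)

end Partition

/-! ### Scaling functions satisfying the matching condition -/

/-- The hypotheses on the scaling function `S` in the sufficiency theorem. -/
structure IsMatched {d : ℕ} (k : ℕ) (ε C : ℝ) (S : (ℕ → Fin d) → Fin (2 * d - 1) → ℝ) :
    Prop where
  two_le : 2 ≤ d
  one_le : 1 ≤ k
  lt_two_mul : k < 2 * d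
  ε_pos : 0 < ε
  ε_le_one : ε ≤ 1
  mem_Simp : ∀ j, S j ∈ Simp d
  cont : Continuous S
  C_pos : 0 < C
  matching : ∀ j j' : ℕ → Fin d, ∀ p : ℕ,
      (∀ t < p, j t = j' t) → j p ≠ j' p →
      ∀ j₀ : Fin d, ∃ ψ : ℝ → ℝ,
        ψ ∈ DkVar k (C * rhoS S j p ^ ((k : ℝ) + ε - 1)) (Apts (S j)) (Apts (S j')) ∧
        Rmap (S j) (S j') j₀ ψ ∈
          DkVar k (C * rhoS S (consSeq j₀ j) (p + 1) ^ ((k : ℝ) + ε - 1))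
            (Apts (S (consSeq j₀ j))) (Apts (S (consSeq j₀ j')))

section Rho

variable {d : ℕ} (S : (ℕ → Fin d) → Fin (2 * d - 1) → ℝ)

/-- The product whose supremum over the tails `w` is `rhoS S j n`. -/
noncomputable def rhoTerm (j : ℕ → Fin d) (n : ℕ) (w : ℕ → Fin d) : ℝ :=
  ∏ t ∈ Finset.range n,
    S (fun m => if t + 1 + m < n then j (t + 1 + m) else w (t + 1 + m - n))
      ⟨((j t) : ℕ), by have := (j t).isLt; omega⟩

lemma rhoTerm_consSeq (i : Fin d) (j : ℕ → Fin d) (n : ℕ) (w : ℕ → Fin d) :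
    rhoTerm S (consSeq i j) (n + 1) w =
      S (fun m => if m < n then j m else w (m - n)) ⟨i, by omega⟩ * rhoTerm S j n w := by
  rw [rhoTerm, Finset.prod_range_succ', mul_comm]
  congr 1
  · have : (fun m => if 0 + 1 + m < n + 1 then consSeq i j (0 + 1 + m)
        else w (0 + 1 + m - (n + 1))) = fun m => if m < n then j m else w (m - n) := by
      funext m
      simp only [consSeq, show 0 + 1 + m = m + 1 by ring, Nat.add_lt_add_iff_right,
        Nat.add_sub_add_right, Nat.succ_ne_zero, if_false, Nat.add_sub_cancel]
    rw [this]
    simp [consSeq]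
  · refine Finset.prod_congr rfl fun t _ => ?_
    have : (fun m => if t + 1 + 1 + m < n + 1 then consSeq i j (t + 1 + 1 + m)
        else w (t + 1 + 1 + m - (n + 1))) =
        fun m => if t + 1 + m < n then j (t + 1 + m) else w (t + 1 + m - n) := by
      funext m
      simp only [consSeq, show t + 1 + 1 + m = t + 1 + m + 1 by ring, Nat.add_lt_add_iff_right,
        Nat.add_sub_add_right, Nat.succ_ne_zero, if_false, Nat.add_sub_cancel]
    rw [this]
    simp [consSeq]

variable {S}

lemma rhoTerm_nonneg (hS : ∀ j, S j ∈ Simp d) (j : ℕ → Fin d) (n : ℕ) (w : ℕ → Fin d) :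
    0 ≤ rhoTerm S j n w :=
  Finset.prod_nonneg fun _ _ => ((hS _).1 _).1.le

lemma rhoTerm_le_pow {θ : ℝ} (hS : ∀ j, S j ∈ Simp d) (hθ : ∀ j m, S j m ≤ θ) (j : ℕ → Fin d)
    (n : ℕ) (w : ℕ → Fin d) : rhoTerm S j n w ≤ θ ^ n := by
  have := Finset.prod_le_prod (s := Finset.range n) (g := fun _ => θ)
    (fun t _ => ((hS (fun m => if t + 1 + m < n then j (t + 1 + m) else w (t + 1 + m - n))).1
      ⟨((j t) : ℕ), by have := (j t).isLt; omega⟩).1.le) fun t _ => hθ _ _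
  simpa [rhoTerm] using this

lemma rhoS_nonneg (hS : ∀ j, S j ∈ Simp d) (j : ℕ → Fin d) (n : ℕ) : 0 ≤ rhoS S j n :=
  Real.iSup_nonneg fun w => rhoTerm_nonneg hS j n w

lemma rhoS_le {a : ℝ} {j : ℕ → Fin d} {n : ℕ} (h : ∀ w, rhoTerm S j n w ≤ a) : rhoS S j n ≤ a :=
  have : Nonempty (ℕ → Fin d) := ⟨j⟩
  ciSup_le h

lemma rhoTerm_le_rhoS (hS : ∀ j, S j ∈ Simp d) (j : ℕ → Fin d) (n : ℕ) (w : ℕ → Fin d) :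
    rhoTerm S j n w ≤ rhoS S j n :=
  le_ciSup (f := rhoTerm S j n)
    ⟨1, by rintro _ ⟨w, rfl⟩; simpa using rhoTerm_le_pow hS (fun j m => ((hS j).1 m).2.le) j n w⟩ w

lemma rhoS_consSeq_le (hS : ∀ j, S j ∈ Simp d) (i : Fin d) (j : ℕ → Fin d) (n : ℕ) :
    rhoS S (consSeq i j) (n + 1) ≤ rhoS S j n := by
  refine rhoS_le fun w => ?_
  rw [rhoTerm_consSeq]
  exact (mul_le_of_le_one_left (rhoTerm_nonneg hS _ _ _) ((hS _).1 _).2.le).trans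
    (rhoTerm_le_rhoS hS _ _ _)

end Rho

section Compactness

variable {d : ℕ} {S : (ℕ → Fin d) → Fin (2 * d - 1) → ℝ}

lemma exists_scaling_bounds (hd : 2 ≤ d) (hS : ∀ j, S j ∈ Simp d) (hc : Continuous S) :
    ∃ σ θ : ℝ, 0 < σ ∧ 0 < θ ∧ θ < 1 ∧ ∀ j m, σ ≤ S j m ∧ S j m ≤ θ := by
  have hc' : Continuous fun p : (ℕ → Fin d) × Fin (2 * d - 1) => S p.1 p.2 :=
    continuous_prod_of_discrete_right.mpr fun m => (continuous_apply m).comp hc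
  have : Nonempty ((ℕ → Fin d) × Fin (2 * d - 1)) :=
    ⟨(fun _ => ⟨0, by omega⟩, ⟨0, by omega⟩)⟩
  obtain ⟨p, -, hp⟩ := isCompact_univ.exists_isMinOn univ_nonempty hc'.continuousOn
  obtain ⟨q, -, hq⟩ := isCompact_univ.exists_isMaxOn univ_nonempty hc'.continuousOn
  exact ⟨_, _, ((hS p.1).1 p.2).1, ((hS q.1).1 q.2).1, ((hS q.1).1 q.2).2, fun j m =>
    ⟨isMinOn_iff.mp hp (j, m) (mem_univ _), isMaxOn_iff.mp hq (j, m) (mem_univ _)⟩⟩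

lemma exists_agree_close (hc : Continuous S) {η : ℝ} (hη : 0 < η) :
    ∃ n, ∀ j j' : ℕ → Fin d, (∀ t < n, j t = j' t) → ∀ m, |S j m - S j' m| ≤ η := by
  let _ : MetricSpace (ℕ → Fin d) := PiNat.metricSpace
  have hu := CompactSpace.uniformContinuous_of_continuous hc
  obtain ⟨δ, hδ, h⟩ := Metric.uniformContinuous_iff.mp hu η hη
  obtain ⟨n, hn⟩ := exists_pow_lt_of_lt_one hδ (by norm_num : (1 / 2 : ℝ) < 1)
  refine ⟨n, fun j j' hj m => ?_⟩
  have h1 : dist j j' ≤ (1 / 2) ^ n := PiNat.mem_cylinder_iff_dist_le.mp fun t ht => hj t ht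
  exact (dist_le_pi_dist (S j) (S j') m).trans (h (h1.trans_lt hn)).le

end Compactness

/-- The jet `F` is that of a map of `[0,1]` to itself sending the partition determined by `s` to
the one determined by `s'`, and its top derivative has variation at most `V`. -/
structure IsComparison {d : ℕ} (k : ℕ) (V : ℝ) (s s' : Fin (2 * d - 1) → ℝ) (F : ℕ → ℝ → ℝ) :
    Prop where
  jet : IsJet k I01 F
  mapsTo : MapsTo (F 0) I01 I01
  map_pt : ∀ n < 2 * d, F 0 (partPt s n) = partPt s' n
  var_le : ∀ x ∈ I01, ∀ y ∈ I01, |F k x - F k y| ≤ V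

lemma isComparison_of_mem_DkVar {d k : ℕ} {V : ℝ} {s s' : Fin (2 * d - 1) → ℝ} {ψ : ℝ → ℝ}
    (hs : s ∈ Simp d) (hs' : s' ∈ Simp d) (h : ψ ∈ DkVar k V (Apts s) (Apts s')) :
    IsComparison k V s s' (fun m => iteratedDerivWithin m ψ I01) where
  jet := isJet_iteratedDerivWithin uniqueDiffOn_I01 h.1.1.smooth
  mapsTo := by simpa only [iteratedDerivWithin_zero] using h.1.1.bij.mapsTo
  map_pt := fun n hn => by
    simpa only [iteratedDerivWithin_zero] using map_partPt hs hs' h.1.1.mono h.1.2 hn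
  var_le := fun x hx y hy => (h.2 x hx y hy).le

lemma IsComparison.abs_sub_le {d k : ℕ} {V W : ℝ} {s s' : Fin (2 * d - 1) → ℝ}
    {F G : ℕ → ℝ → ℝ} (hs : s ∈ Simp d) (hk : k < 2 * d) (hF : IsComparison k V s s' F)
    (hG : IsComparison k W s s' G) : ∀ m ≤ k, ∀ y ∈ I01, |F m y - G m y| ≤ V + W := by
  refine (hF.jet.sub hG.jet).abs_le_of_zeros (partPt s)
    (fun i hi => partPt_mem_I01 hs (by omega)) (fun i hi => partPt_lt hs (by omega) (by omega))
    (fun i hi => ?_) fun x hx y hy => ?_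
  · rw [hF.map_pt i (by omega), hG.map_pt i (by omega), sub_self]
  · have h1 := hF.var_le x hx y hy
    have h2 := hG.var_le x hx y hy
    rw [show F k x - G k x - (F k y - G k y) = (F k x - F k y) - (G k x - G k y) by ring]
    exact (abs_sub _ _).trans (add_le_add h1 h2)

/-- The jet of `z ↦ (F 0 (a + ℓ z) - a') / ℓ'`. -/
noncomputable def renormJet (a ℓ a' ℓ' : ℝ) (F : ℕ → ℝ → ℝ) (m : ℕ) (z : ℝ) : ℝ :=
  ℓ ^ m / ℓ' * F m (a + ℓ * z) - if m = 0 then a' / ℓ' else 0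

lemma IsJet.renormJet {k : ℕ} {a ℓ a' ℓ' : ℝ} {F : ℕ → ℝ → ℝ} (hF : IsJet k I01 F)
    (h : MapsTo (fun z => a + ℓ * z) I01 I01) : IsJet k I01 (renormJet a ℓ a' ℓ' F) := by
  intro m hm x hx
  have h1 : HasDerivWithinAt (fun z => a + ℓ * z) ℓ I01 x := by
    simpa using ((hasDerivWithinAt_id x I01).const_mul ℓ).const_add a
  have h2 := (((hF m hm _ (h hx)).comp x h1 h).const_mul (ℓ ^ m / ℓ')).sub_const
    (if m = 0 then a' / ℓ' else 0)
  refine h2.congr_deriv ?_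
  simp only [_root_.renormJet, Nat.succ_ne_zero, if_false, sub_zero, pow_succ]
  ring

section Child

variable {d : ℕ} {s : Fin (2 * d - 1) → ℝ}

lemma child_mapsTo (hs : s ∈ Simp d) (i : Fin d) :
    MapsTo (fun z => childLeft s i + s ⟨i, by omega⟩ * z) I01 I01 := by
  intro z hz
  have h1 := childLeft_mem_I01 hs i
  have h2 := childRight_mem_I01 hs i
  have h3 := (hs.1 ⟨i, by omega⟩).1
  rw [childRight] at h2
  exact ⟨add_nonneg h1.1 (mul_nonneg h3.le hz.1),
    (by nlinarith [hz.2] : _ ≤ childLeft s i + s ⟨i, _⟩).trans h2.2⟩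

end Child

namespace IsMatched

variable {d k : ℕ} {ε C : ℝ} {S : (ℕ → Fin d) → Fin (2 * d - 1) → ℝ}

lemma exponent_pos (h : IsMatched k ε C S) : 0 < (k : ℝ) + ε - 1 := by
  have : (1 : ℝ) ≤ k := by exact_mod_cast h.one_le
  linarith [h.ε_pos]

/-- For all pairs of distinct sequences one can choose comparison jets that are compatible with
renormalization up to an error controlled by `rhoS`. -/
theorem exists_comparisons (h : IsMatched k ε C S) :
    ∃ (D : (ℕ → Fin d) → (ℕ → Fin d) → ℕ → ℝ → ℝ) (B K : ℝ), 0 ≤ B ∧ 0 ≤ K ∧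
      ∀ (j j' : ℕ → Fin d) (p : ℕ), (∀ t < p, j t = j' t) → j p ≠ j' p →
        IsComparison k (C * rhoS S j p ^ ((k : ℝ) + ε - 1)) (S j) (S j') (D j j') ∧
        (∀ m ≤ k, ∀ x ∈ I01, |D j j' m x| ≤ B) ∧
        ∀ i : Fin d, ∀ m ≤ k, ∀ z ∈ I01,
          |renormJet (childLeft (S j) i) (S j ⟨i, by omega⟩) (childLeft (S j') i)
              (S j' ⟨i, by omega⟩) (D j j') m z - D (consSeq i j) (consSeq i j') m z| ≤
            K * rhoS S j p ^ ((k : ℝ) + ε - 1) := by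
  obtain ⟨σ, θ, hσ, -, hθ1, hb⟩ := exists_scaling_bounds h.two_le h.mem_Simp h.cont
  obtain ⟨B, hB, hBF⟩ := IsJet.uniform_bound k C
  have hκ := h.exponent_pos
  have hex : ∀ j j' : ℕ → Fin d, ∃ F : ℕ → ℝ → ℝ, ∀ p, (∀ t < p, j t = j' t) → j p ≠ j' p →
      IsComparison k (C * rhoS S j p ^ ((k : ℝ) + ε - 1)) (S j) (S j') F := by
    intro j j'
    by_cases hj : ∃ p, (∀ t < p, j t = j' t) ∧ j p ≠ j' p
    · obtain ⟨p, hp, hp'⟩ := hj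
      obtain ⟨ψ, hψ, -⟩ := h.matching j j' p hp hp' (j 0)
      refine ⟨fun m => iteratedDerivWithin m ψ I01, fun q hq hq' => ?_⟩
      obtain rfl : p = q := by
        rcases lt_trichotomy p q with hpq | hpq | hpq
        · exact absurd (hq p hpq) hp'
        · exact hpq
        · exact absurd (hp q hpq) hq'
      exact isComparison_of_mem_DkVar (h.mem_Simp j) (h.mem_Simp j') hψ
    · exact ⟨fun _ _ => 0, fun p hp hp' => absurd ⟨p, hp, hp'⟩ hj⟩
  choose D hD using hex
  have hC := h.C_pos
  refine ⟨D, B, (C + C) / σ + (C + C), hB, by positivity, fun j j' p hp hp' => ?_⟩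
  have hρ0 := rhoS_nonneg h.mem_Simp j p
  have hρ1 : rhoS S j p ≤ 1 := rhoS_le fun w => by
    simpa using rhoTerm_le_pow h.mem_Simp (fun j m => ((h.mem_Simp j).1 m).2.le) j p w
  set V := rhoS S j p ^ ((k : ℝ) + ε - 1) with hV
  have hV0 : 0 ≤ V := Real.rpow_nonneg hρ0 _
  have hV1 : V ≤ 1 := Real.rpow_le_one hρ0 hρ1 hκ.le
  have hDj := hD j j' p hp hp'
  refine ⟨hDj, hBF _ hDj.jet (fun x hx => ?_) fun x hx y hy => ?_, fun i m hm z hz => ?_⟩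
  · have := hDj.mapsTo hx
    rw [abs_of_nonneg this.1]; exact this.2
  · exact (hDj.var_le x hx y hy).trans (mul_le_of_le_one_right hC.le hV1)
  · obtain ⟨ψ, hψ, hR⟩ := h.matching j j' p hp hp' i
    have hE := isComparison_of_mem_DkVar (h.mem_Simp j) (h.mem_Simp j') hψ
    have hRE := isComparison_of_mem_DkVar (h.mem_Simp _) (h.mem_Simp _) hR
    have hmaps := child_mapsTo (h.mem_Simp j) i
    set E : ℕ → ℝ → ℝ := fun m => iteratedDerivWithin m ψ I01 with hE_def
    set ℓ := S j ⟨i, by omega⟩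
    set ℓ' := S j' ⟨i, by omega⟩
    have hℓ' : σ ≤ ℓ' := (hb j' _).1
    have hℓ'0 : 0 < ℓ' := hσ.trans_le hℓ'
    have hℓ0 : 0 ≤ ℓ := ((h.mem_Simp j).1 _).1.le
    have hℓ1 : ℓ ≤ 1 := ((h.mem_Simp j).1 _).2.le
    have hjetR : IsJet k I01 (renormJet (childLeft (S j) i) ℓ (childLeft (S j') i) ℓ' E) :=
      hE.jet.renormJet hmaps
    have hR0 : Rmap (S j) (S j') i ψ =
        renormJet (childLeft (S j) i) ℓ (childLeft (S j') i) ℓ' E 0 := by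
      funext x
      simp only [Rmap, renorm, childRight, renormJet, hE_def, iteratedDerivWithin_zero,
        add_sub_cancel_left, pow_zero, if_true]
      ring
    have hjeteq := hjetR.iteratedDerivWithin_eq uniqueDiffOn_I01
    rw [← hR0] at hjeteq
    have e1 := hE.abs_sub_le (h.mem_Simp j) h.lt_two_mul hDj m hm _ (hmaps hz)
    have hpc : ∀ t < p + 1, consSeq i j t = consSeq i j' t := by
      intro t ht
      rcases t with _ | t
      · simp [consSeq]
      · simpa [consSeq] using hp t (by omega)
    have e2 := hRE.abs_sub_le (h.mem_Simp _) h.lt_two_mul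
      (hD (consSeq i j) (consSeq i j') (p + 1) hpc (by simpa [consSeq] using hp')) m hm z hz
    simp only [hjeteq m hm z hz] at e2
    have e3 : rhoS S (consSeq i j) (p + 1) ^ ((k : ℝ) + ε - 1) ≤ V :=
      Real.rpow_le_rpow (rhoS_nonneg h.mem_Simp _ _) (rhoS_consSeq_le h.mem_Simp i j p) hκ.le
    have e4 : |renormJet (childLeft (S j) i) ℓ (childLeft (S j') i) ℓ' (D j j') m z -
        renormJet (childLeft (S j) i) ℓ (childLeft (S j') i) ℓ' E m z| ≤ (C + C) / σ * V := by
      simp only [renormJet]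
      rw [sub_sub_sub_cancel_right, ← mul_sub, abs_mul, abs_sub_comm,
        abs_of_nonneg (div_nonneg (pow_nonneg hℓ0 m) hℓ'0.le)]
      calc _ ≤ 1 / σ * (C * V + C * V) := by
            refine mul_le_mul ?_ e1 (abs_nonneg _) (by positivity)
            exact div_le_div₀ zero_le_one (pow_le_one₀ hℓ0 hℓ1) hσ hℓ'
        _ = _ := by ring
    calc _ ≤ _ := abs_sub_le _ _ _
      _ ≤ (C + C) / σ * V + (C * V + C * V) := by
          refine add_le_add e4 (e2.trans ?_)
          gcongr
      _ = _ := by ring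

end IsMatched

/-- Comparison jets together with uniform constants: bounds for the scaling data, for the jets and
for their compatibility with renormalization, and exponential closeness of the comparison maps to
the identity. -/
structure IsControlled {d : ℕ} (k : ℕ) (ε : ℝ) (S : (ℕ → Fin d) → Fin (2 * d - 1) → ℝ)
    (D : (ℕ → Fin d) → (ℕ → Fin d) → ℕ → ℝ → ℝ) (M σ θ : ℝ) : Prop where
  M_nonneg : 0 ≤ M
  σ_pos : 0 < σ
  θ_pos : 0 < θ
  θ_lt_one : θ < 1
  bounds : ∀ j m, σ ≤ S j m ∧ S j m ≤ θ
  jet : ∀ j j' p, (∀ t < p, j t = j' t) → j p ≠ j' p → IsJet k I01 (D j j')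
  mapsTo : ∀ j j' p, (∀ t < p, j t = j' t) → j p ≠ j' p → MapsTo (D j j' 0) I01 I01
  var_le : ∀ j j' p, (∀ t < p, j t = j' t) → j p ≠ j' p → ∀ x ∈ I01, ∀ y ∈ I01,
    |D j j' k x - D j j' k y| ≤ M * rhoS S j p ^ ((k : ℝ) + ε - 1)
  abs_le : ∀ j j' p, (∀ t < p, j t = j' t) → j p ≠ j' p → ∀ m ≤ k, ∀ x ∈ I01, |D j j' m x| ≤ M
  renorm_le : ∀ j j' p, (∀ t < p, j t = j' t) → j p ≠ j' p → ∀ i : Fin d, ∀ m ≤ k, ∀ z ∈ I01,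
    |renormJet (childLeft (S j) i) (S j ⟨i, by omega⟩) (childLeft (S j') i)
      (S j' ⟨i, by omega⟩) (D j j') m z - D (consSeq i j) (consSeq i j') m z| ≤
    M * rhoS S j p ^ ((k : ℝ) + ε - 1)
  abs_sub_one_le : ∀ j j' p, (∀ t < p, j t = j' t) → j p ≠ j' p → ∀ x ∈ I01,
    |D j j' 1 x - 1| ≤ M * θ ^ p
  ratio_le : ∀ j j' p, (∀ t < p, j t = j' t) → ∀ m, S j' m ≤ Real.exp (M * θ ^ p) * S j m

lemma exists_eq_consSeq {d : ℕ} (j j' : ℕ → Fin d) (p : ℕ) (h : ∀ t < p + 1, j t = j' t) :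
    ∃ i u u', j = consSeq i u ∧ j' = consSeq i u' ∧ (∀ t < p, u t = u' t) ∧
      u p = j (p + 1) ∧ u' p = j' (p + 1) := by
  refine ⟨j 0, fun m => j (m + 1), fun m => j' (m + 1), ?_, ?_, fun t ht => h _ (by omega),
    rfl, rfl⟩
  · funext m; cases m <;> simp [consSeq]
  · funext m
    cases m with
    | zero => simpa [consSeq] using (h 0 (by omega)).symm
    | succ m => simp [consSeq]

namespace IsMatched

variable {d k : ℕ} {ε C : ℝ} {S : (ℕ → Fin d) → Fin (2 * d - 1) → ℝ}

theorem exists_isControlled (h : IsMatched k ε C S) :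
    ∃ (D : (ℕ → Fin d) → (ℕ → Fin d) → ℕ → ℝ → ℝ) (M σ θ : ℝ), IsControlled k ε S D M σ θ := by
  obtain ⟨σ, θ₀, hσ, hθ₀, hθ1, hb⟩ := exists_scaling_bounds h.two_le h.mem_Simp h.cont
  obtain ⟨D, B, K, hB, hK, hD⟩ := h.exists_comparisons
  have hκ := h.exponent_pos
  have hC := h.C_pos
  have hk := h.one_le
  have hd := h.two_le
  set κ := (k : ℝ) + ε - 1 with hκ_def
  -- decay of the powers of `rhoS`
  set θ₁ := θ₀ ^ κ with hθ₁_def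
  have hθ₁0 : 0 < θ₁ := Real.rpow_pos_of_pos hθ₀ _
  have hθ₁1 : θ₁ < 1 := Real.rpow_lt_one hθ₀.le hθ1 hκ
  have hρ : ∀ j p, rhoS S j p ^ κ ≤ θ₁ ^ p := by
    intro j p
    rw [hθ₁_def, ← Real.rpow_natCast, ← Real.rpow_mul hθ₀.le, mul_comm, Real.rpow_mul hθ₀.le,
      Real.rpow_natCast]
    exact Real.rpow_le_rpow (rhoS_nonneg h.mem_Simp _ _)
      (rhoS_le fun w => rhoTerm_le_pow h.mem_Simp (fun j m => (hb j m).2) j p w) hκ.le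
  set θ₂ := (1 + θ₀) / 2 with hθ₂_def
  set θ := (1 + max θ₁ θ₂) / 2 with hθ_def
  have hm1 : max θ₁ θ₂ < 1 := max_lt hθ₁1 (by rw [hθ₂_def]; linarith)
  have hθ₁θ : θ₁ ≤ θ := by linarith [le_max_left θ₁ θ₂]
  have hθ₂θ : θ₂ < θ := by linarith [le_max_right θ₁ θ₂]
  have hθ0 : 0 < θ := hθ₁0.trans_le hθ₁θ
  have hθlt : θ < 1 := by linarith
  have hρ' : ∀ j p, rhoS S j p ^ κ ≤ θ ^ p := fun j p =>
    (hρ j p).trans (pow_le_pow_left₀ hθ₁0.le hθ₁θ p)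
  -- the first derivative is somewhere one
  have hone : ∀ j j' p, (∀ t < p, j t = j' t) → j p ≠ j' p → ∃ ξ ∈ I01, D j j' 1 ξ = 1 := by
    intro j j' p hp hp'
    obtain ⟨hc, -, -⟩ := hD j j' p hp hp'
    obtain ⟨ξ, hξ, e⟩ := exists_slope_eq_of_hasDerivWithinAt ordConnected_Icc
      (hc.jet 0 (by omega)) (left_mem_Icc.mpr zero_le_one) (right_mem_Icc.mpr zero_le_one) one_pos
    have e0 := hc.map_pt 0 (by omega)
    have e1 := hc.map_pt (2 * d - 1) (by omega)
    rw [partPt_zero, partPt_zero] at e0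
    rw [partPt_last _ (by omega), partPt_last _ (by omega), (h.mem_Simp j).2,
      (h.mem_Simp j').2] at e1
    refine ⟨ξ, Ioo_subset_Icc_self hξ, ?_⟩
    rw [e0, e1] at e
    simpa using e.symm
  have hclose : ∃ M, 0 ≤ M ∧ ∀ j j' p, (∀ t < p, j t = j' t) → j p ≠ j' p → ∀ x ∈ I01,
      |D j j' 1 x - 1| ≤ M * θ ^ p := by
    rcases hk.eq_or_lt with hk1 | hk2
    · refine ⟨C, hC.le, fun j j' p hp hp' x hx => ?_⟩
      obtain ⟨ξ, hξ, e⟩ := hone j j' p hp hp'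
      obtain ⟨hc, -, -⟩ := hD j j' p hp hp'
      have hv := hc.var_le x hx ξ hξ
      rw [← hk1, e] at hv
      refine hv.trans ?_
      exact mul_le_mul_of_nonneg_left (hρ' j p) hC.le
    · obtain ⟨n₀, hn₀⟩ := exists_agree_close h.cont (η := σ * ((1 - θ₀) / 2)) (by
        have : 0 < 1 - θ₀ := by linarith
        positivity)
      set M := K / (θ - θ₂) + B / θ ^ n₀ with hM
      have hθθ : 0 < θ - θ₂ := by linarith
      have hM0 : 0 ≤ M := by positivity
      have hM1 : K ≤ M * (θ - θ₂) := by
        rw [← div_le_iff₀ hθθ]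
        exact le_add_of_nonneg_right (by positivity)
      have hM2 : B ≤ M * θ ^ n₀ := by
        rw [← div_le_iff₀ (by positivity)]
        exact le_add_of_nonneg_left (by positivity)
      have h2 : ∀ p j j', (∀ t < p, j t = j' t) → j p ≠ j' p → ∀ x ∈ I01,
          |D j j' 2 x| ≤ M * θ ^ p := by
        intro p
        induction p with
        | zero =>
          intro j j' hp hp' x hx
          refine ((hD j j' 0 hp hp').2.1 2 hk2 x hx).trans (hM2.trans ?_)
          exact mul_le_mul_of_nonneg_left (pow_le_pow_of_le_one hθ0.le hθlt.le (Nat.zero_le _)) hM0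
        | succ p ih =>
          intro j j' hp hp' x hx
          rcases le_or_gt (p + 1) n₀ with hpn | hpn
          · refine ((hD j j' _ hp hp').2.1 2 hk2 x hx).trans (hM2.trans ?_)
            exact mul_le_mul_of_nonneg_left (pow_le_pow_of_le_one hθ0.le hθlt.le hpn) hM0
          obtain ⟨i, u, u', rfl, rfl, hu, e1, e2⟩ := exists_eq_consSeq j j' p hp
          rw [← e1, ← e2] at hp'
          have h3 := (hD u u' p hu hp').2.2 i 2 hk2 x hx
          have h4 := ih u u' hu hp' _ (child_mapsTo (h.mem_Simp u) i hx)
          have h5 := (abs_le.mp (hn₀ u u' (fun t ht => hu t (by omega)) ⟨i, by omega⟩)).2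
          rw [renormJet, if_neg two_ne_zero, sub_zero] at h3
          set s := S u ⟨i, by omega⟩
          set s' := S u' ⟨i, by omega⟩
          have hs' : σ ≤ s' := (hb u' _).1
          have hs'0 : 0 < s' := hσ.trans_le hs'
          have hs0 : 0 < s := hσ.trans_le (hb u _).1
          have hsθ : s ≤ θ₀ := (hb u _).2
          have h6 : s ^ 2 / s' ≤ θ₂ := by
            rw [div_le_iff₀ hs'0, hθ₂_def]
            have : s ≤ s' * (1 + (1 - θ₀) / 2) := by nlinarith
            nlinarith [mul_le_mul_of_nonneg_right hsθ hs0.le, mul_le_mul_of_nonneg_left this hθ₀.le,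
              mul_nonneg hs'0.le (sub_nonneg.mpr hθ1.le)]
          have h7 : |s ^ 2 / s' * D u u' 2 (childLeft (S u) i + s * x)| ≤ θ₂ * (M * θ ^ p) := by
            rw [abs_mul, abs_of_nonneg (by positivity)]
            exact mul_le_mul h6 h4 (abs_nonneg _) (by rw [hθ₂_def]; linarith)
          have h8 : K * rhoS S u p ^ κ ≤ M * (θ - θ₂) * θ ^ p :=
            mul_le_mul hM1 (hρ' u p) (Real.rpow_nonneg (rhoS_nonneg h.mem_Simp _ _) _)
              (mul_nonneg hM0 hθθ.le)
          have h9 := abs_le.mp h3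
          have h10 := abs_le.mp h7
          rw [abs_le, pow_succ]
          constructor <;> nlinarith
      refine ⟨M, hM0, fun j j' p hp hp' x hx => ?_⟩
      obtain ⟨ξ, hξ, e⟩ := hone j j' p hp hp'
      have := abs_sub_le_of_hasDerivWithinAt ordConnected_Icc
        ((hD j j' p hp hp').1.jet 1 (by omega)) (h2 p j j' hp hp') hξ hx
      rw [e] at this
      exact this.trans (mul_le_of_le_one_right (by positivity) (abs_sub_le_one_of_mem_I01 hx hξ))
  obtain ⟨M, hM0, hM⟩ := hclose
  have hθ₀θ : θ₀ ≤ θ := by rw [hθ₂_def] at hθ₂θ; linarith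
  have hV0 : ∀ j p, 0 ≤ rhoS S j p ^ κ := fun j p =>
    Real.rpow_nonneg (rhoS_nonneg h.mem_Simp _ _) _
  refine ⟨D, C + B + K + M, σ, θ, by positivity, hσ, hθ0, hθlt,
    fun j m => ⟨(hb j m).1, (hb j m).2.trans hθ₀θ⟩,
    fun j j' p hp hp' => (hD j j' p hp hp').1.jet,
    fun j j' p hp hp' => (hD j j' p hp hp').1.mapsTo,
    fun j j' p hp hp' x hx y hy => ((hD j j' p hp hp').1.var_le x hx y hy).trans
      (mul_le_mul_of_nonneg_right (by linarith) (hV0 j p)),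
    fun j j' p hp hp' m hm x hx => ((hD j j' p hp hp').2.1 m hm x hx).trans (by linarith),
    fun j j' p hp hp' i m hm z hz => ((hD j j' p hp hp').2.2 i m hm z hz).trans
      (mul_le_mul_of_nonneg_right (by linarith) (hV0 j p)),
    fun j j' p hp hp' x hx => (hM j j' p hp hp' x hx).trans
      (mul_le_mul_of_nonneg_right (by linarith) (by positivity)), fun j j' p hp m => ?_⟩
  have hMM : 0 ≤ C + B + K + M := by positivity
  have hSp := ((h.mem_Simp j).1 m).1
  by_cases hj : j = j'
  · subst hj
    exact le_mul_of_one_le_left hSp.le (Real.one_le_exp (by positivity))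
  · obtain ⟨q, hq, hq'⟩ : ∃ q, (∀ t < q, j t = j' t) ∧ j q ≠ j' q := by
      classical
      have hex : ∃ q, j q ≠ j' q := Function.ne_iff.mp hj
      exact ⟨Nat.find hex, fun t ht => not_not.mp (Nat.find_min hex ht), Nat.find_spec hex⟩
    have hpq : p ≤ q := by
      by_contra hlt
      exact hq' (hp q (by omega))
    obtain ⟨n, hn, hn'⟩ := exists_partLen (by omega : 1 ≤ d) m
    have hc := (hD j j' q hq hq').1
    obtain ⟨ξ, hξ, e⟩ := exists_slope_eq_of_hasDerivWithinAt ordConnected_Icc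
      (hc.jet 0 (by omega)) (partPt_mem_I01 (h.mem_Simp j) (n := n) (by omega))
      (partPt_mem_I01 (h.mem_Simp j) hn) (partPt_lt (h.mem_Simp j) (by omega) hn)
    rw [hc.map_pt _ hn, hc.map_pt _ (by omega), partPt_succ, partPt_succ, add_sub_cancel_left,
      add_sub_cancel_left, ← hn', ← hn'] at e
    rw [e]
    refine mul_le_mul_of_nonneg_right ?_ hSp.le
    have hξI : ξ ∈ I01 := by
      exact ordConnected_Icc.out (partPt_mem_I01 (h.mem_Simp j) (n := n) (by omega))
        (partPt_mem_I01 (h.mem_Simp j) hn) (Ioo_subset_Icc_self hξ)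
    have h1 := (abs_le.mp (hM j j' q hq hq' ξ hξI)).2
    have h2 : M * θ ^ q ≤ (C + B + K + M) * θ ^ p :=
      mul_le_mul (by linarith) (pow_le_pow_of_le_one hθ0.le hθlt.le hpq) (by positivity) hMM
    simp only [zero_add]
    linarith [Real.add_one_le_exp ((C + B + K + M) * θ ^ p)]

end IsMatched

section Cascade

variable {d : ℕ} (T : List (Fin d) → Fin (2 * d - 1) → ℝ)

/-- The length of the interval with word `w` in the cascade with scaling data `T`. -/
noncomputable def cascLen : List (Fin d) → ℝ
  | [] => 1
  | i :: w => cascLen w * T w ⟨i, by omega⟩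

/-- The left endpoint of the interval with word `w` in the cascade with scaling data `T`. -/
noncomputable def cascLeft : List (Fin d) → ℝ
  | [] => 0
  | i :: w => cascLeft w + cascLen T w * childLeft (T w) i

/-- The position of the `n`-th partition point of the interval with word `w`. -/
noncomputable def cascPos (w : List (Fin d)) (n : ℕ) : ℝ :=
  cascLeft T w + cascLen T w * partPt (T w) n

/-- The word formed by the first `n` letters of a code, most recent letter first. -/
def codeWord (a : ℕ → Fin d) : ℕ → List (Fin d)
  | 0 => []
  | n + 1 => a n :: codeWord a n

/-- The point of the Cantor set with a given code. -/
noncomputable def cascPt (a : ℕ → Fin d) : ℝ := ⨆ n, cascLeft T (codeWord a n)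

/-- The scaling data `T` is simplex-valued and uniformly bounded away from `0` and `1`. -/
structure IsCascade (σ θ : ℝ) : Prop where
  two_le : 2 ≤ d
  mem_Simp : ∀ w, T w ∈ Simp d
  σ_pos : 0 < σ
  θ_lt_one : θ < 1
  bounds : ∀ w m, σ ≤ T w m ∧ T w m ≤ θ

@[simp] lemma codeWord_length (a : ℕ → Fin d) (n : ℕ) : (codeWord a n).length = n := by
  induction n with
  | zero => rfl
  | succ n ih => simp [codeWord, ih]

lemma codeWord_congr {a b : ℕ → Fin d} {n : ℕ} (h : ∀ t < n, a t = b t) :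
    codeWord a n = codeWord b n := by
  induction n with
  | zero => rfl
  | succ n ih => rw [codeWord, codeWord, ih fun t ht => h t (by omega), h n (by omega)]

lemma codeWord_consSeq (i : Fin d) (a : ℕ → Fin d) (n : ℕ) :
    codeWord (consSeq i a) (n + 1) = codeWord a n ++ [i] := by
  induction n with
  | zero => simp [codeWord, consSeq]
  | succ n ih =>
    rw [codeWord, ih, codeWord]
    simp [consSeq]

lemma exists_code (w : List (Fin d)) (c : Fin d) :
    ∃ a, codeWord a w.length = w ∧ ∀ n, w.length ≤ n → a n = c := by
  induction w with
  | nil => exact ⟨fun _ => c, rfl, fun _ _ => rfl⟩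
  | cons i w ih =>
    obtain ⟨a, ha, -⟩ := ih
    refine ⟨fun n => if n < w.length then a n else if n = w.length then i else c, ?_,
      fun n hn => ?_⟩
    · rw [List.length_cons, codeWord, ← codeWord_congr (a := a) fun t ht => by rw [if_pos ht], ha]
      simp
    · rw [List.length_cons] at hn
      dsimp only
      rw [if_neg (by omega), if_neg (by omega)]

lemma cascLeft_cons (i : Fin d) (w : List (Fin d)) :
    cascLeft T (i :: w) = cascPos T w (2 * i) := by
  rw [cascLeft, cascPos, childLeft_eq_partPt]

lemma cascRight_cons (i : Fin d) (w : List (Fin d)) :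
    cascLeft T (i :: w) + cascLen T (i :: w) = cascPos T w (2 * i + 1) := by
  rw [cascLeft, cascLen, cascPos, ← childRight_eq_partPt, childRight]; ring

lemma cascPos_zero (w : List (Fin d)) : cascPos T w 0 = cascLeft T w := by
  rw [cascPos, partPt_zero, mul_zero, add_zero]

lemma cascPos_succ (w : List (Fin d)) (n : ℕ) :
    cascPos T w (n + 1) = cascPos T w n + cascLen T w * partLen (T w) n := by
  rw [cascPos, cascPos, partPt_succ]; ring

namespace IsCascade

variable {T} {σ θ : ℝ}

lemma θ_nonneg (h : IsCascade T σ θ) : 0 ≤ θ :=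
  h.σ_pos.le.trans ((h.bounds [] ⟨0, by have := h.two_le; omega⟩).1.trans (h.bounds [] _).2)

lemma cascLen_pos (h : IsCascade T σ θ) (w : List (Fin d)) : 0 < cascLen T w := by
  induction w with
  | nil => exact one_pos
  | cons i w ih => exact mul_pos ih ((h.mem_Simp w).1 _).1

lemma cascLen_cons_le (h : IsCascade T σ θ) (i : Fin d) (w : List (Fin d)) :
    cascLen T (i :: w) ≤ θ * cascLen T w := by
  rw [cascLen, mul_comm]
  exact mul_le_mul_of_nonneg_right (h.bounds _ _).2 (h.cascLen_pos w).le

lemma cascLen_le_pow (h : IsCascade T σ θ) (w : List (Fin d)) : cascLen T w ≤ θ ^ w.length := by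
  induction w with
  | nil => simp [cascLen]
  | cons i w ih =>
    rw [List.length_cons, pow_succ']
    exact (h.cascLen_cons_le i w).trans (mul_le_mul_of_nonneg_left ih h.θ_nonneg)

lemma cascLen_le_one (h : IsCascade T σ θ) (w : List (Fin d)) : cascLen T w ≤ 1 :=
  (h.cascLen_le_pow w).trans (pow_le_one₀ h.θ_nonneg h.θ_lt_one.le)

lemma pow_le_cascLen (h : IsCascade T σ θ) (w : List (Fin d)) : σ ^ w.length ≤ cascLen T w := by
  induction w with
  | nil => simp [cascLen]
  | cons i w ih =>
    rw [List.length_cons, pow_succ, cascLen]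
    exact mul_le_mul ih (h.bounds _ _).1 h.σ_pos.le (h.cascLen_pos w).le

lemma cascPos_last (h : IsCascade T σ θ) (w : List (Fin d)) :
    cascPos T w (2 * d - 1) = cascLeft T w + cascLen T w := by
  rw [cascPos, partPt_last _ (by have := h.two_le; omega), (h.mem_Simp w).2, mul_one]

lemma cascPos_le (h : IsCascade T σ θ) (w : List (Fin d)) {n n' : ℕ} (hn : n ≤ n')
    (hn' : n' < 2 * d) : cascPos T w n ≤ cascPos T w n' :=
  add_le_add_right (mul_le_mul_of_nonneg_left (partPt_le (h.mem_Simp w) hn hn')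
    (h.cascLen_pos w).le) _

lemma σ_le_partLen (h : IsCascade T σ θ) (w : List (Fin d)) {n : ℕ} (hn : n + 1 < 2 * d) :
    σ ≤ partLen (T w) n := by
  obtain ⟨m, hm⟩ := exists_eq_partLen n hn
  rw [hm]; exact (h.bounds w m).1

lemma cascLeft_le_cons (h : IsCascade T σ θ) (i : Fin d) (w : List (Fin d)) :
    cascLeft T w ≤ cascLeft T (i :: w) := by
  rw [cascLeft_cons, ← cascPos_zero]; exact h.cascPos_le w (n' := 2 * i) (Nat.zero_le _) (by omega)

lemma cascRight_cons_le (h : IsCascade T σ θ) (i : Fin d) (w : List (Fin d)) :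
    cascLeft T (i :: w) + cascLen T (i :: w) ≤ cascLeft T w + cascLen T w := by
  rw [cascRight_cons, ← h.cascPos_last]
  exact h.cascPos_le w (n := 2 * i + 1) (by omega) (by have := h.two_le; omega)

lemma monotone_cascLeft (h : IsCascade T σ θ) (a : ℕ → Fin d) :
    Monotone fun n => cascLeft T (codeWord a n) :=
  monotone_nat_of_le_succ fun n => h.cascLeft_le_cons (a n) (codeWord a n)

lemma antitone_cascRight (h : IsCascade T σ θ) (a : ℕ → Fin d) :
    Antitone fun n => cascLeft T (codeWord a n) + cascLen T (codeWord a n) :=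
  antitone_nat_of_succ_le fun n => h.cascRight_cons_le (a n) (codeWord a n)

lemma cascLeft_le_cascRight (h : IsCascade T σ θ) (a : ℕ → Fin d) (m n : ℕ) :
    cascLeft T (codeWord a m) ≤ cascLeft T (codeWord a n) + cascLen T (codeWord a n) :=
  (h.monotone_cascLeft a (le_max_left m n)).trans
    ((le_add_of_nonneg_right (h.cascLen_pos _).le).trans
      (h.antitone_cascRight a (le_max_right m n)))

lemma cascLeft_le_cascPt (h : IsCascade T σ θ) (a : ℕ → Fin d) (n : ℕ) :
    cascLeft T (codeWord a n) ≤ cascPt T a :=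
  le_ciSup (f := fun n => cascLeft T (codeWord a n))
    ⟨_, by rintro _ ⟨m, rfl⟩; exact h.cascLeft_le_cascRight a m 0⟩ n

lemma cascPt_le_cascRight (h : IsCascade T σ θ) (a : ℕ → Fin d) (n : ℕ) :
    cascPt T a ≤ cascLeft T (codeWord a n) + cascLen T (codeWord a n) :=
  ciSup_le fun m => h.cascLeft_le_cascRight a m n

lemma cascPt_mem_I01 (h : IsCascade T σ θ) (a : ℕ → Fin d) : cascPt T a ∈ I01 := by
  have h1 := h.cascLeft_le_cascPt a 0
  have h2 := h.cascPt_le_cascRight a 0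
  simp only [codeWord, cascLeft, cascLen, zero_add] at h1 h2
  exact ⟨h1, h2⟩

/-- The position of a point of the Cantor set relative to one of the intervals containing it. -/
lemma relPos_mem_I01 (h : IsCascade T σ θ) (a : ℕ → Fin d) (n : ℕ) :
    (cascPt T a - cascLeft T (codeWord a n)) / cascLen T (codeWord a n) ∈ I01 := by
  have := h.cascLen_pos (codeWord a n)
  refine ⟨div_nonneg (sub_nonneg.mpr (h.cascLeft_le_cascPt a n)) this.le, ?_⟩
  rw [div_le_one this]
  linarith [h.cascPt_le_cascRight a n]

lemma cascPt_eq_cascLeft (h : IsCascade T σ θ) {a : ℕ → Fin d} {N : ℕ}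
    (ha : ∀ n, N ≤ n → (a n : ℕ) = 0) : cascPt T a = cascLeft T (codeWord a N) := by
  refine le_antisymm (ciSup_le fun m => ?_) (h.cascLeft_le_cascPt a N)
  rcases le_total m N with hm | hm
  · exact h.monotone_cascLeft a hm
  · induction m, hm using Nat.le_induction with
    | base => exact le_rfl
    | succ n hn ih =>
      rw [codeWord, cascLeft_cons, ha n hn, mul_zero, cascPos_zero]; exact ih

lemma cascPt_eq_cascRight (h : IsCascade T σ θ) {a : ℕ → Fin d} {N : ℕ}
    (ha : ∀ n, N ≤ n → (a n : ℕ) = d - 1) :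
    cascPt T a = cascLeft T (codeWord a N) + cascLen T (codeWord a N) := by
  have key : ∀ n, N ≤ n → cascLeft T (codeWord a N) + cascLen T (codeWord a N) =
      cascLeft T (codeWord a n) + cascLen T (codeWord a n) := by
    intro n hn
    induction n, hn using Nat.le_induction with
    | base => rfl
    | succ n hn ih =>
      have := h.two_le
      rw [codeWord, cascRight_cons, ha n hn, show 2 * (d - 1) + 1 = 2 * d - 1 by omega,
        h.cascPos_last, ih]
  refine le_antisymm (h.cascPt_le_cascRight a N) (le_of_forall_pos_le_add fun η hη => ?_)
  obtain ⟨n, hn⟩ := exists_pow_lt_of_lt_one hη h.θ_lt_one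
  have h1 := h.cascLen_le_pow (codeWord a (max n N))
  rw [codeWord_length] at h1
  have h2 := pow_le_pow_of_le_one h.θ_nonneg h.θ_lt_one.le (le_max_left n N)
  linarith [key _ (le_max_right n N), h.cascLeft_le_cascPt a (max n N)]

lemma abs_cascPt_sub_le (h : IsCascade T σ θ) {a b : ℕ → Fin d} {n : ℕ} (hab : ∀ t < n, a t = b t) :
    |cascPt T a - cascPt T b| ≤ cascLen T (codeWord a n) := by
  have e := codeWord_congr hab
  have h1 := h.cascLeft_le_cascPt b n
  have h2 := h.cascPt_le_cascRight b n
  rw [← e] at h1 h2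
  rw [abs_le]
  constructor <;> linarith [h.cascLeft_le_cascPt a n, h.cascPt_le_cascRight a n]

lemma cascPt_add_le (h : IsCascade T σ θ) {a b : ℕ → Fin d} {n : ℕ} (hab : ∀ t < n, a t = b t)
    (hn : a n < b n) : cascPt T a + σ * cascLen T (codeWord a n) ≤ cascPt T b := by
  have e := codeWord_congr hab
  have h1 := h.cascPt_le_cascRight a (n + 1)
  have h2 := h.cascLeft_le_cascPt b (n + 1)
  rw [codeWord, cascRight_cons] at h1
  rw [codeWord, cascLeft_cons, ← e] at h2
  have h3 : cascPos T (codeWord a n) (2 * a n + 1 + 1) ≤ cascPos T (codeWord a n) (2 * b n) :=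
    h.cascPos_le _ (by have : (a n : ℕ) < b n := hn; omega) (by omega)
  rw [cascPos_succ] at h3
  have h4 := mul_le_mul_of_nonneg_left (h.σ_le_partLen (codeWord a n) (n := 2 * a n + 1)
    (by have : (a n : ℕ) < b n := hn; omega)) (h.cascLen_pos (codeWord a n)).le
  linarith

lemma exists_first_ne {a b : ℕ → Fin d} (hab : a ≠ b) :
    ∃ n, (∀ t < n, a t = b t) ∧ a n ≠ b n := by
  classical
  have hex : ∃ n, a n ≠ b n := Function.ne_iff.mp hab
  exact ⟨Nat.find hex, fun t ht => not_not.mp (Nat.find_min hex ht), Nat.find_spec hex⟩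

lemma le_abs_cascPt_sub (h : IsCascade T σ θ) {a b : ℕ → Fin d} {n : ℕ}
    (hab : ∀ t < n, a t = b t) (hn : a n ≠ b n) :
    σ * cascLen T (codeWord a n) ≤ |cascPt T a - cascPt T b| := by
  rcases lt_or_gt_of_ne hn with hn | hn
  · rw [abs_sub_comm]
    exact le_trans (by linarith [h.cascPt_add_le hab hn]) (le_abs_self _)
  · rw [codeWord_congr hab]
    exact le_trans (by linarith [h.cascPt_add_le (fun t ht => (hab t ht).symm) hn])
      (le_abs_self _)

lemma cascPt_injective (h : IsCascade T σ θ) : Function.Injective (cascPt T) := by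
  intro a b hab
  by_contra hne
  obtain ⟨n, hn, hn'⟩ := exists_first_ne hne
  have := h.le_abs_cascPt_sub hn hn'
  rw [hab, sub_self, abs_zero] at this
  exact absurd this (not_le.mpr (mul_pos h.σ_pos (h.cascLen_pos _)))

lemma continuous_cascPt (h : IsCascade T σ θ) : Continuous (cascPt T) := by
  refine continuous_iff_continuousAt.mpr fun a => Metric.continuousAt_iff'.mpr fun η hη => ?_
  obtain ⟨n, hn⟩ := exists_pow_lt_of_lt_one hη h.θ_lt_one
  have : ∀ᶠ b in nhds a, ∀ t ∈ Finset.range n, b t = a t :=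
    (Finset.eventually_all _).mpr fun t _ =>
      (continuous_apply t).continuousAt.eventually (isOpen_discrete {a t} |>.mem_nhds rfl)
  filter_upwards [this] with b hb
  have h1 := h.abs_cascPt_sub_le (a := b) (b := a) fun t ht => hb t (Finset.mem_range.mpr ht)
  have h2 := h.cascLen_le_pow (codeWord b n)
  rw [codeWord_length] at h2
  rw [Real.dist_eq]
  linarith

lemma cascLeft_mem (h : IsCascade T σ θ) (w : List (Fin d)) : cascLeft T w ∈ range (cascPt T) := by
  obtain ⟨a, ha, ha'⟩ := exists_code w ⟨0, by have := h.two_le; omega⟩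
  exact ⟨a, by rw [h.cascPt_eq_cascLeft fun n hn => by rw [ha' n hn], ha]⟩

lemma cascRight_mem (h : IsCascade T σ θ) (w : List (Fin d)) :
    cascLeft T w + cascLen T w ∈ range (cascPt T) := by
  obtain ⟨a, ha, ha'⟩ := exists_code w ⟨d - 1, by have := h.two_le; omega⟩
  exact ⟨a, by rw [h.cascPt_eq_cascRight fun n hn => by rw [ha' n hn], ha]⟩

lemma isFrame (h : IsCascade T σ θ) : IsFrame (range (cascPt T)) where
  closed := (isCompact_range h.continuous_cascPt).isClosed
  subset := by rintro _ ⟨a, rfl⟩; exact h.cascPt_mem_I01 a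
  zero_mem := h.cascLeft_mem []
  one_mem := by simpa [cascLeft, cascLen] using h.cascRight_mem []

lemma exists_of_isGap (h : IsCascade T σ θ) {x y : ℝ} (hxy : IsGap (range (cascPt T)) x y) :
    ∃ w, ∃ l l' : Fin d, (l' : ℕ) = l + 1 ∧ x = cascLeft T (l :: w) + cascLen T (l :: w) ∧
      y = cascLeft T (l' :: w) := by
  obtain ⟨⟨a, rfl⟩, ⟨b, rfl⟩, hlt, hgap⟩ := hxy
  obtain ⟨n, hn, hn'⟩ := exists_first_ne (a := a) (b := b) (by rintro rfl; exact lt_irrefl _ hlt)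
  have hab : a n < b n := by
    refine lt_of_le_of_ne (not_lt.mp fun hba => ?_) hn'
    have h1 := h.cascPt_add_le (fun t ht => (hn t ht).symm) hba
    have h2 := mul_pos h.σ_pos (h.cascLen_pos (codeWord b n))
    linarith
  have hab' : (a n : ℕ) < b n := hab
  have h1 := h.cascPt_le_cascRight a (n + 1)
  have h2 := h.cascLeft_le_cascPt b (n + 1)
  rw [codeWord] at h1 h2
  rw [← codeWord_congr hn] at h2
  set w := codeWord a n
  set l' : Fin d := ⟨a n + 1, by omega⟩ with hl'
  have h3 : cascLeft T (a n :: w) + cascLen T (a n :: w) < cascLeft T (l' :: w) := by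
    rw [cascRight_cons, cascLeft_cons, hl']
    simp only
    rw [show 2 * ((a n : ℕ) + 1) = 2 * a n + 1 + 1 by ring, cascPos_succ _ _ (2 * a n + 1)]
    have := mul_pos (h.cascLen_pos w)
      (partLen_pos (h.mem_Simp w) (n := 2 * a n + 1) (by omega))
    linarith
  have h4 : cascLeft T (l' :: w) ≤ cascLeft T (b n :: w) := by
    rw [cascLeft_cons, cascLeft_cons]
    exact h.cascPos_le w (by simp only [hl']; omega) (by omega)
  refine ⟨w, a n, l', rfl, ?_, ?_⟩
  · refine h1.eq_or_lt.resolve_right fun hlt' => ?_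
    exact hgap _ ⟨hlt', by linarith⟩ (h.cascRight_mem _)
  · refine ((h4.trans h2).eq_or_lt.resolve_right fun hlt' => ?_).symm
    exact hgap _ ⟨by linarith, hlt'⟩ (h.cascLeft_mem _)

/-- A family of maps acting on codes as the shift branches has scaling data `T`. -/
lemma wordMap_cascLeft {g : Fin d → ℝ → ℝ} (h : IsCascade T σ θ)
    (hg : ∀ i a, g i (cascPt T a) = cascPt T (consSeq i a)) (w v : List (Fin d)) :
    wordMap g w (cascLeft T v) = cascLeft T (v ++ w) ∧
      wordMap g w (cascLeft T v + cascLen T v) = cascLeft T (v ++ w) + cascLen T (v ++ w) := by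
  have hstep : ∀ i v, g i (cascLeft T v) = cascLeft T (v ++ [i]) ∧
      g i (cascLeft T v + cascLen T v) = cascLeft T (v ++ [i]) + cascLen T (v ++ [i]) := by
    intro i v
    constructor
    · obtain ⟨a, ha, ha'⟩ := exists_code v ⟨0, by have := h.two_le; omega⟩
      have e := h.cascPt_eq_cascLeft (a := a) (N := v.length) fun n hn => by rw [ha' n hn]
      have e' := h.cascPt_eq_cascLeft (a := consSeq i a) (N := v.length + 1) fun n hn => by
        rw [consSeq, if_neg (by omega), ha' _ (by omega)]
      rw [ha] at e
      rw [codeWord_consSeq, ha] at e'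
      rw [← e, hg, e']
    · obtain ⟨a, ha, ha'⟩ := exists_code v ⟨d - 1, by have := h.two_le; omega⟩
      have e := h.cascPt_eq_cascRight (a := a) (N := v.length) fun n hn => by rw [ha' n hn]
      have e' := h.cascPt_eq_cascRight (a := consSeq i a) (N := v.length + 1) fun n hn => by
        rw [consSeq, if_neg (by omega), ha' _ (by omega)]
      rw [ha] at e
      rw [codeWord_consSeq, ha] at e'
      rw [← e, hg, e']
  induction w generalizing v with
  | nil => simp [wordMap]
  | cons i w ih =>
    simp only [wordMap]
    have := ih (v ++ [i])
    rw [List.append_assoc, List.singleton_append] at this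
    rw [(hstep i v).1, (hstep i v).2]
    exact this

lemma scalingData_eq {g : Fin d → ℝ → ℝ} (h : IsCascade T σ θ)
    (hg : ∀ i a, g i (cascPt T a) = cascPt T (consSeq i a)) (w : List (Fin d)) :
    scalingData g w = T w := by
  have h0 : ∀ w, wordMap g w 0 = cascLeft T w := fun w => by
    simpa [cascLeft] using (h.wordMap_cascLeft hg w []).1
  have h1 : ∀ w, wordMap g w 1 = cascLeft T w + cascLen T w := fun w => by
    simpa [cascLeft, cascLen] using (h.wordMap_cascLeft hg w []).2
  have hlen : ∀ w, wordLen g w = cascLen T w := fun w => by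
    rw [wordLen, h0, h1, add_sub_cancel_left]
  have hw := (h.cascLen_pos w).ne'
  funext m
  have := m.isLt
  rw [scalingData]
  split_ifs with hm
  · rw [hlen, hlen, cascLen, mul_div_cancel_left₀ _ hw]
  · have e0 := fun i => h0 (i :: w)
    have e1 := fun i => h1 (i :: w)
    simp only [wordMap] at e0 e1
    rw [e0, e1, hlen, cascRight_cons, cascLeft_cons]
    simp only
    rw [show 2 * ((m : ℕ) - d + 1) = 2 * (m - d) + 1 + 1 by ring, cascPos_succ,
      add_sub_cancel_left, mul_div_cancel_left₀ _ hw, partLen_odd _ _ (by omega)]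
    congr 1
    ext
    simp only
    omega

end IsCascade

end Cascade

section Truncation

variable {d : ℕ}

/-- The sequence starting with the word `w` and continuing with `b`. -/
def extSeq (b : ℕ → Fin d) (w : List (Fin d)) : ℕ → Fin d := w.foldr consSeq b

lemma extSeq_cons (b : ℕ → Fin d) (i : Fin d) (w : List (Fin d)) :
    extSeq b (i :: w) = consSeq i (extSeq b w) := rfl

lemma extSeq_concat (b : ℕ → Fin d) (w : List (Fin d)) (i : Fin d) :
    extSeq b (w ++ [i]) = extSeq (consSeq i b) w := by
  simp [extSeq]

lemma extSeq_apply_add (b : ℕ → Fin d) (w : List (Fin d)) (n : ℕ) :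
    extSeq b w (w.length + n) = b n := by
  induction w generalizing n with
  | nil => simp [extSeq]
  | cons i w ih =>
    rw [extSeq_cons, consSeq, if_neg (by simp), List.length_cons,
      show w.length + 1 + n - 1 = w.length + n by omega, ih]

lemma extSeq_agree {b b' : ℕ → Fin d} {p : ℕ} (h : ∀ t < p, b t = b' t) (w : List (Fin d)) :
    ∀ t < w.length + p, extSeq b w t = extSeq b' w t := by
  intro t ht
  induction w generalizing t with
  | nil => exact h t (by simpa using ht)
  | cons i w ih =>
    rw [extSeq_cons, extSeq_cons, consSeq, consSeq]
    split_ifs with h0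
    · rfl
    · exact ih _ (by rw [List.length_cons] at ht; omega)

/-- The sequence `b` first differs from `consSeq i b` at index `p i`. -/
structure IsTail (b : ℕ → Fin d) (p : Fin d → ℕ) : Prop where
  agree : ∀ i, ∀ t < p i, b t = consSeq i b t
  ne : ∀ i, b (p i) ≠ consSeq i b (p i)

lemma exists_isTail (hd : 2 ≤ d) : ∃ (b : ℕ → Fin d) (p : Fin d → ℕ), IsTail b p := by
  have key : ∀ i : Fin d, ∃ p, (∀ t < p, (if t = 0 then ⟨0, by omega⟩ else ⟨1, by omega⟩ : Fin d) =
      consSeq i (fun n => if n = 0 then ⟨0, by omega⟩ else ⟨1, by omega⟩) t) ∧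
      (if p = 0 then ⟨0, by omega⟩ else ⟨1, by omega⟩ : Fin d) ≠
      consSeq i (fun n => if n = 0 then ⟨0, by omega⟩ else ⟨1, by omega⟩) p := by
    intro i
    by_cases hi : (i : ℕ) = 0
    · refine ⟨1, fun t ht => ?_, ?_⟩
      · obtain rfl : t = 0 := by omega
        simpa [consSeq, Fin.ext_iff] using hi.symm
      · simp [consSeq]
    · refine ⟨0, fun t ht => by omega, ?_⟩
      simpa [consSeq, Fin.ext_iff] using Ne.symm hi
  choose p hp using key
  exact ⟨_, p, fun i => (hp i).1, fun i => (hp i).2⟩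

/-- The scaling data `S` along words continued by `b`, replaced by the uniform data for words of
length less than `N`. -/
noncomputable def truncData (S : (ℕ → Fin d) → Fin (2 * d - 1) → ℝ) (b : ℕ → Fin d) (N : ℕ)
    (w : List (Fin d)) : Fin (2 * d - 1) → ℝ :=
  if w.length < N then fun _ => ((2 * d - 1 : ℕ) : ℝ)⁻¹ else S (extSeq b w)

variable {k : ℕ} {ε C M σ θ : ℝ} {S : (ℕ → Fin d) → Fin (2 * d - 1) → ℝ}
  {D : (ℕ → Fin d) → (ℕ → Fin d) → ℕ → ℝ → ℝ} {b : ℕ → Fin d} {p : Fin d → ℕ} {N : ℕ}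

lemma truncData_of_lt {w : List (Fin d)} (hw : w.length < N) (m : Fin (2 * d - 1)) :
    truncData S b N w m = ((2 * d - 1 : ℕ) : ℝ)⁻¹ := by rw [truncData, if_pos hw]

lemma truncData_of_le {w : List (Fin d)} (hw : N ≤ w.length) :
    truncData S b N w = S (extSeq b w) := by rw [truncData, if_neg (by omega)]

namespace IsControlled

lemma isCascade_truncData (h : IsMatched k ε C S) (hc : IsControlled k ε S D M σ θ)
    (b : ℕ → Fin d) (N : ℕ) : IsCascade (truncData S b N) σ θ := by
  have hd := h.two_le
  have hpos : (1 : ℝ) < ((2 * d - 1 : ℕ) : ℝ) := by exact_mod_cast (by omega : 1 < 2 * d - 1)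
  have hsum := (h.mem_Simp b).2
  have h1 : σ ≤ ((2 * d - 1 : ℕ) : ℝ)⁻¹ := by
    rw [le_inv_comm₀ hc.σ_pos (by linarith), ← one_div, le_div_iff₀ hc.σ_pos, ← hsum]
    simpa using Finset.sum_le_sum fun m (_ : m ∈ Finset.univ) => (hc.bounds b m).1
  have h2 : ((2 * d - 1 : ℕ) : ℝ)⁻¹ ≤ θ := by
    rw [inv_le_comm₀ (by linarith) hc.θ_pos, ← one_div, div_le_iff₀ hc.θ_pos, ← hsum]
    simpa using Finset.sum_le_sum fun m (_ : m ∈ Finset.univ) => (hc.bounds b m).2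
  refine ⟨hd, fun w => ?_, hc.σ_pos, hc.θ_lt_one, fun w m => ?_⟩
  · by_cases hw : w.length < N
    · rw [truncData, if_pos hw]
      refine ⟨fun _ => ⟨by positivity, inv_lt_one_of_one_lt₀ hpos⟩, ?_⟩
      rw [Finset.sum_const, Finset.card_univ, Fintype.card_fin, nsmul_eq_mul, mul_inv_cancel₀]
      linarith
    · rw [truncData, if_neg hw]; exact h.mem_Simp _
  · by_cases hw : w.length < N
    · rw [truncData_of_lt hw]; exact ⟨h1, h2⟩
    · rw [truncData, if_neg hw]; exact hc.bounds _ m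

/-- The exponential rate at which ratios stabilize. -/
noncomputable def tailSum (M θ : ℝ) (n : ℕ) : ℝ := M * θ ^ n / (1 - θ)

lemma tailSum_nonneg (hc : IsControlled k ε S D M σ θ) (n : ℕ) : 0 ≤ tailSum M θ n := by
  have := hc.M_nonneg
  have := hc.θ_pos
  have : 0 < 1 - θ := by linarith [hc.θ_lt_one]
  unfold tailSum
  positivity

lemma tailSum_eq (hc : IsControlled k ε S D M σ θ) (n : ℕ) :
    tailSum M θ n = M * θ ^ n + tailSum M θ (n + 1) := by
  have : 1 - θ ≠ 0 := by linarith [hc.θ_lt_one]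
  unfold tailSum
  field_simp
  ring

lemma rhoTerm_le_mul_cascLen (h : IsMatched k ε C S) (hc : IsControlled k ε S D M σ θ)
    (b : ℕ → Fin d) (N q : ℕ) (ω : ℕ → Fin d) (w : List (Fin d)) :
    rhoTerm S (extSeq b w) (w.length + q) ω ≤
      (σ ^ N)⁻¹ * Real.exp (tailSum M θ N - tailSum M θ (max N w.length)) *
        cascLen (truncData S b N) w := by
  have hC := hc.isCascade_truncData h b N
  have hσ := hc.σ_pos
  have hσ1 : σ ≤ 1 := (hc.bounds b ⟨0, by have := h.two_le; omega⟩).1.trans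
    ((h.mem_Simp b).1 _).2.le
  have hshort : ∀ w : List (Fin d), w.length ≤ N → rhoTerm S (extSeq b w) (w.length + q) ω ≤
      (σ ^ N)⁻¹ * Real.exp (tailSum M θ N - tailSum M θ (max N w.length)) *
        cascLen (truncData S b N) w := by
    intro w hw
    rw [max_eq_left hw, sub_self, Real.exp_zero, mul_one]
    have h1 : rhoTerm S (extSeq b w) (w.length + q) ω ≤ 1 := by
      simpa using rhoTerm_le_pow h.mem_Simp (fun j m => ((h.mem_Simp j).1 m).2.le) (extSeq b w)
        (w.length + q) ω
    refine h1.trans ?_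
    rw [inv_mul_eq_div, one_le_div (by positivity)]
    exact (pow_le_pow_of_le_one hσ.le hσ1 hw).trans (hC.pow_le_cascLen w)
  induction w with
  | nil => exact hshort [] (Nat.zero_le _)
  | cons i w ih =>
    by_cases hw : (i :: w).length ≤ N
    · exact hshort _ hw
    rw [List.length_cons] at hw ⊢
    have hNw : N ≤ w.length := by omega
    rw [max_eq_right hNw] at ih
    rw [max_eq_right (by omega), extSeq_cons, show w.length + 1 + q = w.length + q + 1 by omega,
      rhoTerm_consSeq, cascLen, truncData_of_le hNw]
    have h1 := hc.ratio_le (extSeq b w) (fun m => if m < w.length + q then extSeq b w m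
      else ω (m - (w.length + q))) w.length (fun t ht => by rw [if_pos (by omega)]) ⟨i, by omega⟩
    refine (mul_le_mul h1 ih (rhoTerm_nonneg h.mem_Simp _ _ _)
      (mul_nonneg (Real.exp_pos _).le ((h.mem_Simp _).1 _).1.le)).trans_eq ?_
    have e : Real.exp (tailSum M θ N - tailSum M θ (w.length + 1)) =
        Real.exp (M * θ ^ w.length) * Real.exp (tailSum M θ N - tailSum M θ w.length) := by
      rw [← Real.exp_add, hc.tailSum_eq w.length]; congr 1; ring
    rw [e]; ring

lemma cascLen_concat_of_lt {w : List (Fin d)} (hw : w.length < N) (i : Fin d) :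
    cascLen (truncData S b N) (w ++ [i]) =
      ((2 * d - 1 : ℕ) : ℝ)⁻¹ * cascLen (truncData S b N) w := by
  induction w with
  | nil => simp only [List.nil_append, cascLen]; rw [truncData_of_lt hw, mul_comm]
  | cons l w ih =>
    rw [List.length_cons] at hw
    rw [List.cons_append, cascLen, ih (by omega), cascLen, truncData_of_lt (by simpa using hw),
      truncData_of_lt (by omega)]
    ring

lemma concat_le (h : IsMatched k ε C S) (hc : IsControlled k ε S D M σ θ)
    (b : ℕ → Fin d) (hN : 1 ≤ N) (i : Fin d) (w : List (Fin d)) (m : Fin (2 * d - 1)) :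
    cascLen (truncData S b N) (w ++ [i]) * truncData S b N (w ++ [i]) m ≤
      θ * Real.exp (tailSum M θ N - tailSum M θ (max N (w.length + 1))) *
        (cascLen (truncData S b N) w * truncData S b N w m) := by
  have hC := hc.isCascade_truncData h b N
  induction w generalizing m with
  | nil =>
    rw [List.length_nil, max_eq_left (by omega), sub_self, Real.exp_zero, mul_one,
      cascLen_concat_of_lt (w := []) (by simp; omega), truncData_of_lt (w := [])
        (by simp; omega), mul_comm θ, mul_comm (((2 * d - 1 : ℕ) : ℝ)⁻¹)]
    exact mul_le_mul_of_nonneg_left (hC.bounds _ _).2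
      (mul_nonneg (hC.cascLen_pos _).le (by positivity))
  | cons l w ih =>
    by_cases hw : (l :: w).length < N
    · rw [max_eq_left (by omega), sub_self, Real.exp_zero, mul_one,
        cascLen_concat_of_lt hw, truncData_of_lt hw, mul_comm θ,
        mul_comm (((2 * d - 1 : ℕ) : ℝ)⁻¹)]
      exact mul_le_mul_of_nonneg_left (hC.bounds _ _).2
        (mul_nonneg (hC.cascLen_pos _).le (by positivity))
    · have hw' : N ≤ (l :: w).length := by omega
      have ih := ih ⟨l, by omega⟩
      rw [← List.length_cons (a := l), max_eq_right hw'] at ih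
      have h1 := hc.ratio_le (extSeq b (l :: w)) (extSeq b (l :: w ++ [i])) (l :: w).length
        (fun t ht => by
          rw [extSeq_concat]; exact extSeq_agree (p := 0) (by simp) _ t (by simpa using ht)) m
      rw [max_eq_right (by omega), truncData_of_le hw', truncData_of_le (by simp at hw' ⊢; omega)]
      refine (mul_le_mul ih h1 ((h.mem_Simp _).1 _).1.le ?_).trans_eq ?_
      · exact mul_nonneg (mul_nonneg hc.θ_pos.le (Real.exp_pos _).le)
          (mul_nonneg (hC.cascLen_pos _).le ((hC.mem_Simp _).1 _).1.le)
      · have e : Real.exp (tailSum M θ N - tailSum M θ ((l :: w).length + 1)) =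
            Real.exp (M * θ ^ (l :: w).length) *
              Real.exp (tailSum M θ N - tailSum M θ (l :: w).length) := by
          rw [← Real.exp_add, hc.tailSum_eq (l :: w).length]; congr 1; ring
        rw [e, cascLen]; ring

lemma le_concat (h : IsMatched k ε C S) (hc : IsControlled k ε S D M σ θ)
    (b : ℕ → Fin d) (hN : 1 ≤ N) (i : Fin d) (w : List (Fin d)) (m : Fin (2 * d - 1)) :
    σ * (cascLen (truncData S b N) w * truncData S b N w m) ≤
      Real.exp (tailSum M θ N - tailSum M θ (max N (w.length + 1))) *
        (cascLen (truncData S b N) (w ++ [i]) * truncData S b N (w ++ [i]) m) := by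
  have hC := hc.isCascade_truncData h b N
  induction w generalizing m with
  | nil =>
    rw [List.length_nil, max_eq_left (by omega), sub_self, Real.exp_zero, one_mul,
      cascLen_concat_of_lt (w := []) (by simp; omega), truncData_of_lt (w := [])
        (by simp; omega), mul_comm σ, mul_comm (((2 * d - 1 : ℕ) : ℝ)⁻¹)]
    exact mul_le_mul_of_nonneg_left (hC.bounds _ _).1
      (mul_nonneg (hC.cascLen_pos _).le (by positivity))
  | cons l w ih =>
    by_cases hw : (l :: w).length < N
    · rw [max_eq_left (by omega), sub_self, Real.exp_zero, one_mul,
        cascLen_concat_of_lt hw, truncData_of_lt hw, mul_comm σ,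
        mul_comm (((2 * d - 1 : ℕ) : ℝ)⁻¹)]
      exact mul_le_mul_of_nonneg_left (hC.bounds _ _).1
        (mul_nonneg (hC.cascLen_pos _).le (by positivity))
    · have hw' : N ≤ (l :: w).length := by omega
      have ih := ih ⟨l, by omega⟩
      rw [← List.length_cons (a := l), max_eq_right hw'] at ih
      have h1 := hc.ratio_le (extSeq b (l :: w ++ [i])) (extSeq b (l :: w)) (l :: w).length
        (fun t ht => by
          rw [extSeq_concat]; exact extSeq_agree (p := 0) (by simp) _ t (by simpa using ht)) m
      rw [max_eq_right (by omega), truncData_of_le hw', truncData_of_le (by simp at hw' ⊢; omega)]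
      have h2 := mul_le_mul ih h1 ((h.mem_Simp _).1 _).1.le (mul_nonneg (Real.exp_pos _).le
        (mul_nonneg (hC.cascLen_pos _).le ((hC.mem_Simp _).1 _).1.le))
      have e : Real.exp (tailSum M θ N - tailSum M θ ((l :: w).length + 1)) =
          Real.exp (M * θ ^ (l :: w).length) *
            Real.exp (tailSum M θ N - tailSum M θ (l :: w).length) := by
        rw [← Real.exp_add, hc.tailSum_eq (l :: w).length]; congr 1; ring
      rw [e, cascLen, List.cons_append, cascLen]
      rw [List.cons_append] at h2
      linarith

/-- Truncating at a large level makes the shift branches uniformly contracting, with interval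
lengths comparable to the products `rhoS`. -/
theorem exists_truncation (h : IsMatched k ε C S) (hc : IsControlled k ε S D M σ θ)
    (b : ℕ → Fin d) : ∃ (N : ℕ) (K c θ' : ℝ), 0 ≤ K ∧ 0 < c ∧ θ' < 1 ∧
      (∀ w q, rhoS S (extSeq b w) (w.length + q) ≤ K * cascLen (truncData S b N) w) ∧
      ∀ i w m, c * (cascLen (truncData S b N) w * truncData S b N w m) ≤
          cascLen (truncData S b N) (w ++ [i]) * truncData S b N (w ++ [i]) m ∧
        cascLen (truncData S b N) (w ++ [i]) * truncData S b N (w ++ [i]) m ≤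
          θ' * (cascLen (truncData S b N) w * truncData S b N w m) := by
  have hlim : Tendsto (fun n => θ * Real.exp (tailSum M θ n)) atTop (nhds (θ * 1)) := by
    refine Tendsto.const_mul _ ?_
    rw [← Real.exp_zero]
    refine (Real.continuous_exp.tendsto 0).comp ?_
    have := ((tendsto_pow_atTop_nhds_zero_of_lt_one hc.θ_pos.le hc.θ_lt_one).const_mul M).div_const
      (1 - θ)
    rw [mul_zero, zero_div] at this
    exact this
  obtain ⟨N, hNθ, hN⟩ := ((hlim.eventually_lt_const (by simpa using hc.θ_lt_one)).and
    (eventually_ge_atTop 1)).exists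
  have hC := hc.isCascade_truncData h b N
  have hσ := hc.σ_pos
  have hexp : ∀ n, Real.exp (tailSum M θ N - tailSum M θ n) ≤ Real.exp (tailSum M θ N) := fun n =>
    Real.exp_le_exp.mpr (by linarith [hc.tailSum_nonneg n])
  have hnn : ∀ w m, 0 ≤ cascLen (truncData S b N) w * truncData S b N w m := fun w m =>
    mul_nonneg (hC.cascLen_pos _).le ((hC.mem_Simp _).1 _).1.le
  refine ⟨N, (σ ^ N)⁻¹ * Real.exp (tailSum M θ N), σ / Real.exp (tailSum M θ N),
    θ * Real.exp (tailSum M θ N), by positivity, by positivity, hNθ, fun w q => ?_,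
    fun i w m => ⟨?_, ?_⟩⟩
  · refine rhoS_le fun ω => (hc.rhoTerm_le_mul_cascLen h b N q ω w).trans ?_
    exact mul_le_mul_of_nonneg_right (mul_le_mul_of_nonneg_left (hexp _) (by positivity))
      (hC.cascLen_pos w).le
  · rw [div_mul_eq_mul_div, div_le_iff₀ (Real.exp_pos _), mul_comm (_ * _) (Real.exp _)]
    exact (hc.le_concat h b hN i w m).trans (mul_le_mul_of_nonneg_right (hexp _) (hnn _ _))
  · exact (hc.concat_le h b hN i w m).trans (mul_le_mul_of_nonneg_right
      (mul_le_mul_of_nonneg_left (hexp _) hc.θ_pos.le) (hnn _ _))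

end IsControlled

end Truncation

lemma mul_rpow_eq_rpow_sub {x ε : ℝ} (hx : 0 < x) {k m : ℕ} (hm : m ≤ k) :
    x / x ^ m * x ^ ((k : ℝ) + ε - 1) = x ^ (((k - m : ℕ) : ℝ) + ε) := by
  rw [Nat.cast_sub hm, show ((k : ℝ) - m + ε) = 1 - m + (k + ε - 1) by ring,
    Real.rpow_add hx (1 - m), Real.rpow_sub hx 1, Real.rpow_one, Real.rpow_natCast]

section CodeJet

variable {d k : ℕ} {ε C M σ θ K c θ' : ℝ} {S : (ℕ → Fin d) → Fin (2 * d - 1) → ℝ}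
  {D : (ℕ → Fin d) → (ℕ → Fin d) → ℕ → ℝ → ℝ} {b : ℕ → Fin d} {p : Fin d → ℕ} {N : ℕ}

/-- The data needed to build the branches: controlled comparison jets and a truncation level at
which the shift branches are uniformly contracting. -/
structure IsPrepared (k : ℕ) (ε C : ℝ) (S : (ℕ → Fin d) → Fin (2 * d - 1) → ℝ)
    (D : (ℕ → Fin d) → (ℕ → Fin d) → ℕ → ℝ → ℝ) (M σ θ : ℝ) (b : ℕ → Fin d) (p : Fin d → ℕ)
    (N : ℕ) (K c θ' : ℝ) : Prop where
  matched : IsMatched k ε C S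
  controlled : IsControlled k ε S D M σ θ
  tail : IsTail b p
  K_nonneg : 0 ≤ K
  c_pos : 0 < c
  θ'_lt_one : θ' < 1
  rho_le : ∀ w q, rhoS S (extSeq b w) (w.length + q) ≤ K * cascLen (truncData S b N) w
  ratio : ∀ i w m, c * (cascLen (truncData S b N) w * truncData S b N w m) ≤
      cascLen (truncData S b N) (w ++ [i]) * truncData S b N (w ++ [i]) m ∧
    cascLen (truncData S b N) (w ++ [i]) * truncData S b N (w ++ [i]) m ≤
      θ' * (cascLen (truncData S b N) w * truncData S b N w m)

/-- The approximation of the `i`-th branch and its derivatives on the interval with word `w`. -/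
noncomputable def approxJet (S : (ℕ → Fin d) → Fin (2 * d - 1) → ℝ)
    (D : (ℕ → Fin d) → (ℕ → Fin d) → ℕ → ℝ → ℝ) (b : ℕ → Fin d) (N : ℕ) (i : Fin d)
    (w : List (Fin d)) (m : ℕ) (x : ℝ) : ℝ :=
  (if m = 0 then cascLeft (truncData S b N) (w ++ [i]) else 0) +
    cascLen (truncData S b N) (w ++ [i]) / cascLen (truncData S b N) w ^ m *
      D (extSeq b w) (extSeq b (w ++ [i])) m
        ((x - cascLeft (truncData S b N) w) / cascLen (truncData S b N) w)

namespace IsPrepared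

lemma cascade (h : IsPrepared k ε C S D M σ θ b p N K c θ') :
    IsCascade (truncData S b N) σ θ := h.controlled.isCascade_truncData h.matched b N

lemma concat_bounds (h : IsPrepared k ε C S D M σ θ b p N K c θ') (i : Fin d)
    (w : List (Fin d)) :
    c * cascLen (truncData S b N) w ≤ cascLen (truncData S b N) (w ++ [i]) ∧
      cascLen (truncData S b N) (w ++ [i]) ≤ θ' * cascLen (truncData S b N) w := by
  have h1 := Finset.sum_le_sum fun m (_ : m ∈ Finset.univ) => (h.ratio i w m).1
  have h2 := Finset.sum_le_sum fun m (_ : m ∈ Finset.univ) => (h.ratio i w m).2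
  simp only [← Finset.mul_sum, (h.cascade.mem_Simp _).2, mul_one] at h1 h2
  exact ⟨h1, h2⟩

lemma concat_le (h : IsPrepared k ε C S D M σ θ b p N K c θ') (i : Fin d) (w : List (Fin d)) :
    cascLen (truncData S b N) (w ++ [i]) ≤ cascLen (truncData S b N) w :=
  (h.concat_bounds i w).2.trans
    (mul_le_of_le_one_left (h.cascade.cascLen_pos w).le h.θ'_lt_one.le)

lemma agree (h : IsPrepared k ε C S D M σ θ b p N K c θ') (i : Fin d) (w : List (Fin d)) :
    ∀ t < w.length + p i, extSeq b w t = extSeq b (w ++ [i]) t := by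
  rw [extSeq_concat]; exact extSeq_agree (h.tail.agree i) w

lemma ne (h : IsPrepared k ε C S D M σ θ b p N K c θ') (i : Fin d) (w : List (Fin d)) :
    extSeq b w (w.length + p i) ≠ extSeq b (w ++ [i]) (w.length + p i) := by
  rw [extSeq_concat, extSeq_apply_add, extSeq_apply_add]; exact h.tail.ne i

lemma rho_rpow_le (h : IsPrepared k ε C S D M σ θ b p N K c θ') (w : List (Fin d)) (q : ℕ) :
    rhoS S (extSeq b w) (w.length + q) ^ ((k : ℝ) + ε - 1) ≤
      K ^ ((k : ℝ) + ε - 1) * cascLen (truncData S b N) w ^ ((k : ℝ) + ε - 1) := by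
  rw [← Real.mul_rpow h.K_nonneg (h.cascade.cascLen_pos w).le]
  exact Real.rpow_le_rpow (rhoS_nonneg h.matched.mem_Simp _ _) (h.rho_le w q)
    h.matched.exponent_pos.le

lemma abs_approxJet_sub_cons_le (h : IsPrepared k ε C S D M σ θ b p N K c θ') {m : ℕ} (hm : m ≤ k)
    (i l : Fin d) (w : List (Fin d)) (hw : N ≤ w.length) {x : ℝ}
    (hx : (x - cascLeft (truncData S b N) (l :: w)) / cascLen (truncData S b N) (l :: w) ∈ I01) :
    |approxJet S D b N i w m x - approxJet S D b N i (l :: w) m x| ≤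
      M * K ^ ((k : ℝ) + ε - 1) / σ ^ k *
        cascLen (truncData S b N) w ^ (((k - m : ℕ) : ℝ) + ε) := by
  set T := truncData S b N with hT
  have hC : IsCascade T σ θ := h.cascade
  have hσ := h.controlled.σ_pos
  have hlw := hC.cascLen_pos w
  have hlw' := hC.cascLen_pos (w ++ [i])
  set s := T w ⟨l, by omega⟩ with hs
  set s' := T (w ++ [i]) ⟨l, by omega⟩ with hs'
  have hs0 : 0 < s := ((hC.mem_Simp _).1 _).1
  have hs'0 : 0 < s' := ((hC.mem_Simp _).1 _).1
  set z := (x - cascLeft T (l :: w)) / cascLen T (l :: w) with hz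
  have hR := h.controlled.renorm_le _ _ _ (h.agree i w) (h.ne i w) l m hm z hx
  have hTw : T w = S (extSeq b w) := truncData_of_le hw
  have hTw' : T (w ++ [i]) = S (extSeq b (w ++ [i])) :=
    truncData_of_le (by rw [List.length_append]; omega)
  rw [← hTw, ← hTw', ← hs, ← hs'] at hR
  have e1 : (x - cascLeft T w) / cascLen T w = childLeft (T w) l + s * z := by
    rw [hz, cascLeft, cascLen, ← hs]; field_simp; ring
  have key : approxJet S D b N i w m x - approxJet S D b N i (l :: w) m x =
      cascLen T (w ++ [i]) * s' / (cascLen T w ^ m * s ^ m) *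
      (renormJet (childLeft (T w) l) s (childLeft (T (w ++ [i])) l) s'
        (D (extSeq b w) (extSeq b (w ++ [i]))) m z -
        D (consSeq l (extSeq b w)) (consSeq l (extSeq b (w ++ [i]))) m z) := by
    rw [approxJet, approxJet, ← hT, e1, ← hz, List.cons_append, extSeq_cons, extSeq_cons, renormJet,
      cascLeft, cascLen, cascLen, ← hs, ← hs']
    rcases Nat.eq_zero_or_pos m with rfl | hm0
    · simp only [if_true, pow_zero]; field_simp; ring
    · simp only [if_neg hm0.ne']; field_simp; ring
  rw [key, abs_mul, abs_of_nonneg (by positivity)]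
  calc _ ≤ cascLen T w / (cascLen T w ^ m * σ ^ k) *
      (M * (K ^ ((k : ℝ) + ε - 1) * cascLen T w ^ ((k : ℝ) + ε - 1))) := by
        refine mul_le_mul ?_ (hR.trans (mul_le_mul_of_nonneg_left (h.rho_rpow_le w _)
          h.controlled.M_nonneg)) (abs_nonneg _) (by positivity)
        refine div_le_div₀ hlw.le ?_ (by positivity) ?_
        · exact (mul_le_of_le_one_right hlw'.le ((hC.mem_Simp _).1 _).2.le).trans
            (h.concat_le i w)
        · refine mul_le_mul_of_nonneg_left ?_ (by positivity)
          calc σ ^ k ≤ σ ^ m := pow_le_pow_of_le_one hσ.le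
                (((hC.bounds w _).1).trans ((hC.mem_Simp w).1 ⟨l, by omega⟩).2.le) hm
            _ ≤ s ^ m := pow_le_pow_left₀ hσ.le (hC.bounds _ _).1 _
    _ = _ := by rw [← mul_rpow_eq_rpow_sub hlw hm]; field_simp

end IsPrepared

end CodeJet

section CodeJet

variable {d k : ℕ} {ε C M σ θ K c θ' : ℝ} {S : (ℕ → Fin d) → Fin (2 * d - 1) → ℝ}
  {D : (ℕ → Fin d) → (ℕ → Fin d) → ℕ → ℝ → ℝ} {b : ℕ → Fin d} {p : Fin d → ℕ} {N : ℕ}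

lemma IsCascade.cascLen_codeWord_add_le {T : List (Fin d) → Fin (2 * d - 1) → ℝ}
    (h : IsCascade T σ θ) (a : ℕ → Fin d) (n j : ℕ) :
    cascLen T (codeWord a (n + j)) ≤ θ ^ j * cascLen T (codeWord a n) := by
  induction j with
  | zero => simp
  | succ j ih =>
    rw [pow_succ', mul_assoc]
    exact (h.cascLen_cons_le _ _).trans (mul_le_mul_of_nonneg_left ih h.θ_nonneg)

/-- The values `H` are approximated by the jets of the branch approximations. -/
def IsCodeJet (k : ℕ) (ε : ℝ) (S : (ℕ → Fin d) → Fin (2 * d - 1) → ℝ)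
    (D : (ℕ → Fin d) → (ℕ → Fin d) → ℕ → ℝ → ℝ) (b : ℕ → Fin d) (N : ℕ) (i : Fin d)
    (A : ℝ) (H : ℕ → (ℕ → Fin d) → ℝ) : Prop :=
  ∀ m ≤ k, ∀ a n, N ≤ n →
    |H m a - approxJet S D b N i (codeWord a n) m (cascPt (truncData S b N) a)| ≤
      A * cascLen (truncData S b N) (codeWord a n) ^ (((k - m : ℕ) : ℝ) + ε)

namespace IsPrepared

lemma exists_isCodeJet (h : IsPrepared k ε C S D M σ θ b p N K c θ') (i : Fin d) :
    ∃ A H, 0 ≤ A ∧ IsCodeJet k ε S D b N i A H := by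
  have hC := h.cascade
  have hε := h.matched.ε_pos
  have hθ0 := h.controlled.θ_pos
  have hr : θ ^ ε < 1 := Real.rpow_lt_one hθ0.le h.controlled.θ_lt_one hε
  have hσ := h.controlled.σ_pos
  have hM := h.controlled.M_nonneg
  have hK := h.K_nonneg
  set A₀ := M * K ^ ((k : ℝ) + ε - 1) / σ ^ k with hA₀
  have hA₀0 : 0 ≤ A₀ := by positivity
  have hu : ∀ m ≤ k, ∀ a n, N ≤ n → ∀ j,
      dist (approxJet S D b N i (codeWord a (n + j)) m (cascPt (truncData S b N) a))
        (approxJet S D b N i (codeWord a (n + (j + 1))) m (cascPt (truncData S b N) a)) ≤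
      A₀ * cascLen (truncData S b N) (codeWord a n) ^ (((k - m : ℕ) : ℝ) + ε) * (θ ^ ε) ^ j := by
    intro m hm a n hn j
    have hl := hC.cascLen_pos (codeWord a n)
    refine (h.abs_approxJet_sub_cons_le hm i (a (n + j)) (codeWord a (n + j))
      (by rw [codeWord_length]; omega) (hC.relPos_mem_I01 a (n + j + 1))).trans ?_
    rw [mul_assoc]
    refine mul_le_mul_of_nonneg_left ?_ hA₀0
    calc _ ≤ (θ ^ j * cascLen (truncData S b N) (codeWord a n)) ^ (((k - m : ℕ) : ℝ) + ε) :=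
          Real.rpow_le_rpow (hC.cascLen_pos _).le (hC.cascLen_codeWord_add_le a n j) (by positivity)
      _ = (θ ^ j) ^ (((k - m : ℕ) : ℝ) + ε) *
          cascLen (truncData S b N) (codeWord a n) ^ (((k - m : ℕ) : ℝ) + ε) :=
          Real.mul_rpow (by positivity) hl.le
      _ ≤ (θ ^ ε) ^ j * cascLen (truncData S b N) (codeWord a n) ^ (((k - m : ℕ) : ℝ) + ε) := by
          refine mul_le_mul_of_nonneg_right ?_ (by positivity)
          rw [Real.rpow_pow_comm hθ0.le]
          exact Real.rpow_le_rpow_of_exponent_ge (by positivity)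
            (pow_le_one₀ hθ0.le h.controlled.θ_lt_one.le) (le_add_of_nonneg_left (by positivity))
      _ = _ := mul_comm _ _
  have hlim : ∀ m a, m ≤ k → ∃ l, Tendsto (fun n =>
      approxJet S D b N i (codeWord a n) m (cascPt (truncData S b N) a)) atTop (nhds l) := by
    intro m a hm
    obtain ⟨l, hl⟩ := cauchySeq_tendsto_of_complete
      (cauchySeq_of_le_geometric _ _ hr (hu m hm a N le_rfl))
    refine ⟨l, (tendsto_add_atTop_iff_nat N).mp ?_⟩
    simpa only [add_comm] using hl
  choose! H hH using hlim
  refine ⟨A₀ / (1 - θ ^ ε), H, div_nonneg hA₀0 (by linarith), fun m hm a n hn => ?_⟩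
  have ht := (tendsto_add_atTop_iff_nat n).mpr (hH m a hm)
  simp only [add_comm _ n] at ht
  have := dist_le_of_le_geometric_of_tendsto₀ _ _ hr (hu m hm a n hn) ht
  rw [dist_comm, Real.dist_eq] at this
  rw [div_mul_eq_mul_div]
  exact this

variable {i : Fin d} {A : ℝ} {H : ℕ → (ℕ → Fin d) → ℝ}

lemma cascLen_rpow_le (h : IsPrepared k ε C S D M σ θ b p N K c θ') (a : ℕ → Fin d) (n : ℕ)
    {e : ℝ} (he : ε ≤ e) : cascLen (truncData S b N) (codeWord a n) ^ e ≤ (θ ^ ε) ^ n := by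
  have hC := h.cascade
  have hl := hC.cascLen_le_pow (codeWord a n)
  rw [codeWord_length] at hl
  rw [Real.rpow_pow_comm h.controlled.θ_pos.le]
  exact (Real.rpow_le_rpow_of_exponent_ge (hC.cascLen_pos _) (hC.cascLen_le_one _) he).trans
    (Real.rpow_le_rpow (hC.cascLen_pos _).le hl h.matched.ε_pos.le)

lemma tendsto_error (h : IsPrepared k ε C S D M σ θ b p N K c θ') (A : ℝ) :
    Tendsto (fun n => A * (θ ^ ε) ^ n) atTop (nhds 0) := by
  have hθ0 := h.controlled.θ_pos
  simpa using (tendsto_pow_atTop_nhds_zero_of_lt_one (Real.rpow_nonneg hθ0.le ε)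
    (Real.rpow_lt_one hθ0.le h.controlled.θ_lt_one h.matched.ε_pos)).const_mul A

lemma codeJet_zero (h : IsPrepared k ε C S D M σ θ b p N K c θ') (hA : 0 ≤ A)
    (hH : IsCodeJet k ε S D b N i A H) (a : ℕ → Fin d) :
    H 0 a = cascPt (truncData S b N) (consSeq i a) := by
  have hC := h.cascade
  rw [← sub_eq_zero, ← abs_nonpos_iff]
  refine ge_of_tendsto (h.tendsto_error (A + 1)) ?_
  filter_upwards [eventually_ge_atTop N] with n hn
  have h1 := hH 0 (Nat.zero_le _) a n hn
  have h2 := mul_le_mul_of_nonneg_left (h.cascLen_rpow_le a n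
    (e := ((k - 0 : ℕ) : ℝ) + ε) (le_add_of_nonneg_left (by positivity))) hA
  have h3 := h.cascLen_rpow_le a n h.matched.ε_le_one
  rw [Real.rpow_one] at h3
  have h4 := h.concat_le i (codeWord a n)
  have hl := hC.cascLen_pos (codeWord a n ++ [i])
  have h5 := hC.cascLeft_le_cascPt (consSeq i a) (n + 1)
  have h6 := hC.cascPt_le_cascRight (consSeq i a) (n + 1)
  rw [codeWord_consSeq] at h5 h6
  have h7 := h.controlled.mapsTo _ _ _ (h.agree i (codeWord a n)) (h.ne i (codeWord a n))
    (hC.relPos_mem_I01 a n)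
  rw [approxJet, if_pos rfl, pow_zero, div_one] at h1
  have h8 := mul_nonneg hl.le h7.1
  have h9 := mul_le_of_le_one_right hl.le h7.2
  rw [abs_le] at h1 ⊢
  constructor <;> linarith

lemma codeJet_one (h : IsPrepared k ε C S D M σ θ b p N K c θ') (hA : 0 ≤ A)
    (hH : IsCodeJet k ε S D b N i A H) (a : ℕ → Fin d) : c ≤ H 1 a ∧ H 1 a ≤ θ' := by
  have hC := h.cascade
  have hM := h.controlled.M_nonneg
  have key : ∀ n, N ≤ n → c - H 1 a ≤ (M + A) * (θ ^ ε) ^ n ∧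
      H 1 a - θ' ≤ (M + A) * (θ ^ ε) ^ n := by
    intro n hn
    have h1 := hH 1 h.matched.one_le a n hn
    have h2 := mul_le_mul_of_nonneg_left (h.cascLen_rpow_le a n
      (e := ((k - 1 : ℕ) : ℝ) + ε) (le_add_of_nonneg_left (by positivity))) hA
    have hl := hC.cascLen_pos (codeWord a n)
    obtain ⟨h3, h4⟩ := h.concat_bounds i (codeWord a n)
    rw [← le_div_iff₀ hl] at h3
    rw [← div_le_iff₀ hl] at h4
    have h5 := h.controlled.abs_sub_one_le _ _ _ (h.agree i (codeWord a n))
      (h.ne i (codeWord a n)) _ (hC.relPos_mem_I01 a n)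
    have h6 : M * θ ^ ((codeWord a n).length + p i) ≤ M * (θ ^ ε) ^ n := by
      refine mul_le_mul_of_nonneg_left ?_ hM
      rw [codeWord_length]
      have hθ0 := h.controlled.θ_pos
      have hθ1 := h.controlled.θ_lt_one.le
      have h7 := Real.rpow_le_rpow_of_exponent_ge hθ0 hθ1 h.matched.ε_le_one
      rw [Real.rpow_one] at h7
      exact (pow_le_pow_of_le_one hθ0.le hθ1 (Nat.le_add_right _ _)).trans
        (pow_le_pow_left₀ hθ0.le h7 n)
    rw [approxJet, if_neg one_ne_zero, pow_one, zero_add] at h1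
    set r := cascLen (truncData S b N) (codeWord a n ++ [i]) /
      cascLen (truncData S b N) (codeWord a n)
    set v := D (extSeq b (codeWord a n)) (extSeq b (codeWord a n ++ [i])) 1
      ((cascPt (truncData S b N) a - cascLeft (truncData S b N) (codeWord a n)) /
        cascLen (truncData S b N) (codeWord a n))
    have hr : |r * v - r| ≤ M * (θ ^ ε) ^ n := by
      rw [show r * v - r = r * (v - 1) by ring, abs_mul, abs_of_nonneg (h.c_pos.le.trans h3)]
      exact (mul_le_of_le_one_left (abs_nonneg _) (h4.trans h.θ'_lt_one.le)).trans (h5.trans h6)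
    rw [abs_le] at h1 hr
    constructor <;> linarith
  constructor
  · rw [← sub_nonpos]
    refine ge_of_tendsto (h.tendsto_error (M + A)) ?_
    filter_upwards [eventually_ge_atTop N] with n hn using (key n hn).1
  · rw [← sub_nonpos]
    refine ge_of_tendsto (h.tendsto_error (M + A)) ?_
    filter_upwards [eventually_ge_atTop N] with n hn using (key n hn).2

lemma exists_abs_codeJet_le (h : IsPrepared k ε C S D M σ θ b p N K c θ') (hA : 0 ≤ A)
    (hH : IsCodeJet k ε S D b N i A H) : ∃ B, 0 ≤ B ∧ ∀ m ≤ k, ∀ a, |H m a| ≤ B := by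
  have hC := h.cascade
  have hM := h.controlled.M_nonneg
  have hσ := h.controlled.σ_pos
  refine ⟨A + (1 + 1 / (σ ^ N) ^ k * M), by positivity, fun m hm a => ?_⟩
  have h1 := hH m hm a N le_rfl
  have h2 : cascLen (truncData S b N) (codeWord a N) ^ (((k - m : ℕ) : ℝ) + ε) ≤ 1 :=
    Real.rpow_le_one (hC.cascLen_pos _).le (hC.cascLen_le_one _)
      (by have := h.matched.ε_pos; positivity)
  have h3 : |approxJet S D b N i (codeWord a N) m (cascPt (truncData S b N) a)| ≤
      1 + 1 / (σ ^ N) ^ k * M := by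
    rw [approxJet]
    refine (abs_add_le _ _).trans (add_le_add ?_ ?_)
    · split_ifs
      · obtain ⟨x, hx⟩ := hC.cascLeft_mem (codeWord a N ++ [i])
        rw [← hx]
        have := hC.cascPt_mem_I01 x
        rw [abs_of_nonneg this.1]; exact this.2
      · simp
    · have hl := hC.cascLen_pos (codeWord a N)
      have hl' := hC.cascLen_pos (codeWord a N ++ [i])
      have hlow := hC.pow_le_cascLen (codeWord a N)
      rw [codeWord_length] at hlow
      rw [abs_mul, abs_of_nonneg (by positivity)]
      refine mul_le_mul ?_ (h.controlled.abs_le _ _ _ (h.agree i _) (h.ne i _) m hm _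
        (hC.relPos_mem_I01 a N)) (abs_nonneg _) (by positivity)
      refine div_le_div₀ zero_le_one (hC.cascLen_le_one _) (by positivity) ?_
      calc (σ ^ N) ^ k ≤ cascLen (truncData S b N) (codeWord a N) ^ k :=
            pow_le_pow_left₀ (by positivity) hlow k
        _ ≤ _ := pow_le_pow_of_le_one hl.le (hC.cascLen_le_one _) hm
  have h4 := abs_sub_abs_le_abs_sub (H m a)
    (approxJet S D b N i (codeWord a N) m (cascPt (truncData S b N) a))
  have h5 := mul_le_mul_of_nonneg_left h2 hA
  linarith

end IsPrepared

end CodeJet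

section CodeJet

variable {d k : ℕ} {ε C M σ θ K c θ' : ℝ} {S : (ℕ → Fin d) → Fin (2 * d - 1) → ℝ}
  {D : (ℕ → Fin d) → (ℕ → Fin d) → ℕ → ℝ → ℝ} {b : ℕ → Fin d} {p : Fin d → ℕ} {N : ℕ}

lemma abs_taylorSum_le {n : ℕ} {F : ℕ → ℝ → ℝ} {x y B : ℝ}
    (h : ∀ l ≤ n, |F l x| * |y - x| ^ l ≤ B) : |taylorSum n F x y| ≤ (n + 1) * B := by
  rw [taylorSum]
  refine (Finset.abs_sum_le_sum_abs _ _).trans ((Finset.sum_le_card_nsmul _ _ B ?_).trans_eq ?_)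
  · intro l hl
    have h1 := h l (by rw [Finset.mem_range] at hl; omega)
    have h2 : (1 : ℝ) ≤ (l.factorial : ℝ) := by exact_mod_cast l.factorial_pos
    rw [abs_div, abs_mul, abs_pow, abs_of_nonneg (zero_le_one.trans h2)]
    exact (div_le_self (by positivity) h2).trans h1
  · simp

lemma taylorSum_sub (n : ℕ) (F G : ℕ → ℝ → ℝ) (x y : ℝ) :
    taylorSum n F x y - taylorSum n G x y = taylorSum n (fun l x => F l x - G l x) x y := by
  simp only [taylorSum, ← Finset.sum_sub_distrib]
  exact Finset.sum_congr rfl fun l _ => by ring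

namespace IsPrepared

lemma approxJet_taylor (h : IsPrepared k ε C S D M σ θ b p N K c θ') (i : Fin d)
    (w : List (Fin d)) {m : ℕ} (hm : m ≤ k) {x y : ℝ}
    (hx : (x - cascLeft (truncData S b N) w) / cascLen (truncData S b N) w ∈ I01)
    (hy : (y - cascLeft (truncData S b N) w) / cascLen (truncData S b N) w ∈ I01) :
    |approxJet S D b N i w m y -
      taylorSum (k - m) (fun l => approxJet S D b N i w (m + l)) x y| ≤
      M * K ^ ((k : ℝ) + ε - 1) * cascLen (truncData S b N) w ^ (((k - m : ℕ) : ℝ) + ε) := by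
  have hC := h.cascade
  have hM := h.controlled.M_nonneg
  have hK := h.K_nonneg
  have hl := hC.cascLen_pos w
  have hl' := hC.cascLen_pos (w ++ [i])
  have hcl := h.concat_le i w
  have hv := h.controlled.var_le _ _ _ (h.agree i w) (h.ne i w)
  have hjet := h.controlled.jet _ _ _ (h.agree i w) (h.ne i w)
  set ψ := D (extSeq b w) (extSeq b (w ++ [i])) with hψ
  set L := cascLeft (truncData S b N) w with hL
  set Λ := cascLen (truncData S b N) w with hΛ
  set Λ' := cascLen (truncData S b N) (w ++ [i]) with hΛ'
  have hjm : IsJet (k - m) I01 fun l => ψ (m + l) := fun l hl x hx => hjet (m + l) (by omega) x hx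
  have hT := hjm.taylor_bound ordConnected_Icc (k - m) hx hy
    (η := M * rhoS S (extSeq b w) (w.length + p i) ^ ((k : ℝ) + ε - 1)) (fun z hz => by
      simp only [Nat.add_sub_cancel' hm]
      exact hv z (ordConnected_Icc.uIcc_subset hx hy hz) _ hx)
  have hsum : taylorSum (k - m) (fun l => approxJet S D b N i w (m + l)) x y =
      (if m = 0 then cascLeft (truncData S b N) (w ++ [i]) else 0) +
        Λ' / Λ ^ m * taylorSum (k - m) (fun l => ψ (m + l)) ((x - L) / Λ) ((y - L) / Λ) := by
    have e1 : ∑ l ∈ Finset.range (k - m + 1),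
        (if m + l = 0 then cascLeft (truncData S b N) (w ++ [i]) else 0) * (y - x) ^ l /
          (l.factorial : ℝ) = if m = 0 then cascLeft (truncData S b N) (w ++ [i]) else 0 := by
      rw [Finset.sum_eq_single 0]
      · simp
      · intro l _ hl0
        rw [if_neg (by omega), zero_mul, zero_div]
      · simp
    rw [taylorSum, taylorSum, Finset.mul_sum, ← e1, ← Finset.sum_add_distrib]
    refine Finset.sum_congr rfl fun l _ => ?_
    rw [approxJet, ← hψ, ← hL, ← hΛ, ← hΛ', ← sub_div, sub_sub_sub_cancel_right, div_pow, pow_add]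
    field_simp
  have key : approxJet S D b N i w m y -
      taylorSum (k - m) (fun l => approxJet S D b N i w (m + l)) x y =
      Λ' / Λ ^ m * (ψ m ((y - L) / Λ) -
        taylorSum (k - m) (fun l => ψ (m + l)) ((x - L) / Λ) ((y - L) / Λ)) := by
    rw [hsum, approxJet, ← hψ, ← hL, ← hΛ, ← hΛ']; ring
  have hxy : |(y - L) / Λ - (x - L) / Λ| ^ (k - m) ≤ 1 := by
    refine pow_le_one₀ (abs_nonneg _) ?_
    rw [abs_le]
    constructor <;> linarith [hx.1, hx.2, hy.1, hy.2]
  rw [key, abs_mul, abs_of_nonneg (by positivity)]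
  calc _ ≤ Λ / Λ ^ m * (M * (K ^ ((k : ℝ) + ε - 1) * Λ ^ ((k : ℝ) + ε - 1))) := by
        refine mul_le_mul (div_le_div_of_nonneg_right hcl (by positivity)) ?_ (abs_nonneg _)
          (by positivity)
        refine hT.trans ((mul_le_of_le_one_right ?_ hxy).trans
          (mul_le_mul_of_nonneg_left (h.rho_rpow_le w _) hM))
        exact mul_nonneg hM (Real.rpow_nonneg (rhoS_nonneg h.matched.mem_Simp _ _) _)
    _ = _ := by rw [← mul_rpow_eq_rpow_sub hl hm]; ring

variable {i : Fin d} {A : ℝ} {H : ℕ → (ℕ → Fin d) → ℝ}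

lemma codeJet_taylor_of_le (h : IsPrepared k ε C S D M σ θ b p N K c θ') (hA : 0 ≤ A)
    (hH : IsCodeJet k ε S D b N i A H) {a a' : ℕ → Fin d} {n : ℕ} (haa : ∀ t < n, a t = a' t)
    (hn : N ≤ n) {m : ℕ} (hm : m ≤ k) :
    |H m a' - taylorSum (k - m) (fun l _ => H (m + l) a) (cascPt (truncData S b N) a)
      (cascPt (truncData S b N) a')| ≤
    (M * K ^ ((k : ℝ) + ε - 1) + A + (k + 1) * A) *
      cascLen (truncData S b N) (codeWord a n) ^ (((k - m : ℕ) : ℝ) + ε) := by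
  have hC := h.cascade
  have hl := hC.cascLen_pos (codeWord a n)
  have hy := hC.relPos_mem_I01 a' n
  have h1 := hH m hm a' n hn
  rw [← codeWord_congr haa] at hy h1
  have h2 := h.approxJet_taylor i (codeWord a n) hm (hC.relPos_mem_I01 a n) hy
  have hxy := hC.abs_cascPt_sub_le haa
  rw [abs_sub_comm] at hxy
  set x := cascPt (truncData S b N) a
  set y := cascPt (truncData S b N) a'
  set Λ := cascLen (truncData S b N) (codeWord a n) with hΛ
  have h3 : |taylorSum (k - m) (fun l => approxJet S D b N i (codeWord a n) (m + l)) x y -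
      taylorSum (k - m) (fun l _ => H (m + l) a) x y| ≤
      (k + 1) * (A * Λ ^ (((k - m : ℕ) : ℝ) + ε)) := by
    rw [taylorSum_sub]
    refine (abs_taylorSum_le (B := A * Λ ^ (((k - m : ℕ) : ℝ) + ε)) fun l hl' => ?_).trans ?_
    · have h4 := hH (m + l) (by omega) a n hn
      rw [abs_sub_comm] at h4
      calc _ ≤ A * Λ ^ (((k - (m + l) : ℕ) : ℝ) + ε) * Λ ^ l :=
            mul_le_mul h4 (pow_le_pow_left₀ (abs_nonneg _) hxy l) (by positivity) (by positivity)
        _ = _ := by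
          rw [mul_assoc, ← Real.rpow_natCast Λ l, ← Real.rpow_add hl]
          congr 2
          rw [show k - m = k - (m + l) + l by omega]
          push_cast; ring
    · refine mul_le_mul_of_nonneg_right ?_ (by positivity)
      have : ((k - m : ℕ) : ℝ) ≤ k := by exact_mod_cast Nat.sub_le k m
      linarith
  rw [abs_le] at h1 h2 h3 ⊢
  constructor <;> nlinarith

lemma exists_codeJet_taylor (h : IsPrepared k ε C S D M σ θ b p N K c θ') (hA : 0 ≤ A)
    (hH : IsCodeJet k ε S D b N i A H) : ∃ B, 0 ≤ B ∧ ∀ m ≤ k, ∀ a a',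
    |H m a' - taylorSum (k - m) (fun l _ => H (m + l) a) (cascPt (truncData S b N) a)
      (cascPt (truncData S b N) a')| ≤
    B * |cascPt (truncData S b N) a' - cascPt (truncData S b N) a| ^
      (((k - m : ℕ) : ℝ) + ε) := by
  obtain ⟨B, hB, hHB⟩ := h.exists_abs_codeJet_le hA hH
  have hC := h.cascade
  have hM := h.controlled.M_nonneg
  have hK := h.K_nonneg
  have hσ := h.controlled.σ_pos
  have hε := h.matched.ε_pos
  have hσ1 : σ ≤ 1 := (h.controlled.bounds b ⟨0, by have := h.matched.two_le; omega⟩).1.trans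
    ((h.matched.mem_Simp b).1 _).2.le
  set B' := M * K ^ ((k : ℝ) + ε - 1) + A + (k + 1) * A + (k + 2) * B / (σ ^ N) ^ (k + 1) with hB'
  have hB'0 : 0 ≤ B' := by positivity
  refine ⟨B' / σ ^ (k + 1), by positivity, fun m hm a a' => ?_⟩
  set x := cascPt (truncData S b N) a with hx
  set y := cascPt (truncData S b N) a' with hy
  have hek : ((k - m : ℕ) : ℝ) + ε ≤ ((k + 1 : ℕ) : ℝ) := by
    have : ((k - m : ℕ) : ℝ) ≤ k := by exact_mod_cast Nat.sub_le k m
    push_cast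
    linarith [h.matched.ε_le_one]
  have he0 : 0 ≤ ((k - m : ℕ) : ℝ) + ε := by positivity
  rcases eq_or_ne a a' with rfl | hne
  · have : H m a - taylorSum (k - m) (fun l _ => H (m + l) a) x y = 0 := by
      rw [taylorSum, Finset.sum_eq_single 0]
      · simp
      · intro l _ hl0
        simp [hx, hy, hl0]
      · simp
    rw [this, abs_zero]
    positivity
  · obtain ⟨n, hn, hn'⟩ := IsCascade.exists_first_ne hne
    have hsep := hC.le_abs_cascPt_sub hn hn'
    rw [abs_sub_comm, ← hx, ← hy] at hsep
    have hl := hC.cascLen_pos (codeWord a n)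
    have hlow := hC.pow_le_cascLen (codeWord a n)
    rw [codeWord_length] at hlow
    set Λ := cascLen (truncData S b N) (codeWord a n)
    have hscale : Λ ^ (((k - m : ℕ) : ℝ) + ε) ≤
        |y - x| ^ (((k - m : ℕ) : ℝ) + ε) / σ ^ (k + 1) := by
      rw [le_div_iff₀ (by positivity)]
      calc _ ≤ Λ ^ (((k - m : ℕ) : ℝ) + ε) * σ ^ (((k - m : ℕ) : ℝ) + ε) := by
            refine mul_le_mul_of_nonneg_left ?_ (by positivity)
            rw [← Real.rpow_natCast]
            exact Real.rpow_le_rpow_of_exponent_ge hσ hσ1 hek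
        _ = (σ * Λ) ^ (((k - m : ℕ) : ℝ) + ε) := by rw [mul_comm, Real.mul_rpow hσ.le hl.le]
        _ ≤ _ := Real.rpow_le_rpow (by positivity) hsep he0
    have hmain : |H m a' - taylorSum (k - m) (fun l _ => H (m + l) a) x y| ≤
        B' * Λ ^ (((k - m : ℕ) : ℝ) + ε) := by
      rcases le_or_gt N n with hNn | hNn
      · refine (h.codeJet_taylor_of_le hA hH hn hNn hm).trans ?_
        refine mul_le_mul_of_nonneg_right ?_ (by positivity)
        rw [hB']
        exact le_add_of_nonneg_right (by positivity)
      · have h1 : |taylorSum (k - m) (fun l _ => H (m + l) a) x y| ≤ (k + 1) * B := by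
          refine (abs_taylorSum_le (B := B) fun l hl' => ?_).trans ?_
          · refine (mul_le_of_le_one_right (abs_nonneg _) (pow_le_one₀ (abs_nonneg _) ?_)).trans
              (hHB (m + l) (by omega) a)
            exact abs_sub_le_one_of_mem_I01 (hC.cascPt_mem_I01 a') (hC.cascPt_mem_I01 a)
          · refine mul_le_mul_of_nonneg_right ?_ hB
            have : ((k - m : ℕ) : ℝ) ≤ k := by exact_mod_cast Nat.sub_le k m
            linarith
        have h2 : (σ ^ N) ^ (k + 1) ≤ Λ ^ (((k - m : ℕ) : ℝ) + ε) := by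
          calc (σ ^ N) ^ (k + 1) ≤ Λ ^ (k + 1) := pow_le_pow_left₀ (by positivity)
                ((pow_le_pow_of_le_one hσ.le hσ1 hNn.le).trans hlow) _
            _ = Λ ^ ((k + 1 : ℕ) : ℝ) := (Real.rpow_natCast _ _).symm
            _ ≤ _ := Real.rpow_le_rpow_of_exponent_ge hl (hC.cascLen_le_one _) hek
        calc _ ≤ B + (k + 1) * B := (abs_sub _ _).trans (add_le_add (hHB m hm a') h1)
          _ = (k + 2) * B / (σ ^ N) ^ (k + 1) * (σ ^ N) ^ (k + 1) := by field_simp; ring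
          _ ≤ B' * Λ ^ (((k - m : ℕ) : ℝ) + ε) := by
            refine mul_le_mul ?_ h2 (by positivity) hB'0
            rw [hB']
            exact le_add_of_nonneg_left (by positivity)
    refine hmain.trans ((mul_le_mul_of_nonneg_left hscale hB'0).trans_eq ?_)
    ring

end IsPrepared

end CodeJet

section Assembly

variable {d k : ℕ} {ε C M σ θ K c θ' : ℝ} {S : (ℕ → Fin d) → Fin (2 * d - 1) → ℝ}
  {D : (ℕ → Fin d) → (ℕ → Fin d) → ℕ → ℝ → ℝ} {b : ℕ → Fin d} {p : Fin d → ℕ} {N : ℕ}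

lemma extSeq_dword (b j : ℕ → Fin d) {n t : ℕ} (ht : t < n) : extSeq b (dword j n) t = j t := by
  induction n generalizing j t with
  | zero => omega
  | succ n ih =>
    rw [dword, List.ofFn_succ, extSeq_cons, consSeq]
    split_ifs with h0
    · subst h0; rfl
    · have := ih (fun m => j (m + 1)) (t := t - 1) (by omega)
      rw [Nat.sub_add_cancel (by omega)] at this
      rw [← this]; rfl

lemma IsCantorSystem.of_isHolderSmooth {g G : Fin d → ℝ → ℝ}
    {T : List (Fin d) → Fin (2 * d - 1) → ℝ}
    (hε : 0 < ε) (hT : IsCascade T σ θ) (hg : ∀ i, IsHolderSmooth ε k (g i))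
    (hG : ∀ i, ∀ x ∈ I01, HasDerivWithinAt (g i) (G i x) I01 x)
    (hG01 : ∀ i, ∀ x ∈ I01, G i x ∈ Ioo (0 : ℝ) 1)
    (hgT : ∀ i a, g i (cascPt T a) = cascPt T (consSeq i a)) : IsCantorSystem k ε g := by
  have hder : ∀ i, ∀ x ∈ I01, derivWithin (g i) I01 x = G i x := fun i x hx =>
    (hG i x hx).derivWithin (uniqueDiffOn_I01 x hx)
  have h0 : ∀ i, g i 0 = cascLeft T [i] := fun i => by
    simpa [wordMap, cascLeft] using (hT.wordMap_cascLeft hgT [i] []).1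
  have h1 : ∀ i, g i 1 = cascLeft T [i] + cascLen T [i] := fun i => by
    simpa [wordMap, cascLeft, cascLen] using (hT.wordMap_cascLeft hgT [i] []).2
  have hmono : ∀ i, StrictMonoOn (g i) I01 := fun i =>
    strictMonoOn_of_deriv_pos (convex_Icc 0 1) (fun x hx => (hG i x hx).continuousWithinAt)
      fun x hx => by
        have hx' := interior_subset hx
        rw [((hG i x hx').hasDerivAt (mem_interior_iff_mem_nhds.mp hx)).deriv]
        exact (hG01 i x hx').1
  have hd := hT.two_le
  refine ⟨fun i x hx => ?_, fun i => ((hg i).contDiffOn hε).1, fun i => ((hg i).contDiffOn hε).2,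
    fun i x hx => ?_, fun i x hx => ?_, fun i j hij => ?_, fun i hi => ?_, fun i hi => ?_⟩
  · have hz : (0 : ℝ) ∈ I01 := by simp
    have ho : (1 : ℝ) ∈ I01 := by simp
    have hl := hT.isFrame.subset (hT.cascLeft_mem [i])
    have hr := hT.isFrame.subset (hT.cascRight_mem [i])
    rw [← h0] at hl
    rw [← h1] at hr
    exact ⟨hl.1.trans ((hmono i).monotoneOn hz hx hx.1),
      ((hmono i).monotoneOn hx ho hx.2).trans hr.2⟩
  · rw [hder i x hx]; exact (hG01 i x hx).1
  · rw [hder i x hx]; exact (hG01 i x hx).2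
  · have hij' : (i : ℕ) < j := hij
    rw [h0, h1, cascRight_cons, cascLeft_cons]
    refine lt_of_lt_of_le ?_ (hT.cascPos_le [] (n := 2 * i + 1 + 1) (by omega) (by omega))
    rw [cascPos_succ _ _ (2 * i + 1)]
    exact lt_add_of_pos_right _ (mul_pos (hT.cascLen_pos _)
      (hT.σ_pos.trans_le (hT.σ_le_partLen _ (n := 2 * i + 1) (by omega))))
  · rw [h0, cascLeft_cons, hi, mul_zero, cascPos_zero, cascLeft]
  · rw [h1, cascRight_cons, hi, show 2 * (d - 1) + 1 = 2 * d - 1 by omega, hT.cascPos_last]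
    simp [cascLeft, cascLen]

namespace IsPrepared

lemma exists_branch_jet (h : IsPrepared k ε C S D M σ θ b p N K c θ') (i : Fin d) :
    ∃ F : ℕ → ℝ → ℝ, IsJet k I01 F ∧ (∃ K', 0 ≤ K' ∧ HolderBoundOn01 ε K' (F k)) ∧
      (∀ a, F 0 (cascPt (truncData S b N) a) = cascPt (truncData S b N) (consSeq i a)) ∧
      ∀ x ∈ range (cascPt (truncData S b N)), F 1 x ∈ Ioo (0 : ℝ) 1 := by
  obtain ⟨A, H, hA, hH⟩ := h.exists_isCodeJet i
  obtain ⟨B, hB, hHB⟩ := h.exists_codeJet_taylor hA hH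
  have : Nonempty (ℕ → Fin d) := ⟨b⟩
  have hinv := Function.leftInverse_invFun h.cascade.cascPt_injective
  obtain ⟨F, hF, hFH, hFC⟩ := whitney_extension h.cascade.isFrame h.matched.ε_pos
    h.matched.ε_le_one k (fun m x => H m (Function.invFun (cascPt (truncData S b N)) x)) B hB (by
      rintro m hm _ ⟨a, rfl⟩ _ ⟨a', rfl⟩
      have := hHB m hm a a'
      simp only [taylorSum] at this ⊢
      simpa only [hinv a, hinv a'] using this)
  refine ⟨F, hF, hFH, fun a => ?_, ?_⟩
  · rw [hFC 0 (Nat.zero_le _) _ ⟨a, rfl⟩, hinv a, h.codeJet_zero hA hH]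
  · rintro _ ⟨a, rfl⟩
    have h1 := h.codeJet_one hA hH a
    rw [hFC 1 h.matched.one_le _ ⟨a, rfl⟩, hinv a]
    exact ⟨h.c_pos.trans_le h1.1, h1.2.trans_lt h.θ'_lt_one⟩

lemma gap_bounds (h : IsPrepared k ε C S D M σ θ b p N K c θ') {f : Fin d → ℝ → ℝ}
    (hf : ∀ i a, f i (cascPt (truncData S b N) a) = cascPt (truncData S b N) (consSeq i a))
    (i : Fin d) {x y : ℝ} (hxy : IsGap (range (cascPt (truncData S b N))) x y) :
    c * (y - x) ≤ f i y - f i x ∧ f i y - f i x ≤ θ' * (y - x) := by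
  obtain ⟨w, l, l', hl, rfl, rfl⟩ := h.cascade.exists_of_isGap hxy
  have hy : f i _ = _ := (h.cascade.wordMap_cascLeft hf [i] (l' :: w)).1
  have hx : f i _ = _ := (h.cascade.wordMap_cascLeft hf [i] (l :: w)).2
  obtain ⟨m, hm⟩ := exists_eq_partLen (d := d) (2 * l + 1) (by omega)
  have e : ∀ v, cascLeft (truncData S b N) (l' :: v) -
      (cascLeft (truncData S b N) (l :: v) + cascLen (truncData S b N) (l :: v)) =
      cascLen (truncData S b N) v * truncData S b N v m := fun v => by
    rw [cascRight_cons, cascLeft_cons, hl, show 2 * ((l : ℕ) + 1) = 2 * l + 1 + 1 by ring,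
      cascPos_succ, hm]
    ring
  rw [hx, hy, e, List.cons_append, List.cons_append, e]
  exact h.ratio i w m

theorem exists_system (h : IsPrepared k ε C S D M σ θ b p N K c θ') :
    ∃ g : Fin d → ℝ → ℝ, IsCantorSystem k ε g ∧ HasScalingFunction g S := by
  choose F hF hFH hF0 hF1 using h.exists_branch_jet
  obtain ⟨k, rfl⟩ : ∃ l, k = l + 1 := ⟨k - 1, by have := h.matched.one_le; omega⟩
  have key := fun i => exists_increasing_contraction h.cascade.isFrame h.matched.ε_pos
    h.matched.ε_le_one ((hF i).shift.isHolderSmooth (hFH i)) (hF i 0 (Nat.succ_pos k)) (hF1 i)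
    h.c_pos h.θ'_lt_one (fun x y hxy => h.gap_bounds hF0 i hxy)
  choose g G hG hgG hG01 hgC using key
  have hg : ∀ i a, g i (cascPt (truncData S b N) a) = cascPt (truncData S b N) (consSeq i a) :=
    fun i a => by rw [hgC i _ ⟨a, rfl⟩, hF0]
  refine ⟨g, .of_isHolderSmooth h.matched.ε_pos h.cascade (fun i => ⟨G i, hgG i, hG i⟩) hgG hG01 hg,
    fun j => ?_⟩
  have hlim : Tendsto (fun n => extSeq b (dword j n)) atTop (nhds j) :=
    tendsto_pi_nhds.mpr fun t => tendsto_const_nhds.congr' <| by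
      filter_upwards [eventually_gt_atTop t] with n hn using (extSeq_dword b j hn).symm
  refine ((h.matched.cont.tendsto j).comp hlim).congr' ?_
  filter_upwards [eventually_ge_atTop N] with n hn
  rw [h.cascade.scalingData_eq hg, truncData_of_le (by simpa [dword] using hn), Function.comp]

end IsPrepared

theorem IsMatched.exists_system (h : IsMatched k ε C S) :
    ∃ g : Fin d → ℝ → ℝ, IsCantorSystem k ε g ∧ HasScalingFunction g S := by
  obtain ⟨D, M, σ, θ, hD⟩ := h.exists_isControlled
  obtain ⟨b, p, hb⟩ := exists_isTail h.two_le
  obtain ⟨N, K, c, θ', hK, hc, hθ', hrho, hratio⟩ := hD.exists_truncation h b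
  exact IsPrepared.exists_system ⟨h, hD, hb, hK, hc, hθ', hrho, hratio⟩

end Assembly

/-- Main Theorem, sufficiency: if `S : Σ_d^dual → Simp_{2d-2}` is continuous
and satisfies the matching condition (for all `j ≠ j'`, `j₀`, the intersection
`D^k_var(C ρ_S(j₀j,j₀j')^{k+ε-1})(A(j₀j),A(j₀j')) ∩ R_{j₀}(D^k_var(C ρ_S(j,j')^{k+ε-1})(A(j),A(j')))`
is nonempty), then `S` is the scaling function of a `C^{k+ε}` Cantor system. -/
theorem stmt15 (d k : ℕ) (hd : 2 ≤ d) (hk : 1 ≤ k) (hkd : k < 2*d)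
    (ε : ℝ) (hε : ε ∈ Set.Ioc (0:ℝ) 1)
    (S : (ℕ → Fin d) → Fin (2*d-1) → ℝ) (hSsimp : ∀ j, S j ∈ Simp d)
    (hScont : Continuous S)
    (C : ℝ) (hC : 0 < C)
    (hmain : ∀ j j' : ℕ → Fin d, ∀ p : ℕ,
      (∀ t < p, j t = j' t) → j p ≠ j' p →
      ∀ j₀ : Fin d, ∃ ψ : ℝ → ℝ,
        ψ ∈ DkVar k (C * rhoS S j p ^ ((k : ℝ) + ε - 1)) (Apts (S j)) (Apts (S j')) ∧
        Rmap (S j) (S j') j₀ ψ ∈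
          DkVar k (C * rhoS S (consSeq j₀ j) (p + 1) ^ ((k : ℝ) + ε - 1))
            (Apts (S (consSeq j₀ j))) (Apts (S (consSeq j₀ j')))) :
    ∃ g : Fin d → ℝ → ℝ, IsCantorSystem k ε g ∧ HasScalingFunction g S := by
  exact IsMatched.exists_system ⟨hd, hk, hkd, hε.1, hε.2, hSsimp, hScont, hC, hmain⟩
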